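/- arXiv:2412.20208 — 4 statements merged into one kernel-verified Lean document; each statement's English description precedes it below -/
import Mathlib

section
/- Let X be a nontrivial finite group with k := k(X) conjugacy classes, let H ≤ Sym({1,…,n}) be a primitive permutation group, and let G = X ≀ H. Suppose H is not permutation-isomorphic to any of the following: (i) Alt(n) or Sym(n) in their natural action on n points; (ii) Alt(m) or Sym(m) acting on the set of 2-element subsets of {1,…,m}, where n = m(m−1)/2; (iii) a group H with (Alt(m))² ≤ H ≤ Sym(m) ≀ Sym(2) in the product action on {1,…,m}², where n = m². Then there exists an absolute constant C such that whenever n ≥ C or k ≥ C, one has k^n/|H| ≤ k(G) < (1 + 1/(kn)) · k^n/|H|. -/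
open Equiv MulAction

/-- The number of conjugacy classes of a group. -/
noncomputable def kclass (G : Type*) [Group G] : ℕ := Nat.card (ConjClasses G)

/-- The coordinate-permuting action of `Perm ι` on `ι → X`, as automorphisms. -/
def permAut (ι X : Type*) [Group X] : Perm ι →* MulAut (ι → X) where
  toFun e :=
    { toFun := fun f => f ∘ e.symm
      invFun := fun f => f ∘ e
      left_inv := fun f => by funext i; simp
      right_inv := fun f => by funext i; simp
      map_mul' := fun f g => rfl }
  map_one' := by ext f; rfl
  map_mul' := fun e₁ e₂ => by ext f; rfl

/-- The wreath product `X ≀ H` of a group `X` with a permutation group `H ≤ Perm ι`,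
i.e. the semidirect product `X^ι ⋊ H` where `H` permutes the direct factors of `X^ι`. -/
abbrev Wreath (X : Type*) [Group X] {ι : Type*} (H : Subgroup (Perm ι)) :=
  SemidirectProduct (ι → X) H ((permAut ι X).comp H.subtype)

/-- A group acting on `Ω` acts on the functions `Ω → S` by permuting coordinates. -/
instance funMulAction (G Ω S : Type*) [Group G] [MulAction G Ω] : MulAction G (Ω → S) where
  smul g f := fun ω => f (g⁻¹ • ω)
  one_smul f := funext fun ω => by
    show f ((1 : G)⁻¹ • ω) = f ω
    rw [inv_one, one_smul]
  mul_smul g h f := funext fun ω => by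
    show f ((g * h)⁻¹ • ω) = f (h⁻¹ • g⁻¹ • ω)
    rw [mul_inv_rev, mul_smul]

/-- `σ(h)`: the number of cycles of a permutation `h` in its disjoint cycle decomposition,
with fixed points counted as cycles of length 1; equivalently, the number of orbits of
the cyclic group generated by `h`. -/
noncomputable def cycleCount {ι : Type*} (h : Perm ι) : ℕ :=
  Nat.card (orbitRel.Quotient (Subgroup.zpowers h) ι)

/-- `n(G, α)`: the number of orbits of a group action. -/
noncomputable def orbitCount (G : Type*) [Group G] (α : Type*) [MulAction G α] : ℕ :=
  Nat.card (orbitRel.Quotient G α)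

/-- The natural action of `Perm (Fin m)` on the set of `ℓ`-element subsets of `{1, …, m}`. -/
instance subsetsMulAction (m ℓ : ℕ) :
    MulAction (Perm (Fin m)) {s : Finset (Fin m) // s.card = ℓ} where
  smul g s := ⟨s.1.image g, by rw [Finset.card_image_of_injective _ g.injective, s.2]⟩
  one_smul s := Subtype.ext (by
    show Finset.image ⇑(1 : Perm (Fin m)) s.1 = s.1
    simp)
  mul_smul g h s := Subtype.ext (by
    show Finset.image ⇑(g * h) s.1 = Finset.image ⇑g (Finset.image ⇑h s.1)
    simp [Finset.image_image, Function.comp_def])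

/-- The set of `ℓ`-element subsets of `{1, …, m}`. -/
abbrev Omega (m ℓ : ℕ) := {s : Finset (Fin m) // s.card = ℓ}

/-- The homomorphism `Sym(m) → Sym(Ω)` induced by the action on `ℓ`-subsets. -/
def subsetsHom (m ℓ : ℕ) : Perm (Fin m) →* Perm (Omega m ℓ) :=
  MulAction.toPermHom _ _

/-- Transport of permutations along a bijection. -/
def permCongrHom {α β : Type*} (e : α ≃ β) : Perm α →* Perm β where
  toFun p := (e.symm.trans p).trans e
  map_one' := by ext x; simp
  map_mul' p q := by ext x; simp

/-- Two permutation groups are permutation-isomorphic if a bijection of the underlying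
sets carries one onto the other. -/
def PermIso {α β : Type*} (H : Subgroup (Perm α)) (K : Subgroup (Perm β)) : Prop :=
  ∃ e : α ≃ β, Subgroup.map (permCongrHom e) H = K

/-- The pair embedding `Sym(m) × Sym(m) → Sym({1,…,m}²)`. -/
def prodCongrHom (m : ℕ) : Perm (Fin m) × Perm (Fin m) →* Perm (Fin m × Fin m) where
  toFun p := Equiv.prodCongr p.1 p.2
  map_one' := Equiv.ext fun x => by simp
  map_mul' p q := Equiv.ext fun x => by obtain ⟨a, b⟩ := x; simp

/-- `(Alt m)²` acting on `{1,…,m}²` in product action. -/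
def altSquare (m : ℕ) : Subgroup (Perm (Fin m × Fin m)) :=
  Subgroup.map (prodCongrHom m) ((alternatingGroup (Fin m)).prod (alternatingGroup (Fin m)))

/-- `Sym m ≀ Sym 2` acting on `{1,…,m}²` in product action. -/
def symWrSym2 (m : ℕ) : Subgroup (Perm (Fin m × Fin m)) :=
  Subgroup.map (prodCongrHom m) ⊤ ⊔ Subgroup.zpowers (Equiv.prodComm (Fin m) (Fin m))


set_option linter.all false
set_option linter.deprecated false

section Els
variable {Ω : Type*} [Fintype Ω] [DecidableEq Ω]

/-- The elements of a permutation group as a finset. -/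
noncomputable def els (H : Subgroup (Perm Ω)) : Finset (Perm Ω) := by
  classical exact Finset.univ.filter (· ∈ H)

@[simp] lemma mem_els {H : Subgroup (Perm Ω)} {g : Perm Ω} : g ∈ els H ↔ g ∈ H := by
  classical simp [els]

lemma card_els (H : Subgroup (Perm Ω)) : (els H).card = Nat.card H := by
  classical
  rw [Nat.card_eq_fintype_card, Fintype.card_subtype]
  congr 1

end Els

section Wr
variable {ι : Type*} [Fintype ι] [DecidableEq ι]

/-- number of `g`-invariant colourings by conjugacy classes -/
noncomputable def invCol (X : Type*) [Group X] (g : Perm ι) : ℕ :=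
  Nat.card {γ : ι → ConjClasses X // ∀ i, γ (g⁻¹ i) = γ i}

/-- pairs of base parts such that the corresponding wreath elements commute -/
def wrPairs (X : Type*) [Group X] (g h : Perm ι) : Set ((ι → X) × (ι → X)) :=
  {p | ∀ i, p.1 i * p.2 (g⁻¹ i) = p.2 i * p.1 (h⁻¹ i)}

lemma wr_class_sum (X : Type*) [Group X] [Fintype X] [DecidableEq X] [DecidableEq (ConjClasses X)]
    (γ : ConjClasses X) :
    ∑ x ∈ Finset.univ.filter (fun x : X => ConjClasses.mk x = γ),
      (Finset.univ.filter (fun a : X => x * a = a * x)).card = Fintype.card X := by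
  classical
  obtain ⟨x0, rfl⟩ := ConjClasses.exists_rep γ
  -- count pairs via conjugators
  have h1 : ∀ x ∈ Finset.univ.filter (fun x : X => ConjClasses.mk x = ConjClasses.mk x0),
      (Finset.univ.filter (fun a : X => x * a = a * x)).card
        = (Finset.univ.filter (fun a : X => a * x0 * a⁻¹ = x)).card := by
    intro x hx
    simp only [Finset.mem_filter, Finset.mem_univ, true_and] at hx
    rw [ConjClasses.mk_eq_mk_iff_isConj, isConj_comm, isConj_iff] at hx
    obtain ⟨c, hc⟩ := hx
    apply Finset.card_bij (fun a _ => a * c)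
    · intro a ha
      simp only [Finset.mem_filter, Finset.mem_univ, true_and] at ha ⊢
      calc a * c * x0 * (a * c)⁻¹ = a * (c * x0 * c⁻¹) * a⁻¹ := by group
        _ = a * x * a⁻¹ := by rw [hc]
        _ = x := by rw [← ha]; group
    · intro a _ b _ hab
      exact mul_right_cancel hab
    · intro b hb
      simp only [Finset.mem_filter, Finset.mem_univ, true_and] at hb
      refine ⟨b * c⁻¹, ?_, by group⟩
      simp only [Finset.mem_filter, Finset.mem_univ, true_and]
      have : b * x0 = x * b := by rw [← hb]; group
      calc x * (b * c⁻¹) = (x * b) * c⁻¹ := by group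
        _ = b * x0 * c⁻¹ := by rw [this]
        _ = b * c⁻¹ * (c * x0 * c⁻¹) := by group
        _ = b * c⁻¹ * x := by rw [hc]
  rw [Finset.sum_congr rfl h1]
  rw [← Finset.card_eq_sum_card_fiberwise (s := Finset.univ) (f := fun a : X => a * x0 * a⁻¹)]
  · simp
  · intro a _
    simp only [Finset.coe_filter, Finset.mem_univ, true_and, Set.mem_setOf_eq]
    rw [ConjClasses.mk_eq_mk_iff_isConj, isConj_comm, isConj_iff]
    exact ⟨a, rfl⟩

lemma wr_single (X : Type*) [Group X] [Finite X] (g : Perm ι) :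
    Nat.card {p : (ι → X) × (ι → X) // ∀ i, p.2 i * p.1 i = p.1 i * p.2 (g⁻¹ i)} ≤
      Nat.card X ^ Fintype.card ι * invCol X g := by
  classical
  have := Fintype.ofFinite X
  have hC := Fintype.ofFinite (ConjClasses X)
  -- number of (a,c) = sum over c of prod over i
  have e1 : Nat.card {p : (ι → X) × (ι → X) // ∀ i, p.2 i * p.1 i = p.1 i * p.2 (g⁻¹ i)}
      = ∑ c : ι → X, ∏ i, (Finset.univ.filter (fun a : X => c i * a = a * c (g⁻¹ i))).card := by
    rw [Nat.card_eq_fintype_card, Fintype.card_subtype]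
    rw [Finset.card_eq_sum_card_fiberwise (f := fun p : (ι → X) × (ι → X) => p.2)
      (t := Finset.univ) (by intro _ _; simp)]
    refine Finset.sum_congr rfl fun c _ => ?_
    rw [← Fintype.card_piFinset]
    apply Finset.card_bij (fun p _ => p.1)
    · intro p hp
      simp only [Finset.mem_filter, Finset.mem_univ, true_and] at hp
      obtain ⟨h1, rfl⟩ := hp
      simp only [Fintype.mem_piFinset, Finset.mem_filter, Finset.mem_univ, true_and]
      exact h1
    · intro p hp q hq h
      simp only [Finset.mem_filter, Finset.mem_univ, true_and] at hp hq
      exact Prod.ext h (hp.2.trans hq.2.symm)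
    · intro a ha
      simp only [Fintype.mem_piFinset, Finset.mem_filter, Finset.mem_univ, true_and] at ha
      exact ⟨(a, c), by simpa using ha, rfl⟩
  rw [e1]
  set I : Finset (ι → ConjClasses X) := Finset.univ.filter (fun γ => ∀ i, γ (g⁻¹ i) = γ i) with hI
  have hIc : invCol X g = I.card := by
    rw [invCol, Nat.card_eq_fintype_card, Fintype.card_subtype]
  rw [hIc]
  have e2 : ∑ c : ι → X, ∏ i, (Finset.univ.filter (fun a : X => c i * a = a * c (g⁻¹ i))).card
      ≤ ∑ γ ∈ I, ∑ c ∈ Fintype.piFinset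
          (fun i => Finset.univ.filter (fun x : X => ConjClasses.mk x = γ i)),
          ∏ i, (Finset.univ.filter (fun a : X => c i * a = a * c i)).card := by
    have hfib : ∀ γ : ι → ConjClasses X, Fintype.piFinset
          (fun i => Finset.univ.filter (fun x : X => ConjClasses.mk x = γ i))
        = Finset.univ.filter (fun c : ι → X => (fun i => ConjClasses.mk (c i)) = γ) := by
      intro γ; ext c; simp [funext_iff]
    simp_rw [hfib]
    have hstep : ∀ c : ι → X, ∏ i, (Finset.univ.filter (fun a : X => c i * a = a * c (g⁻¹ i))).card
        ≤ if (fun i => ConjClasses.mk (c i)) ∈ I then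
          ∏ i, (Finset.univ.filter (fun a : X => c i * a = a * c i)).card else 0 := by
      intro c
      by_cases hex : ∀ i, ∃ a : X, c i * a = a * c (g⁻¹ i)
      · have hin : (fun i => ConjClasses.mk (c i)) ∈ I := by
          simp only [hI, Finset.mem_filter, Finset.mem_univ, true_and]
          intro i
          obtain ⟨a, ha⟩ := hex i
          rw [ConjClasses.mk_eq_mk_iff_isConj, isConj_iff]
          exact ⟨a, by rw [← ha]; group⟩
        rw [if_pos hin]
        refine Finset.prod_le_prod' fun i _ => ?_
        obtain ⟨a0, ha0⟩ := hex i
        apply Finset.card_le_card_of_injOn (fun a => a * a0⁻¹)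
        · intro a ha
          simp only [Finset.coe_filter, Finset.mem_univ, true_and, Set.mem_setOf_eq] at ha ⊢
          have h2 : c (g⁻¹ i) = a0⁻¹ * c i * a0 := by
            rw [mul_assoc, ha0]; group
          calc c i * (a * a0⁻¹) = (c i * a) * a0⁻¹ := by group
            _ = a * c (g⁻¹ i) * a0⁻¹ := by rw [ha]
            _ = a * a0⁻¹ * c i := by rw [h2]; group
        · intro a _ b _ hab
          exact mul_right_cancel hab
      · push Not at hex
        obtain ⟨i, hi⟩ := hex
        have : (Finset.univ.filter (fun a : X => c i * a = a * c (g⁻¹ i))).card = 0 := by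
          rw [Finset.card_eq_zero, Finset.filter_eq_empty_iff]
          intro a _; exact hi a
        rw [Finset.prod_eq_zero (Finset.mem_univ i) this]
        exact Nat.zero_le _
    refine (Finset.sum_le_sum fun c _ => hstep c).trans ?_
    rw [← Finset.sum_filter]
    rw [← Finset.sum_fiberwise_of_maps_to (s := Finset.univ.filter
      (fun c : ι → X => (fun i => ConjClasses.mk (c i)) ∈ I)) (t := I)
      (g := fun c : ι → X => (fun i => ConjClasses.mk (c i)))]
    · refine Finset.sum_le_sum fun γ hγ => ?_
      apply le_of_eq
      apply Finset.sum_congr _ (fun _ _ => rfl)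
      ext c
      simp only [Finset.mem_filter, Finset.mem_univ, true_and]
      constructor
      · exact fun h => h.2
      · rintro rfl; exact ⟨hγ, rfl⟩
    · intro c hc
      simpa using hc
  refine e2.trans ?_
  have e3 : ∀ γ ∈ I, ∑ c ∈ Fintype.piFinset
          (fun i => Finset.univ.filter (fun x : X => ConjClasses.mk x = γ i)),
          ∏ i, (Finset.univ.filter (fun a : X => c i * a = a * c i)).card
        = Nat.card X ^ Fintype.card ι := by
    intro γ _
    rw [← Finset.prod_univ_sum (fun i => Finset.univ.filter (fun x : X => ConjClasses.mk x = γ i))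
      (fun _ x => (Finset.univ.filter (fun a : X => x * a = a * x)).card)]
    rw [Finset.prod_congr rfl (fun i _ => wr_class_sum X (γ i))]
    simp
  rw [Finset.sum_congr rfl e3]
  simp [mul_comm]

lemma wr_pairs_le (X : Type*) [Group X] [Finite X] (g h : Perm ι) :
    Nat.card (wrPairs X g h) ≤ Nat.card X ^ Fintype.card ι * invCol X g := by
  classical
  refine le_trans ?_ (wr_single X g)
  -- choose a base solution for every first component
  let b0 : (ι → X) → (ι → X) := fun a =>
    if hh : ∃ b, (a, b) ∈ wrPairs X g h then hh.choose else 1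
  have hb0 : ∀ a b, (a, b) ∈ wrPairs X g h → (a, b0 a) ∈ wrPairs X g h := by
    intro a b hab
    have hh : ∃ b, (a, b) ∈ wrPairs X g h := ⟨b, hab⟩
    simp only [b0, dif_pos hh]
    exact hh.choose_spec
  refine Nat.card_le_card_of_injective
    (fun p : wrPairs X g h => (⟨(p.1.1, p.1.2 * (b0 p.1.1)⁻¹), ?_⟩ :
      {p : (ι → X) × (ι → X) // ∀ i, p.2 i * p.1 i = p.1 i * p.2 (g⁻¹ i)})) ?_
  · obtain ⟨⟨a, b⟩, hab⟩ := p
    have h0 := hb0 a b hab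
    intro i
    have h1 : a i * b (g⁻¹ i) = b i * a (h⁻¹ i) := hab i
    have h2 : a i * b0 a (g⁻¹ i) = b0 a i * a (h⁻¹ i) := h0 i
    simp only [Pi.mul_apply, Pi.inv_apply]
    have e1 : b i = a i * b (g⁻¹ i) * (a (h⁻¹ i))⁻¹ := by rw [h1]; group
    have e2 : b0 a i = a i * b0 a (g⁻¹ i) * (a (h⁻¹ i))⁻¹ := by rw [h2]; group
    rw [e1, e2]; group
  · rintro ⟨⟨a, b⟩, hab⟩ ⟨⟨a', b'⟩, hab'⟩ hh
    simp only [Subtype.mk.injEq, Prod.mk.injEq] at hh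
    obtain ⟨rfl, h2⟩ := hh
    have := mul_right_cancel h2
    subst this; rfl

lemma wr_pairs_swap (X : Type*) [Group X] (g h : Perm ι) :
    Nat.card (wrPairs X g h) = Nat.card (wrPairs X h g) := by
  refine Nat.card_congr ⟨fun p => ⟨p.1.swap, fun i => (p.2 i).symm⟩,
    fun p => ⟨p.1.swap, fun i => (p.2 i).symm⟩, fun _ => rfl, fun _ => rfl⟩

lemma wr_pairs_one (X : Type*) [Group X] [Finite X] :
    Nat.card (wrPairs X (1 : Perm ι) 1) = (kclass X * Nat.card X) ^ Fintype.card ι := by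
  rw [kclass, ← card_comm_eq_card_conjClasses_mul_card]
  rw [← Nat.card_eq_fintype_card, ← Nat.card_fun]
  refine Nat.card_congr ⟨fun p i => ⟨(p.1.1 i, p.1.2 i), by show _ * _ = _ * _; simpa using p.2 i⟩,
    fun f => ⟨(fun i => (f i).1.1, fun i => (f i).1.2), fun i => by simpa using (f i).2.eq⟩,
    fun _ => rfl, fun _ => rfl⟩

lemma wr_commute_iff (X : Type*) [Group X] (H : Subgroup (Perm ι)) (u v : Wreath X H) :
    Commute u v ↔ (u.left, v.left) ∈ wrPairs X u.right.1 v.right.1 ∧ Commute u.right v.right := by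
  rw [Commute, SemiconjBy, SemidirectProduct.ext_iff, SemidirectProduct.mul_left,
    SemidirectProduct.mul_left, SemidirectProduct.mul_right, SemidirectProduct.mul_right]
  refine and_congr ?_ Iff.rfl
  rw [funext_iff]
  rfl

theorem wreath_bounds (X : Type*) [Group X] [Finite X] (H : Subgroup (Perm ι)) :
    kclass X ^ Fintype.card ι ≤ kclass (Wreath X H) * Nat.card H ∧
    kclass (Wreath X H) * Nat.card H ≤ kclass X ^ Fintype.card ι +
      ∑ p ∈ (els H ×ˢ els H).erase (1, 1), min (invCol X p.1) (invCol X p.2) := by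
  classical
  have hXpos : 0 < Nat.card X ^ Fintype.card ι := pow_pos Nat.card_pos _
  have hfinG : Finite (Wreath X H) := Finite.of_equiv _ SemidirectProduct.equivProd.symm
  have hG : Nat.card (Wreath X H) = Nat.card X ^ Fintype.card ι * Nat.card H := by
    rw [SemidirectProduct.card, Nat.card_fun, Nat.card_eq_fintype_card (α := ι)]
  have hcomm := card_comm_eq_card_conjClasses_mul_card (Wreath X H)
  rw [hG] at hcomm
  constructor
  · have : (kclass X * Nat.card X) ^ Fintype.card ι
        ≤ Nat.card {p : Wreath X H × Wreath X H // Commute p.1 p.2} := by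
      rw [← wr_pairs_one (ι := ι)]
      refine Nat.card_le_card_of_injective
        (fun p => ⟨(⟨p.1.1, 1⟩, ⟨p.1.2, 1⟩), ?_⟩) ?_
      · rw [wr_commute_iff]
        exact ⟨p.2, Commute.one_left _⟩
      · rintro ⟨⟨a, b⟩, hab⟩ ⟨⟨a', b'⟩, hab'⟩ hh
        simp only [Subtype.mk.injEq, Prod.mk.injEq, SemidirectProduct.ext_iff, and_true] at hh
        obtain ⟨rfl, rfl⟩ := hh
        rfl
    rw [hcomm, mul_pow] at this
    refine Nat.le_of_mul_le_mul_right (c := Nat.card X ^ Fintype.card ι) ?_ hXpos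
    refine this.trans (le_of_eq ?_)
    rw [kclass]; ring
  · have : Nat.card {p : Wreath X H × Wreath X H // Commute p.1 p.2}
        ≤ ∑ p ∈ (els H ×ˢ els H), Nat.card (wrPairs X p.1 p.2) := by
      have hs : ∑ p ∈ (els H ×ˢ els H), Nat.card (wrPairs X p.1 p.2)
          = Nat.card (Σ p : {p // p ∈ els H ×ˢ els H}, wrPairs X p.1.1 p.1.2) := by
        rw [Nat.card_sigma]
        rw [Finset.univ_eq_attach]
        exact (Finset.sum_attach (els H ×ˢ els H)
          (fun p => Nat.card (wrPairs X p.1 p.2))).symm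
      rw [hs]
      refine Nat.card_le_card_of_injective
        (fun p => ⟨⟨(p.1.1.right.1, p.1.2.right.1), by simp⟩,
          ⟨(p.1.1.left, p.1.2.left), ((wr_commute_iff X H _ _).1 p.2).1⟩⟩) ?_
      rintro ⟨⟨⟨a, g⟩, ⟨b, h⟩⟩, hab⟩ ⟨⟨⟨a', g'⟩, ⟨b', h'⟩⟩, hab'⟩ hh
      simp only [Sigma.mk.injEq, Subtype.mk.injEq, Prod.mk.injEq] at hh
      obtain ⟨⟨h1, h2⟩, h3⟩ := hh
      have h1' : g = g' := Subtype.ext h1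
      have h2' : h = h' := Subtype.ext h2
      subst h1' h2'
      simp only [heq_eq_eq, Subtype.mk.injEq, Prod.mk.injEq] at h3
      obtain ⟨rfl, rfl⟩ := h3
      rfl
    rw [hcomm] at this
    have hmem : ((1 : Perm ι), (1 : Perm ι)) ∈ els H ×ˢ els H := by simp
    rw [← Finset.add_sum_erase _ _ hmem, wr_pairs_one] at this
    refine Nat.le_of_mul_le_mul_right (c := Nat.card X ^ Fintype.card ι) ?_ hXpos
    calc kclass (Wreath X H) * Nat.card H * Nat.card X ^ Fintype.card ι
        = Nat.card (ConjClasses (Wreath X H)) * (Nat.card X ^ Fintype.card ι * Nat.card H) := by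
          rw [kclass]; ring
      _ ≤ _ := this
      _ ≤ _ := by
        rw [add_mul, mul_pow]
        refine Nat.add_le_add_left ?_ _
        rw [Finset.sum_mul]
        refine Finset.sum_le_sum fun p _ => ?_
        rw [mul_comm, ← Nat.mul_min_mul_left]
        refine le_min (wr_pairs_le X _ _) ?_
        rw [wr_pairs_swap]
        exact wr_pairs_le X _ _

end Wr

section Red
variable {Ω : Type*} [Fintype Ω] [DecidableEq Ω]

/-- number of cycles (including fixed points) -/
noncomputable def nq (g : Perm Ω) : ℕ := Nat.card (Quotient (Equiv.Perm.SameCycle.setoid g))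

lemma nq_bound (g : Perm Ω) : 2 * nq g + g.support.card ≤ 2 * Fintype.card Ω := by
  classical
  let S := Equiv.Perm.SameCycle.setoid g
  have : Fintype (Quotient S) := Fintype.ofFinite _
  let R : Finset Ω := Finset.univ.image (fun q : Quotient S => q.out)
  have hR : R.card = nq g := by
    rw [Finset.card_image_of_injective _ Quotient.out_injective, nq, Nat.card_eq_fintype_card]
    rfl
  have hgR : (R.image g).card = nq g := by
    rw [Finset.card_image_of_injective _ g.injective, hR]
  have hinter : R ∩ R.image g ⊆ g.supportᶜ := by
    intro x hx
    simp only [Finset.mem_inter, Finset.mem_image, R, Finset.mem_univ, true_and] at hx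
    obtain ⟨⟨q, rfl⟩, y, ⟨q', rfl⟩, hy⟩ := hx
    have hs : S (q'.out) (q.out) := ⟨1, by simpa using hy⟩
    have : q' = q := by
      rw [← Quotient.out_eq q', ← Quotient.out_eq q]
      exact Quotient.sound hs
    subst this
    simp [hy]
  have h1 := Finset.card_union_add_card_inter R (R.image g)
  have h2 : (R ∪ R.image g).card ≤ Fintype.card Ω := Finset.card_le_univ _
  have h3 := Finset.card_le_card hinter
  rw [Finset.card_compl] at h3
  have h4 : g.support.card ≤ Fintype.card Ω := Finset.card_le_univ _
  omega

lemma invCol_le (X : Type*) [Group X] [Finite X] (g : Perm Ω) :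
    invCol X g ≤ kclass X ^ nq g := by
  classical
  let S := Equiv.Perm.SameCycle.setoid g
  have : Fintype (Quotient S) := Fintype.ofFinite _
  rw [invCol, kclass, nq, ← Nat.card_fun]
  refine Nat.card_le_card_of_injective (fun γ q => γ.1 q.out) ?_
  rintro ⟨γ, hγ⟩ ⟨δ, hδ⟩ h
  have key : ∀ γ : Ω → ConjClasses X, (∀ i, γ (g⁻¹ i) = γ i) → ∀ x y, S x y → γ x = γ y := by
    intro γ hγ x y hxy
    have h1 : ∀ i, γ (g i) = γ i := fun i => by simpa using (hγ (g i)).symm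
    obtain ⟨m, hm⟩ := hxy
    have : ∀ m : ℕ, ∀ x, γ ((g ^ m) x) = γ x := by
      intro m
      induction m with
      | zero => simp
      | succ m ih => intro x; rw [pow_succ']; simp [h1, ih]
    have h2 : ∀ m : ℤ, ∀ x, γ ((g ^ m) x) = γ x := by
      intro m x
      obtain ⟨k, rfl | rfl⟩ := m.eq_nat_or_neg
      · exact_mod_cast this k x
      · have := this k ((g ^ (-(k:ℤ))) x)
        rw [← this]; simp
    rw [← hm, h2]
  apply Subtype.ext
  funext x
  have hx : S (Quotient.mk S x).out x := Quotient.mk_out (s := S) x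
  have := congrFun h (Quotient.mk S x)
  simp only at this
  show γ x = δ x
  rw [← key γ hγ _ _ hx, ← key δ hδ _ _ hx]
  exact this

lemma supp_ge_four {H : Subgroup (Perm Ω)} (hH : IsPreprimitive H Ω)
    (hA : ¬ alternatingGroup Ω ≤ H) {g : Perm Ω} (hg : g ∈ H) (h1 : g ≠ 1) :
    4 ≤ g.support.card := by
  by_contra hlt
  have h0 : g.support.card ≠ 0 := by
    rw [Ne, Finset.card_eq_zero, Equiv.Perm.support_eq_empty_iff]; exact h1
  have hne1 := Equiv.Perm.card_support_ne_one g
  have : g.support.card = 2 ∨ g.support.card = 3 := by omega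
  rcases this with h | h
  · have hs := Equiv.Perm.card_support_eq_two.1 h
    have := Equiv.Perm.subgroup_eq_top_of_isPreprimitive_of_isSwap_mem hH g hs hg
    exact hA (this ▸ le_top)
  · have hs := card_support_eq_three_iff.1 h
    exact hA (Equiv.Perm.alternatingGroup_le_of_isPreprimitive_of_isThreeCycle_mem hH hs hg)

lemma not_alt_le {H : Subgroup (Perm Ω)} (h1 : H ≠ ⊤) (h2 : H ≠ alternatingGroup Ω) :
    ¬ alternatingGroup Ω ≤ H := by
  intro hle
  rcases subsingleton_or_nontrivial Ω with hs | hn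
  · apply h1
    exact Subsingleton.elim _ _
  · have := Subgroup.index_dvd_of_le hle
    rw [alternatingGroup.index_eq_two] at this
    rcases (Nat.dvd_prime Nat.prime_two).1 this with h | h
    · exact h1 (Subgroup.index_eq_one.1 h)
    · exact h2 (Equiv.Perm.eq_alternatingGroup_of_index_eq_two h)

lemma two_le_kclass (X : Type*) [Group X] [Finite X] [Nontrivial X] : 2 ≤ kclass X := by
  rw [kclass]
  have : Nontrivial (ConjClasses X) := by
    obtain ⟨x, hx⟩ := exists_ne (1 : X)
    refine ⟨ConjClasses.mk x, ConjClasses.mk 1, ?_⟩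
    rw [Ne, ConjClasses.mk_eq_mk_iff_isConj, isConj_one_left]
    exact hx
  exact Finite.one_lt_card

/-- final reduction -/
lemma final_of_sum (X : Type*) [Group X] [Finite X] [Nontrivial X] (H : Subgroup (Perm Ω))
    (hn : 0 < Fintype.card Ω)
    (hsum : (∑ p ∈ (els H ×ˢ els H).erase (1, 1), kclass X ^ min (nq p.1) (nq p.2)) *
      (kclass X * Fintype.card Ω) < kclass X ^ Fintype.card Ω) :
    ((kclass X : ℝ) ^ Fintype.card Ω / (Nat.card H : ℝ) ≤ (kclass (Wreath X H) : ℝ) ∧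
        (kclass (Wreath X H) : ℝ) <
          (1 + 1 / ((kclass X : ℝ) * Fintype.card Ω)) *
            ((kclass X : ℝ) ^ Fintype.card Ω / (Nat.card H : ℝ))) := by
  classical
  have hk := two_le_kclass X
  obtain ⟨hlo, hhi⟩ := wreath_bounds X H
  set K := kclass X with hK
  set n := Fintype.card Ω with hnn
  set S := ∑ p ∈ (els H ×ˢ els H).erase (1, 1), K ^ min (nq p.1) (nq p.2) with hS
  have hhi' : kclass (Wreath X H) * Nat.card H ≤ K ^ n + S := by
    refine hhi.trans (Nat.add_le_add_left (Finset.sum_le_sum fun p _ => ?_) _)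
    rcases le_total (nq p.1) (nq p.2) with h | h
    · rw [min_eq_left h]; exact (min_le_left _ _).trans (invCol_le X _)
    · rw [min_eq_right h]; exact (min_le_right _ _).trans (invCol_le X _)
  have hHpos : (0:ℝ) < Nat.card H := by exact_mod_cast Nat.card_pos
  have hKn : (0:ℝ) < (K:ℝ) * n := by
    have : 0 < K * n := Nat.mul_pos (by omega) hn
    exact_mod_cast this
  constructor
  · rw [div_le_iff₀ hHpos]
    exact_mod_cast hlo
  · have h1 : (kclass (Wreath X H) : ℝ) * Nat.card H ≤ (K:ℝ) ^ n + S := by exact_mod_cast hhi'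
    have h2 : (S:ℝ) * ((K:ℝ) * n) < (K:ℝ) ^ n := by exact_mod_cast hsum
    rw [← mul_div_assoc, lt_div_iff₀ hHpos]
    refine h1.trans_lt ?_
    have h3 : (S:ℝ) < (K:ℝ) ^ n / ((K:ℝ) * n) := by rw [lt_div_iff₀ hKn]; exact h2
    have : (1 + 1 / ((K:ℝ) * n)) * (K:ℝ) ^ n = (K:ℝ) ^ n + (K:ℝ) ^ n / ((K:ℝ) * n) := by ring
    rw [this]; linarith

lemma pair_nq_le {H : Subgroup (Perm Ω)} (h4 : ∀ g ∈ H, g ≠ 1 → 4 ≤ g.support.card)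
    {p : Perm Ω × Perm Ω} (hp : p ∈ (els H ×ˢ els H).erase (1, 1)) :
    min (nq p.1) (nq p.2) + 2 ≤ Fintype.card Ω := by
  classical
  simp only [Finset.mem_erase, Finset.mem_product, mem_els] at hp
  obtain ⟨hne, h1, h2⟩ := hp
  by_cases hp1 : p.1 = 1
  · have hp2 : p.2 ≠ 1 := fun h => hne (Prod.ext hp1 h)
    have := nq_bound p.2
    have := h4 _ h2 hp2
    have := min_le_right (nq p.1) (nq p.2)
    omega
  · have := nq_bound p.1
    have := h4 _ h1 hp1
    have := min_le_left (nq p.1) (nq p.2)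
    omega

/-- small degree, many classes -/
lemma sum_small {H : Subgroup (Perm Ω)} (h4 : ∀ g ∈ H, g ≠ 1 → 4 ≤ g.support.card) (K : ℕ)
    (hn : 2 ≤ Fintype.card Ω)
    (hK : (Fintype.card Ω).factorial ^ 2 * Fintype.card Ω < K) :
    (∑ p ∈ (els H ×ˢ els H).erase (1, 1), K ^ min (nq p.1) (nq p.2)) *
      (K * Fintype.card Ω) < K ^ Fintype.card Ω := by
  classical
  set n := Fintype.card Ω with hnn
  have hKpos : 0 < K := by omega
  have hS : (∑ p ∈ (els H ×ˢ els H).erase (1, 1), K ^ min (nq p.1) (nq p.2))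
      ≤ n.factorial ^ 2 * K ^ (n - 2) := by
    refine (Finset.sum_le_card_nsmul _ _ (K ^ (n - 2)) ?_).trans ?_
    · intro p hp
      have := pair_nq_le h4 hp
      exact Nat.pow_le_pow_right hKpos (by omega)
    · rw [smul_eq_mul]
      refine Nat.mul_le_mul_right _ ?_
      refine (Finset.card_le_card (Finset.erase_subset _ _)).trans ?_
      rw [Finset.card_product, sq]
      have : (els H).card ≤ n.factorial := by
        rw [← Fintype.card_perm]; exact Finset.card_le_univ _
      exact Nat.mul_le_mul this this
  calc _ ≤ n.factorial ^ 2 * K ^ (n - 2) * (K * n) := Nat.mul_le_mul_right _ hS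
    _ = (n.factorial ^ 2 * n) * (K ^ (n - 2) * K) := by ring
    _ < K * (K ^ (n - 2) * K) := Nat.mul_lt_mul_of_pos_right hK (by positivity)
    _ = K ^ n := by
      obtain ⟨m, hm⟩ : ∃ m, n = m + 2 := ⟨n - 2, by omega⟩
      rw [hm]; simp; ring

/-- reduction to two colours -/
lemma sum_large {H : Subgroup (Perm Ω)} (h4 : ∀ g ∈ H, g ≠ 1 → 4 ≤ g.support.card) (K : ℕ)
    (hK : 2 ≤ K)
    (h2 : (∑ p ∈ (els H ×ˢ els H).erase (1, 1), 2 ^ min (nq p.1) (nq p.2)) *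
      (2 * Fintype.card Ω) < 2 ^ Fintype.card Ω) :
    (∑ p ∈ (els H ×ˢ els H).erase (1, 1), K ^ min (nq p.1) (nq p.2)) *
      (K * Fintype.card Ω) < K ^ Fintype.card Ω := by
  classical
  set n := Fintype.card Ω with hnn
  have hKn : 0 < K ^ n := by positivity
  refine Nat.lt_of_mul_lt_mul_right (a := 2 ^ n) ?_
  calc _ = ∑ p ∈ (els H ×ˢ els H).erase (1, 1), K ^ (min (nq p.1) (nq p.2) + 1) * 2 ^ n * n := by
        rw [Finset.sum_mul, Finset.sum_mul]
        refine Finset.sum_congr rfl fun p _ => ?_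
        ring
    _ ≤ ∑ p ∈ (els H ×ˢ els H).erase (1, 1), K ^ n * 2 ^ (min (nq p.1) (nq p.2) + 1) * n := by
        refine Finset.sum_le_sum fun p hp => Nat.mul_le_mul_right _ ?_
        have := pair_nq_le h4 hp
        obtain ⟨d, hd⟩ : ∃ d, n = (min (nq p.1) (nq p.2) + 1) + d :=
          ⟨n - (min (nq p.1) (nq p.2) + 1), by omega⟩
        rw [hd]
        generalize min (nq p.1) (nq p.2) + 1 = e
        rw [pow_add, pow_add]
        have : 2 ^ d ≤ K ^ d := Nat.pow_le_pow_left hK d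
        calc K ^ e * (2 ^ e * 2 ^ d) ≤ K ^ e * (2 ^ e * K ^ d) := by gcongr
          _ = _ := by ring
    _ = K ^ n * ((∑ p ∈ (els H ×ˢ els H).erase (1, 1), 2 ^ min (nq p.1) (nq p.2)) * (2 * n)) := by
        rw [Finset.sum_mul, Finset.mul_sum]
        refine Finset.sum_congr rfl fun p _ => ?_
        ring
    _ < K ^ n * 2 ^ n := Nat.mul_lt_mul_of_pos_left h2 hKn

end Red

section KeySum
variable {Ω : Type*} [Fintype Ω] [DecidableEq Ω]

/-- number of elements with support of size at most `s` -/
noncomputable def Ns (H : Subgroup (Perm Ω)) (s : ℕ) : ℕ :=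
  ((els H).filter (fun g => g.support.card ≤ s)).card

lemma key_sum {H : Subgroup (Perm Ω)} (m0 : ℕ)
    (hm0 : ∀ g ∈ H, g ≠ 1 → m0 ≤ g.support.card)
    (hN : ∀ s, m0 ≤ s → s ≤ Fintype.card Ω → Ns H s ^ 8 ≤ 2 ^ s)
    (hm : (2 * Fintype.card Ω * (Fintype.card Ω + 1)) ^ 4 < 2 ^ m0) :
    (∑ p ∈ (els H ×ˢ els H).erase (1, 1), 2 ^ min (nq p.1) (nq p.2)) *
      (2 * Fintype.card Ω) < 2 ^ Fintype.card Ω := by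
  classical
  set n := Fintype.card Ω with hn
  set P := (els H ×ˢ els H).erase (1, 1) with hP
  let sz : Perm Ω × Perm Ω → ℕ := fun p => max p.1.support.card p.2.support.card
  have hle : ∀ g : Perm Ω, g.support.card ≤ n := fun g => Finset.card_le_univ _
  have hmaps : ∀ p ∈ P, sz p ∈ Finset.range (n + 1) := by
    intro p _
    rw [Finset.mem_range]
    exact Nat.lt_succ_of_le (max_le (hle _) (hle _))
  let T : ℕ → ℕ := fun s => ∑ p ∈ P.filter (fun p => sz p = s), 2 ^ min (nq p.1) (nq p.2)
  have hT : ∀ s ∈ Finset.range (n + 1), T s ^ 4 * 2 ^ m0 ≤ 2 ^ (4 * n) := by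
    intro s hs
    rw [Finset.mem_range] at hs
    by_cases hne : (P.filter (fun p => sz p = s)).Nonempty
    · obtain ⟨p, hp⟩ := hne
      rw [Finset.mem_filter] at hp
      have hms : m0 ≤ s := by
        obtain ⟨hp1, hp2⟩ := hp
        simp only [hP, Finset.mem_erase, Finset.mem_product, mem_els] at hp1
        obtain ⟨hne, h1, h2⟩ := hp1
        rw [← hp2]
        by_cases hp1 : p.1 = 1
        · exact (hm0 _ h2 (fun h => hne (Prod.ext hp1 h))).trans (le_max_right _ _)
        · exact (hm0 _ h1 hp1).trans (le_max_left _ _)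
      have h1 : T s ≤ Ns H s ^ 2 * 2 ^ ((2 * n - s) / 2) := by
        refine (Finset.sum_le_card_nsmul _ _ (2 ^ ((2 * n - s) / 2)) ?_).trans ?_
        · intro p hp
          rw [Finset.mem_filter] at hp
          refine Nat.pow_le_pow_right (by norm_num) ?_
          have b1 := nq_bound p.1
          have b2 := nq_bound p.2
          have := hp.2
          simp only [sz] at this
          omega
        · rw [smul_eq_mul]
          refine Nat.mul_le_mul_right _ ?_
          rw [sq, Ns, ← Finset.card_product]
          refine Finset.card_le_card ?_
          intro p hp
          simp only [hP, Finset.mem_filter, Finset.mem_erase, Finset.mem_product] at hp ⊢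
          have := hp.2
          simp only [sz] at this
          exact ⟨⟨hp.1.2.1, by omega⟩, ⟨hp.1.2.2, by omega⟩⟩
      calc T s ^ 4 * 2 ^ m0 ≤ (Ns H s ^ 2 * 2 ^ ((2 * n - s) / 2)) ^ 4 * 2 ^ m0 := by gcongr
        _ = Ns H s ^ 8 * 2 ^ (4 * ((2 * n - s) / 2)) * 2 ^ m0 := by
          rw [mul_pow, ← pow_mul, ← pow_mul, mul_comm ((2 * n - s) / 2) 4]
        _ ≤ 2 ^ s * 2 ^ (4 * ((2 * n - s) / 2)) * 2 ^ m0 := by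
          exact Nat.mul_le_mul_right _ (Nat.mul_le_mul_right _ (hN s hms (by omega)))
        _ = 2 ^ (s + 4 * ((2 * n - s) / 2) + m0) := by rw [pow_add, pow_add]
        _ ≤ 2 ^ (4 * n) := Nat.pow_le_pow_right (by norm_num) (by omega)
    · rw [Finset.not_nonempty_iff_eq_empty] at hne
      have : T s = 0 := by simp only [T, hne, Finset.sum_empty]
      rw [this]; simp
  obtain ⟨s0, hs0, hmax⟩ := Finset.exists_max_image (Finset.range (n + 1)) T ⟨0, by simp⟩
  have hsum : ∑ p ∈ P, 2 ^ min (nq p.1) (nq p.2) ≤ (n + 1) * T s0 := by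
    rw [← Finset.sum_fiberwise_of_maps_to hmaps]
    refine (Finset.sum_le_card_nsmul _ _ (T s0) hmax).trans ?_
    simp
  have h4 := hT s0 hs0
  refine lt_of_le_of_lt (Nat.mul_le_mul_right _ hsum) ?_
  refine lt_of_pow_lt_pow_left₀ 4 (by positivity) ?_
  refine Nat.lt_of_mul_lt_mul_right (a := 2 ^ m0) ?_
  calc ((n + 1) * T s0 * (2 * n)) ^ 4 * 2 ^ m0
      = (2 * n * (n + 1)) ^ 4 * (T s0 ^ 4 * 2 ^ m0) := by ring
    _ ≤ (2 * n * (n + 1)) ^ 4 * 2 ^ (4 * n) := by gcongr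
    _ < 2 ^ m0 * 2 ^ (4 * n) := by gcongr
    _ = (2 ^ n) ^ 4 * 2 ^ m0 := by rw [← pow_mul, mul_comm n 4, mul_comm]

end KeySum

section TwoTrans
variable {Ω : Type*} [Fintype Ω] [DecidableEq Ω]

/-- two-fold transitivity, elementary form -/
def TwoTr (H : Subgroup (Perm Ω)) : Prop :=
  ∀ a b u v : Ω, a ≠ b → u ≠ v → ∃ h ∈ H, h u = a ∧ h v = b

lemma twoTr_const {H : Subgroup (Perm Ω)} (hT : TwoTr H) (a b : Ω) (hab : a ≠ b) :
    ∃ m : ℕ, 0 < m ∧ ∀ c d : Ω, c ≠ d → ∀ P : Finset (Ω × Ω), (∀ p ∈ P, p.1 ≠ p.2) →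
      ((els H).filter (fun x => (x⁻¹ c, x⁻¹ d) ∈ P)).card = m * P.card := by
  classical
  let M : Ω → Ω → Ω → Ω → Finset (Perm Ω) := fun c d u v =>
    (els H).filter (fun x => x⁻¹ c = u ∧ x⁻¹ d = v)
  have hM : ∀ c d u v, c ≠ d → u ≠ v → (M c d u v).card = (M a b a b).card := by
    intro c d u v hcd huv
    obtain ⟨y, hy, hyu, hyv⟩ := hT u v a b huv hab
    obtain ⟨z, hz, hzc, hzd⟩ := hT c d a b hcd hab
    symm
    apply Finset.card_bij (fun x _ => z * x * y⁻¹)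
    · intro x hx
      simp only [M, Finset.mem_filter, mem_els] at hx ⊢
      obtain ⟨hxH, h1, h2⟩ := hx
      refine ⟨H.mul_mem (H.mul_mem hz hxH) (H.inv_mem hy), ?_, ?_⟩
      · have : z⁻¹ c = a := by rw [← hzc]; simp
        rw [mul_inv_rev, mul_inv_rev, inv_inv, Equiv.Perm.mul_apply, Equiv.Perm.mul_apply, this, h1, hyu]
      · have : z⁻¹ d = b := by rw [← hzd]; simp
        rw [mul_inv_rev, mul_inv_rev, inv_inv, Equiv.Perm.mul_apply, Equiv.Perm.mul_apply, this, h2, hyv]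
    · intro x _ x' _ h
      simpa using h
    · intro x hx
      simp only [M, Finset.mem_filter, mem_els] at hx
      obtain ⟨hxH, h1, h2⟩ := hx
      refine ⟨z⁻¹ * x * y, ?_, by group⟩
      simp only [M, Finset.mem_filter, mem_els]
      refine ⟨H.mul_mem (H.mul_mem (H.inv_mem hz) hxH) hy, ?_, ?_⟩
      · rw [mul_inv_rev, mul_inv_rev, inv_inv, Equiv.Perm.mul_apply, Equiv.Perm.mul_apply, hzc, h1, Equiv.Perm.inv_eq_iff_eq, hyu]
      · rw [mul_inv_rev, mul_inv_rev, inv_inv, Equiv.Perm.mul_apply, Equiv.Perm.mul_apply, hzd, h2, Equiv.Perm.inv_eq_iff_eq, hyv]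
  refine ⟨(M a b a b).card, ?_, ?_⟩
  · rw [Finset.card_pos]
    exact ⟨1, by simp only [M, Finset.mem_filter, mem_els, inv_one, Equiv.Perm.one_apply, H.one_mem, and_self]⟩
  · intro c d hcd P hP
    rw [Finset.card_eq_sum_card_fiberwise (f := fun x : Perm Ω => (x⁻¹ c, x⁻¹ d)) (t := P)]
    · rw [Finset.sum_const_nat (m := (M a b a b).card), mul_comm]
      rintro ⟨u, v⟩ huv
      rw [← hM c d u v hcd (hP _ huv)]
      congr 1
      ext x
      simp only [M, Finset.mem_filter, Prod.mk.injEq]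
      constructor
      · rintro ⟨⟨h1, h2⟩, h3⟩; exact ⟨h1, h3⟩
      · rintro ⟨h1, h2, h3⟩; exact ⟨⟨h1, by rw [h2, h3]; exact huv⟩, h2, h3⟩
    · intro x hx
      simp only [Finset.coe_filter, Set.mem_setOf_eq] at hx
      exact hx.2

lemma supp_commutator_le (g h : Perm Ω) :
    (g * h * g⁻¹ * h⁻¹).support.card ≤ 3 * (g.support ∩ h.support).card := by
  classical
  set A := g.support ∩ h.support with hA
  have hsub : (g * h * g⁻¹ * h⁻¹).support ⊆ A ∪ A.image g ∪ A.image h := by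
    intro y hy
    rw [Equiv.Perm.mem_support] at hy
    by_contra hn
    simp only [Finset.mem_union, Finset.mem_image, not_or, not_exists, not_and] at hn
    obtain ⟨⟨h1, h2⟩, h3⟩ := hn
    have hA' : ∀ z, z ∉ A → g z = z ∨ h z = z := by
      intro z hz
      simp only [hA, Finset.mem_inter, Equiv.Perm.mem_support, not_and_or, not_not] at hz
      exact hz
    have k2 : g⁻¹ y ∉ A := fun hh => h2 _ hh (by simp)
    have k3 : h⁻¹ y ∉ A := fun hh => h3 _ hh (by simp)
    have r1 := hA' _ h1
    have r2 := hA' _ k2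
    have r3 := hA' _ k3
    apply hy
    simp only [Equiv.Perm.coe_mul, Function.comp_apply]
    have i1 : g (g⁻¹ y) = y := by simp
    have i2 : h (h⁻¹ y) = y := by simp
    -- translate
    have e1 : g y = y → g⁻¹ y = y := fun hh => by
      rw [Equiv.Perm.inv_eq_iff_eq]; exact hh.symm
    have e2 : h y = y → h⁻¹ y = y := fun hh => by
      rw [Equiv.Perm.inv_eq_iff_eq]; exact hh.symm
    have e3 : ∀ z, g z = z → g⁻¹ z = z := fun z hh => by
      rw [Equiv.Perm.inv_eq_iff_eq]; exact hh.symm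
    rcases r3 with r3 | r3
    · -- g fixes h⁻¹ y
      rw [e3 _ r3, i2]
      rcases r1 with r1 | r1
      · exact r1
      · -- h y = y, so h⁻¹ y = y
        have := e2 r1
        rw [this] at r3
        exact r3
    · -- h fixes h⁻¹ y so h⁻¹ y = y
      rw [i2] at r3
      have hy0 : h⁻¹ y = y := r3.symm
      rw [hy0]
      rcases r2 with r2 | r2
      · rw [i1] at r2
        have hhy : h y = y := by
          rw [hy0] at i2; exact i2
        rw [← r2] at i1 ⊢
        rw [hhy]; exact i1
      · rw [r2]; exact i1
  calc _ ≤ (A ∪ A.image g ∪ A.image h).card := Finset.card_le_card hsub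
    _ ≤ A.card + (A.image g).card + (A.image h).card :=
      (Finset.card_union_le _ _).trans (Nat.add_le_add_right (Finset.card_union_le _ _) _)
    _ ≤ A.card + A.card + A.card :=
      Nat.add_le_add (Nat.add_le_add_left Finset.card_image_le _) Finset.card_image_le
    _ = 3 * A.card := by ring

/-- Bochert type bound for doubly transitive groups -/
lemma bochert {H : Subgroup (Perm Ω)} (hT : TwoTr H) (hn : 30 ≤ Fintype.card Ω)
    (h4 : ∀ g ∈ H, g ≠ 1 → 4 ≤ g.support.card) :
    ∀ g ∈ H, g ≠ 1 → Fintype.card Ω < 5 * g.support.card := by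
  classical
  by_contra hcon
  push Not at hcon
  obtain ⟨g', hg', hg'1, hs'⟩ := hcon
  -- minimal support
  obtain ⟨g, hgm, hmin⟩ := Finset.exists_min_image ((els H).erase 1)
    (fun g => g.support.card) ⟨g', by simp [hg', hg'1]⟩
  have hg : g ∈ H := by simp at hgm; exact hgm.2
  have hg1 : g ≠ 1 := by simp at hgm; exact hgm.1
  set S := g.support with hS
  have hSs : 5 * S.card ≤ Fintype.card Ω := by
    have := hmin g' (by simp [hg', hg'1])
    omega
  have hS4 : 4 ≤ S.card := h4 g hg hg1
  set n := Fintype.card Ω with hnn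
  obtain ⟨a, ha⟩ : ∃ a, g a ≠ a := by
    by_contra hh; push Not at hh; exact hg1 (Equiv.ext hh)
  set b := g a with hb
  obtain ⟨m, hm0, hm⟩ := twoTr_const hT a b (Ne.symm ha)
  have haS : a ∈ S := Equiv.Perm.mem_support.2 ha
  have hbS : b ∈ S := by rw [hS, hb, Equiv.Perm.apply_mem_support]; exact haS
  let P1 : Finset (Ω × Ω) := Sᶜ ×ˢ S
  have hP1 : ∀ p ∈ P1, p.1 ≠ p.2 := by
    intro p hp h
    simp only [P1, Finset.mem_product, Finset.mem_compl] at hp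
    exact hp.1 (h ▸ hp.2)
  let E := (els H).filter (fun x => (x⁻¹ a, x⁻¹ b) ∈ P1)
  have hEc : E.card = m * ((n - S.card) * S.card) := by
    rw [hm a b (Ne.symm ha) P1 hP1, Finset.card_product, Finset.card_compl]
  have hpair : ∀ c, c ≠ b → ((els H).filter (fun x => (x⁻¹ c, x⁻¹ b) ∈ S.offDiag)).card
      = m * (S.card * S.card - S.card) := by
    intro c hc
    rw [hm c b hc S.offDiag (fun p hp => (Finset.mem_offDiag.1 hp).2.2), Finset.offDiag_card]
  -- double count
  have hcount : ∑ x ∈ E, (S.filter (fun c => x⁻¹ c ∈ S)).card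
      ≤ m * ((n - S.card) * S.card) + (S.card - 2) * (m * (S.card * S.card - S.card)) := by
    have : ∑ x ∈ E, (S.filter (fun c => x⁻¹ c ∈ S)).card
        = ∑ c ∈ S, (E.filter (fun x => x⁻¹ c ∈ S)).card := by
      simp_rw [Finset.card_filter]
      exact Finset.sum_comm
    rw [this, ← Finset.add_sum_erase S _ hbS]
    have haS' : a ∈ S.erase b := Finset.mem_erase.2 ⟨Ne.symm ha, haS⟩
    rw [← Finset.add_sum_erase (S.erase b) _ haS']
    have h0 : (E.filter (fun x => x⁻¹ a ∈ S)).card = 0 := by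
      rw [Finset.card_eq_zero, Finset.filter_eq_empty_iff]
      intro x hx
      simp only [E, P1, Finset.mem_filter, Finset.mem_product, Finset.mem_compl] at hx
      exact hx.2.1
    rw [h0, zero_add]
    refine Nat.add_le_add ?_ ?_
    · rw [← hEc]; exact Finset.card_le_card (Finset.filter_subset _ _)
    · refine (Finset.sum_le_card_nsmul _ _ (m * (S.card * S.card - S.card)) ?_).trans ?_
      · intro c hc
        have hcb : c ≠ b := (Finset.mem_erase.1 (Finset.mem_erase.1 hc).2).1
        rw [← hpair c hcb]
        refine Finset.card_le_card ?_
        intro x hx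
        simp only [E, P1, Finset.mem_filter, Finset.mem_product, Finset.mem_compl,
          Finset.mem_offDiag] at hx ⊢
        refine ⟨hx.1.1, hx.2, hx.1.2.2, ?_⟩
        intro h
        exact hcb (x⁻¹.injective h)
      · rw [smul_eq_mul, Finset.card_erase_of_mem haS', Finset.card_erase_of_mem hbS]
        exact le_of_eq (by rw [Nat.sub_sub])
  -- find x
  have hex : ∃ x ∈ E, 3 * (S.filter (fun c => x⁻¹ c ∈ S)).card < S.card := by
    by_contra hh
    push Not at hh
    have h1 : E.card * S.card ≤ ∑ x ∈ E, 3 * (S.filter (fun c => x⁻¹ c ∈ S)).card := by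
      rw [← smul_eq_mul]
      exact Finset.card_nsmul_le_sum _ _ _ hh
    rw [← Finset.mul_sum, hEc] at h1
    have h2 := h1.trans (Nat.mul_le_mul_left 3 hcount)
    have h3 : m * ((n - S.card) * S.card * S.card) ≤
      m * (3 * ((n - S.card) * S.card + (S.card - 2) * (S.card * S.card - S.card))) := by
      calc _ = m * ((n - S.card) * S.card) * S.card := by ring
        _ ≤ _ := h2
        _ = _ := by ring
    have h4' := Nat.le_of_mul_le_mul_left h3 hm0
    obtain ⟨t, ht⟩ : ∃ t, S.card = t + 4 := ⟨S.card - 4, by omega⟩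
    obtain ⟨r, hr⟩ : ∃ r, n - S.card = 4 * S.card + r := ⟨n - S.card - 4 * S.card, by omega⟩
    have hr' : t = 0 → 10 ≤ r := by intro h; omega
    rw [hr, ht] at h4'
    have e1 : (t + 4) * (t + 4) - (t + 4) = (t + 4) * (t + 3) := by
      rw [← Nat.mul_sub_one]; rfl
    rw [e1, show t + 4 - 2 = t + 2 by omega] at h4'
    have h5 : (t + 4) * ((4 * (t + 4) + r) * (t + 4)) ≤
      (t + 4) * (3 * ((4 * (t + 4) + r) + (t + 2) * (t + 3))) := by
      calc _ = (4 * (t + 4) + r) * (t + 4) * (t + 4) := by ring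
        _ ≤ _ := h4'
        _ = _ := by ring
    have h6 := Nat.le_of_mul_le_mul_left h5 (by omega)
    rcases Nat.eq_zero_or_pos t with h0 | h0
    · have := hr' h0
      subst h0
      omega
    · nlinarith
  obtain ⟨x, hxE, hx3⟩ := hex
  simp only [E, P1, Finset.mem_filter, mem_els, Finset.mem_product, Finset.mem_compl] at hxE
  obtain ⟨hxH, hxa, hxb⟩ := hxE
  set h := x * g * x⁻¹ with hh
  have hhH : h ∈ H := H.mul_mem (H.mul_mem hxH hg) (H.inv_mem hxH)
  have hsupp : ∀ c, c ∈ h.support ↔ x⁻¹ c ∈ S := by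
    intro c
    rw [hS, Equiv.Perm.mem_support, Equiv.Perm.mem_support, hh]
    simp only [Equiv.Perm.coe_mul, Function.comp_apply]
    rw [not_iff_not]
    constructor
    · intro h1; rw [Equiv.Perm.eq_inv_iff_eq]; exact h1
    · intro h1; rw [h1]; simp
  have hinter : g.support ∩ h.support = S.filter (fun c => x⁻¹ c ∈ S) := by
    ext c; rw [Finset.mem_inter, hsupp, Finset.mem_filter]
  have hcl := supp_commutator_le g h
  rw [hinter] at hcl
  have hcH : g * h * g⁻¹ * h⁻¹ ∈ H :=
    H.mul_mem (H.mul_mem (H.mul_mem hg hhH) (H.inv_mem hg)) (H.inv_mem hhH)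
  have hcne : g * h * g⁻¹ * h⁻¹ ≠ 1 := by
    intro h1
    have hcomm : g * h = h * g := by
      have : g * h * g⁻¹ * h⁻¹ * (h * g) = g * h := by group
      rw [← this, h1, one_mul]
    have e1 : g (h a) = h (g a) := by
      have := congrArg (fun p : Perm Ω => p a) hcomm
      simpa using this
    have e2 : h a = a := by
      by_contra hne; exact hxa ((hsupp a).1 (Equiv.Perm.mem_support.2 hne))
    have e3 : h b ≠ b := Equiv.Perm.mem_support.1 ((hsupp b).2 hxb)
    rw [e2] at e1
    exact e3 e1.symm
  have := hmin _ (Finset.mem_erase.2 ⟨hcne, mem_els.2 hcH⟩)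
  omega

end TwoTrans

section Giant
variable {Ω : Type*} [Fintype Ω] [DecidableEq Ω]

lemma perm_inv_app (g : Perm Ω) (x : Ω) : g⁻¹ (g x) = x := by
  rw [Equiv.Perm.inv_eq_iff_eq]

/-- orbit of `y` under the pointwise stabiliser of the list `l` in `H` -/
noncomputable def orb (H : Subgroup (Perm Ω)) (l : List Ω) (y : Ω) : Finset Ω := by
  classical exact Finset.univ.filter (fun x => ∃ g ∈ H, (∀ a ∈ l, g a = a) ∧ g y = x)

lemma mem_orb {H : Subgroup (Perm Ω)} {l : List Ω} {y x : Ω} :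
    x ∈ orb H l y ↔ ∃ g ∈ H, (∀ a ∈ l, g a = a) ∧ g y = x := by
  classical simp [orb]

/-- `x` lies in an orbit of size more than half of the degree -/
def giant (H : Subgroup (Perm Ω)) (l : List Ω) (x : Ω) : Prop :=
  Fintype.card Ω < 2 * (orb H l x).card

lemma orb_self {H : Subgroup (Perm Ω)} {l : List Ω} (x : Ω) : x ∈ orb H l x :=
  mem_orb.2 ⟨1, H.one_mem, fun _ _ => rfl, rfl⟩

lemma orb_symm {H : Subgroup (Perm Ω)} {l : List Ω} {x y : Ω} (h : x ∈ orb H l y) :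
    y ∈ orb H l x := by
  obtain ⟨g, hg, hl, hx⟩ := mem_orb.1 h
  refine mem_orb.2 ⟨g⁻¹, H.inv_mem hg, fun a ha => ?_, ?_⟩
  · rw [Equiv.Perm.inv_eq_iff_eq]; exact (hl a ha).symm
  · rw [Equiv.Perm.inv_eq_iff_eq]; exact hx.symm

lemma orb_trans {H : Subgroup (Perm Ω)} {l : List Ω} {x y z : Ω} (h : x ∈ orb H l y)
    (h' : y ∈ orb H l z) : x ∈ orb H l z := by
  obtain ⟨g, hg, hl, hx⟩ := mem_orb.1 h
  obtain ⟨g', hg', hl', hx'⟩ := mem_orb.1 h'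
  refine mem_orb.2 ⟨g * g', H.mul_mem hg hg', fun a ha => ?_, ?_⟩
  · rw [Equiv.Perm.mul_apply, hl' a ha, hl a ha]
  · rw [Equiv.Perm.mul_apply, hx', hx]

lemma orb_mono {H : Subgroup (Perm Ω)} {l l' : List Ω} (hll : ∀ a ∈ l, a ∈ l') (x : Ω) :
    orb H l' x ⊆ orb H l x := by
  intro y hy
  obtain ⟨g, hg, hl, hx⟩ := mem_orb.1 hy
  exact mem_orb.2 ⟨g, hg, fun a ha => hl a (hll a ha), hx⟩

lemma giant_mono {H : Subgroup (Perm Ω)} {l l' : List Ω} (hll : ∀ a ∈ l, a ∈ l') {x : Ω}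
    (h : giant H l' x) : giant H l x := by
  have := Finset.card_le_card (orb_mono (H := H) hll x)
  unfold giant at *
  omega

lemma giant_orb {H : Subgroup (Perm Ω)} {l : List Ω} {x y : Ω}
    (hx : giant H l x) (hy : giant H l y) : y ∈ orb H l x := by
  have hinter : (orb H l x ∩ orb H l y).Nonempty := by
    rw [← Finset.card_pos]
    have h1 := Finset.card_union_add_card_inter (orb H l x) (orb H l y)
    have h2 := Finset.card_le_univ (orb H l x ∪ orb H l y)
    unfold giant at *
    omega
  obtain ⟨z, hz⟩ := hinter
  rw [Finset.mem_inter] at hz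
  exact orb_trans (orb_symm hz.2) hz.1

lemma giant_of_orb {H : Subgroup (Perm Ω)} {l : List Ω} {x y : Ω}
    (hx : giant H l x) (hy : y ∈ orb H l x) : giant H l y := by
  have : orb H l x ⊆ orb H l y := fun z hz => orb_trans hz (orb_symm hy)
  have := Finset.card_le_card this
  unfold giant at *
  omega

lemma orb_map {H : Subgroup (Perm Ω)} {l : List Ω} {x y : Ω} {g : Perm Ω} (hg : g ∈ H)
    (h : y ∈ orb H l x) : g y ∈ orb H (l.map g) (g x) := by
  obtain ⟨k, hk, hl, hx⟩ := mem_orb.1 h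
  refine mem_orb.2 ⟨g * k * g⁻¹, H.mul_mem (H.mul_mem hg hk) (H.inv_mem hg), ?_, ?_⟩
  · intro a ha
    obtain ⟨b, hb, rfl⟩ := List.mem_map.1 ha
    rw [Equiv.Perm.mul_apply, Equiv.Perm.mul_apply, perm_inv_app, hl b hb]
  · rw [Equiv.Perm.mul_apply, Equiv.Perm.mul_apply, perm_inv_app, hx]

lemma giant_map {H : Subgroup (Perm Ω)} {l : List Ω} {x : Ω} {g : Perm Ω} (hg : g ∈ H)
    (h : giant H l x) : giant H (l.map g) (g x) := by
  have h1 : (orb H l x).image g ⊆ orb H (l.map g) (g x) := by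
    intro z hz
    obtain ⟨y, hy, rfl⟩ := Finset.mem_image.1 hz
    exact orb_map hg hy
  have h2 := Finset.card_le_card h1
  rw [Finset.card_image_of_injective _ g.injective] at h2
  unfold giant at *
  omega

/-- lists built by successively choosing points of the giant orbit -/
def good (H : Subgroup (Perm Ω)) : List Ω → Prop
  | [] => True
  | x :: l => good H l ∧ giant H l x

lemma good_equiv {H : Subgroup (Perm Ω)} : ∀ l l' : List Ω, good H l → good H l' →
    l.length = l'.length → ∃ g ∈ H, l.map g = l'
  | [], [], _, _, _ => ⟨1, H.one_mem, rfl⟩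
  | [], _ :: _, _, _, h => by simp at h
  | _ :: _, [], _, _, h => by simp at h
  | x :: t, x' :: t', h1, h2, h => by
    obtain ⟨g, hg, hgt⟩ := good_equiv t t' h1.1 h2.1 (by simpa using h)
    have h3 := giant_map hg h1.2
    rw [hgt] at h3
    obtain ⟨k, hk, hkl, hkx⟩ := mem_orb.1 (giant_orb h3 h2.2)
    refine ⟨k * g, H.mul_mem hk hg, ?_⟩
    rw [List.map_cons, Equiv.Perm.mul_apply, hkx]
    congr 1
    conv_rhs => rw [← hgt]
    refine List.map_congr_left ?_
    intro a ha
    rw [Equiv.Perm.mul_apply]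
    exact hkl _ (by rw [← hgt]; exact List.mem_map_of_mem ha)

lemma giant_swap {H : Subgroup (Perm Ω)} {l : List Ω} {x y : Ω} (hx : giant H l x)
    (hy : giant H (x :: l) y) : giant H (y :: l) x := by
  classical
  let Γ : Finset Ω := Finset.univ.filter (fun z => giant H l z)
  let R : Finset (Ω × Ω) := (Γ ×ˢ Γ).filter (fun p => giant H (p.1 :: l) p.2)
  have htr : ∀ z, giant H l z → ∃ k ∈ H, (∀ a ∈ l, k a = a) ∧ k x = z :=
    fun z hz => mem_orb.1 (giant_orb hx hz)
  have hmapl : ∀ k : Perm Ω, (∀ a ∈ l, k a = a) → l.map k = l := by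
    intro k hk
    conv_rhs => rw [← List.map_id l]
    exact List.map_congr_left hk
  have hsize : ∀ z ∈ Γ, Fintype.card Ω < 2 * (Γ.filter (fun w => giant H (z :: l) w)).card := by
    intro z hz
    have hz' : giant H l z := (Finset.mem_filter.1 hz).2
    obtain ⟨k, hk, hkl, hkx⟩ := htr z hz'
    have h1 := giant_map hk hy
    rw [List.map_cons, hmapl k hkl, hkx] at h1
    have : orb H (z :: l) (k y) ⊆ Γ.filter (fun w => giant H (z :: l) w) := by
      intro w hw
      have h2 := giant_of_orb h1 hw
      rw [Finset.mem_filter, Finset.mem_filter]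
      exact ⟨⟨Finset.mem_univ _, giant_mono (fun a ha => List.mem_cons_of_mem _ ha) h2⟩, h2⟩
    have := Finset.card_le_card this
    unfold giant at h1
    omega
  have hxΓ : x ∈ Γ := by simp [Γ, hx]
  have hΓpos : 0 < Γ.card := Finset.card_pos.2 ⟨x, hxΓ⟩
  have hRcard : R.card = ∑ z ∈ Γ, (Γ.filter (fun w => giant H (z :: l) w)).card := by
    rw [Finset.card_filter, Finset.sum_product]
    refine Finset.sum_congr rfl fun z _ => ?_
    rw [Finset.card_filter]
  have hR2 : Γ.card * Γ.card < 2 * R.card := by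
    rw [hRcard, Finset.mul_sum]
    have h1 : Γ.card * Fintype.card Ω <
        ∑ z ∈ Γ, 2 * (Γ.filter (fun w => giant H (z :: l) w)).card := by
      rw [← smul_eq_mul, ← Finset.sum_const]
      exact Finset.sum_lt_sum_of_nonempty ⟨x, hxΓ⟩ hsize
    have h2 : Γ.card ≤ Fintype.card Ω := Finset.card_le_univ _
    nlinarith
  have hex : ∃ a b, (a, b) ∈ R ∧ (b, a) ∈ R := by
    by_contra hno
    push Not at hno
    have hd : Disjoint R (R.image Prod.swap) := by
      rw [Finset.disjoint_left]
      rintro ⟨a, b⟩ h1 h2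
      obtain ⟨⟨c, d⟩, hcd, he⟩ := Finset.mem_image.1 h2
      simp only [Prod.swap_prod_mk, Prod.mk.injEq] at he
      obtain ⟨rfl, rfl⟩ := he
      exact hno _ _ h1 hcd
    have hsub : R ∪ R.image Prod.swap ⊆ Γ ×ˢ Γ := by
      refine Finset.union_subset (Finset.filter_subset _ _) ?_
      intro p hp
      obtain ⟨⟨c, d⟩, hcd, he⟩ := Finset.mem_image.1 hp
      have := (Finset.mem_filter.1 hcd).1
      rw [Finset.mem_product] at this
      rw [← he]
      exact Finset.mem_product.2 ⟨this.2, this.1⟩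
    have h3 := Finset.card_le_card hsub
    rw [Finset.card_union_of_disjoint hd, Finset.card_image_of_injective _ Prod.swap_injective,
      Finset.card_product] at h3
    omega
  obtain ⟨a, b, hab, hba⟩ := hex
  simp only [R, Γ, Finset.mem_filter, Finset.mem_product, Finset.mem_univ, true_and] at hab hba
  obtain ⟨k, hk, hkl, hkx⟩ := htr a hab.1.1
  have h1 := giant_map hk hy
  rw [List.map_cons, hmapl k hkl, hkx] at h1
  obtain ⟨h, hh, hhl, hhx⟩ := mem_orb.1 (giant_orb h1 hab.2)
  set q := h * k with hq
  have hqH : q ∈ H := H.mul_mem hh hk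
  have hql : ∀ a ∈ l, q a = a := by
    intro c hc
    rw [hq, Equiv.Perm.mul_apply, hkl c hc, hhl c (List.mem_cons_of_mem _ hc)]
  have hqx : q x = a := by
    rw [hq, Equiv.Perm.mul_apply, hkx, hhl a List.mem_cons_self]
  have hqy : q y = b := by rw [hq, Equiv.Perm.mul_apply, hhx]
  have h5 := giant_map (H.inv_mem hqH) hba.2
  have e1 : q⁻¹ b = y := by rw [Equiv.Perm.inv_eq_iff_eq, hqy]
  have e2 : q⁻¹ a = x := by rw [Equiv.Perm.inv_eq_iff_eq, hqx]
  have e3 : ∀ c ∈ l, q⁻¹ c = c := fun c hc => by rw [Equiv.Perm.inv_eq_iff_eq, hql c hc]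
  rw [List.map_cons, hmapl _ e3, e1, e2] at h5
  exact h5

lemma good_perm {H : Subgroup (Perm Ω)} {l l' : List Ω} (h : l.Perm l') (hl : good H l) :
    good H l' := by
  induction h with
  | nil => exact hl
  | cons x h ih =>
    exact ⟨ih hl.1, giant_mono (fun a ha => h.symm.subset ha) hl.2⟩
  | swap x y l =>
    -- from `y :: x :: l` to `x :: y :: l`
    obtain ⟨⟨h0, h1⟩, h2⟩ := hl
    exact ⟨⟨h0, giant_mono (fun a ha => List.mem_cons_of_mem _ ha) h2⟩, giant_swap h1 h2⟩
  | trans _ _ ih1 ih2 => exact ih2 (ih1 hl)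

lemma good_nodup {H : Subgroup (Perm Ω)} (hn : 2 ≤ Fintype.card Ω) :
    ∀ l : List Ω, good H l → l.Nodup
  | [], _ => List.nodup_nil
  | x :: l, h => by
    rw [List.nodup_cons]
    refine ⟨fun hx => ?_, good_nodup hn l h.1⟩
    have : orb H l x ⊆ {x} := by
      intro y hy
      obtain ⟨g, hg, hl, hx'⟩ := mem_orb.1 hy
      rw [Finset.mem_singleton, ← hx', hl x hx]
    have := Finset.card_le_card this
    have h2 := h.2
    unfold giant at h2
    rw [Finset.card_singleton] at this
    omega

lemma good_exists {H : Subgroup (Perm Ω)} {s : ℕ}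
    (hs : ∀ l : List Ω, l.length < s → ∃ x, giant H l x) :
    ∀ j ≤ s, ∃ l : List Ω, l.length = j ∧ good H l := by
  intro j
  induction j with
  | zero => intro _; exact ⟨[], rfl, trivial⟩
  | succ j ih =>
    intro hj
    obtain ⟨l, hl, hg⟩ := ih (by omega)
    obtain ⟨x, hx⟩ := hs l (by omega)
    exact ⟨x :: l, by simp [hl], hg, hx⟩

lemma good_sym {H : Subgroup (Perm Ω)} (hn : 2 ≤ Fintype.card Ω) {ι : Type*} [Fintype ι]
    (hs : ∀ l : List Ω, l.length < Fintype.card ι → ∃ x, giant H l x) :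
    ∃ f : ι → Ω, Function.Injective f ∧ ∀ σ : Perm ι, ∃ g ∈ H, ∀ i, g (f i) = f (σ i) := by
  obtain ⟨l, hl, hgood⟩ := good_exists hs _ le_rfl
  have hnd := good_nodup hn l hgood
  let e : ι ≃ Fin l.length := (Fintype.equivFin ι).trans (finCongr hl.symm)
  refine ⟨fun i => l.get (e i), ?_, ?_⟩
  · intro i j hij
    exact e.injective (List.nodup_iff_injective_get.1 hnd hij)
  · intro σ
    let τ : Perm (Fin l.length) := (e.symm.trans σ).trans e
    have hp : (List.ofFn (l.get ∘ τ)).Perm (List.ofFn l.get) :=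
      Equiv.Perm.ofFn_comp_perm τ l.get
    rw [List.ofFn_get] at hp
    obtain ⟨g, hg, hgl⟩ := good_equiv l _ hgood (good_perm hp.symm hgood) (by simp)
    refine ⟨g, hg, fun i => ?_⟩
    have h1 : (l.map g).get ⟨(e i).1, by simp⟩ = l.get (τ (e i)) := by
      have h3 := List.getElem_of_eq hgl (i := (e i).1) (by simp)
      simp only [List.get_eq_getElem]
      rw [h3]
      simp
    have h2 : (l.map g).get ⟨(e i).1, by simp⟩ = g (l.get (e i)) := by simp
    rw [← h2, h1]
    simp [τ]

lemma exists_no_giant {H : Subgroup (Perm Ω)} (hn : 2 ≤ Fintype.card Ω)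
    (hB : ∀ g ∈ H, g ≠ 1 → Fintype.card Ω < 5 * g.support.card)
    (ps : Finset ℕ) (hps : ∀ p ∈ ps, p.Prime) (L : ℕ) (hL : Fintype.card Ω < 2 ^ (L + 1))
    (hc : 5 * L ≤ ps.card) (hc0 : 0 < ps.card) :
    ∃ l : List Ω, l.length < ∑ p ∈ ps, p ∧ ∀ x, ¬ giant H l x := by
  classical
  by_contra hcon
  push Not at hcon
  haveI hz : ∀ p : ps, NeZero (p : ℕ) := fun p => ⟨(hps p.1 p.2).ne_zero⟩
  have hcard : Fintype.card (Σ p : ps, ZMod (p : ℕ)) = ∑ p ∈ ps, p := by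
    rw [Fintype.card_sigma]
    simp only [ZMod.card]
    exact Finset.sum_coe_sort ps (fun p => p)
  obtain ⟨f, hf, hsym⟩ := good_sym (H := H) hn (ι := Σ p : ps, ZMod (p : ℕ))
    (by rw [hcard]; exact hcon)
  obtain ⟨g, hg, hgf⟩ := hsym (Equiv.sigmaCongrRight (fun p => Equiv.addRight (1 : ZMod (p : ℕ))))
  have hgf' : ∀ (p : ps) (a : ZMod (p : ℕ)), g (f ⟨p, a⟩) = f ⟨p, a + 1⟩ := fun p a => hgf ⟨p, a⟩
  have hpow : ∀ (m : ℕ) (p : ps) (a : ZMod (p : ℕ)), (g ^ m) (f ⟨p, a⟩) = f ⟨p, a + m⟩ := by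
    intro m p
    induction m with
    | zero => intro a; simp
    | succ m ih =>
      intro a
      rw [pow_succ, Equiv.Perm.mul_apply, hgf', ih]
      congr 2
      push_cast; ring
  have hmove : ∀ (m : ℕ) (p : ps), ¬ (p : ℕ) ∣ m → (g ^ m) (f ⟨p, 0⟩) ≠ f ⟨p, 0⟩ := by
    intro m p hpm h
    rw [hpow] at h
    have := hf h
    rw [Sigma.mk.injEq] at this
    have h2 := eq_of_heq this.2
    rw [zero_add, ZMod.natCast_eq_zero_iff] at h2
    exact hpm h2
  -- periods
  let P : Ω → ℕ := fun x => Function.minimalPeriod g x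
  have hPd : ∀ x, P x ∣ orderOf g := by
    intro x
    have : Function.IsPeriodicPt g (orderOf g) x := by
      show g^[orderOf g] x = x
      rw [Equiv.Perm.iterate_eq_pow, pow_orderOf_eq_one]; rfl
    exact this.minimalPeriod_dvd
  have hop : 0 < orderOf g := orderOf_pos g
  have hPpos : ∀ x, 0 < P x := fun x => Nat.pos_of_dvd_of_pos (hPd x) hop
  have hPle : ∀ x, P x ≤ Fintype.card Ω := by
    intro x
    have hinj : Function.Injective (fun i : Fin (P x) => g^[i] x) := by
      intro i j hij
      have := (Function.iterate_eq_iterate_iff_of_lt_minimalPeriod i.2 j.2).1 hij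
      exact Fin.ext this
    simpa using Fintype.card_le_of_injective _ hinj
  have hcount : ∀ x, (ps.filter (fun p => p ∣ P x)).card ≤ L := by
    intro x
    have hdvd : ∏ p ∈ ps.filter (fun p => p ∣ P x), p ∣ P x := by
      refine Finset.prod_primes_dvd _ ?_ ?_
      · intro p hp; exact (hps p (Finset.mem_filter.1 hp).1).prime
      · intro p hp; exact (Finset.mem_filter.1 hp).2
    have h1 := Nat.le_of_dvd (hPpos x) hdvd
    have h2 : 2 ^ (ps.filter (fun p => p ∣ P x)).card ≤ ∏ p ∈ ps.filter (fun p => p ∣ P x), p := by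
      refine Finset.pow_card_le_prod _ _ _ ?_
      intro p hp; exact (hps p (Finset.mem_filter.1 hp).1).two_le
    have h3 : 2 ^ (ps.filter (fun p => p ∣ P x)).card < 2 ^ (L + 1) :=
      lt_of_le_of_lt (h2.trans (h1.trans (hPle x))) hL
    have := (Nat.pow_lt_pow_iff_right (by norm_num : 1 < 2)).1 h3
    omega
  have hsum : ∑ p ∈ ps, (Finset.univ.filter (fun x => p ∣ P x)).card ≤ Fintype.card Ω * L := by
    have : ∑ p ∈ ps, (Finset.univ.filter (fun x => p ∣ P x)).card
        = ∑ x : Ω, (ps.filter (fun p => p ∣ P x)).card := by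
      simp_rw [Finset.card_filter]
      exact Finset.sum_comm
    rw [this]
    refine (Finset.sum_le_card_nsmul _ _ L (fun x _ => hcount x)).trans ?_
    rw [smul_eq_mul, Finset.card_univ]
  obtain ⟨p, hp, hp5⟩ : ∃ p ∈ ps, 5 * (Finset.univ.filter (fun x => p ∣ P x)).card
      ≤ Fintype.card Ω := by
    by_contra hh
    push Not at hh
    have h1 : ps.card * Fintype.card Ω <
        ∑ p ∈ ps, 5 * (Finset.univ.filter (fun x => p ∣ P x)).card := by
      rw [← smul_eq_mul, ← Finset.sum_const]
      exact Finset.sum_lt_sum_of_nonempty (Finset.card_pos.1 hc0) hh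
    rw [← Finset.mul_sum] at h1
    nlinarith
  have hpp := hps p hp
  set m := orderOf g / p ^ (orderOf g).factorization p with hm
  have hpm : ¬ p ∣ m := Nat.not_dvd_ordCompl hpp hop.ne'
  have hmm : p ^ (orderOf g).factorization p * m = orderOf g := Nat.ordProj_mul_ordCompl_eq_self _ _
  have hne : g ^ m ≠ 1 := by
    intro h
    exact hmove m ⟨p, hp⟩ hpm (by rw [h]; rfl)
  have h1 := hB _ (H.pow_mem hg m) hne
  have h2 : (g ^ m).support ⊆ Finset.univ.filter (fun x => p ∣ P x) := by
    intro x hx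
    rw [Finset.mem_filter]
    refine ⟨Finset.mem_univ _, ?_⟩
    by_contra hpx
    rw [Equiv.Perm.mem_support] at hx
    apply hx
    have hcop : Nat.Coprime (P x) (p ^ (orderOf g).factorization p) :=
      (Nat.Coprime.pow_left _ ((Nat.Prime.coprime_iff_not_dvd hpp).2 hpx)).symm
    have hdm : P x ∣ m := by
      refine hcop.dvd_of_dvd_mul_left ?_
      rw [hmm]; exact hPd x
    have : Function.IsPeriodicPt g m x :=
      (Function.isPeriodicPt_minimalPeriod g x).trans_dvd hdm
    have h3 : g^[m] x = x := this
    rw [Equiv.Perm.iterate_eq_pow] at h3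
    exact h3
  have := Finset.card_le_card h2
  omega

lemma order_le_of_no_giant {H : Subgroup (Perm Ω)} (hT : TwoTr H) (hn : 2 ≤ Fintype.card Ω)
    (l : List Ω) (hl : ∀ x, ¬ giant H l x) (T : ℕ) (hTn : Fintype.card Ω ^ 2 < 2 ^ T) :
    (els H).card ≤ Fintype.card Ω ^ (T * l.length) := by
  classical
  set n := Fintype.card Ω with hnn
  have : Nontrivial Ω := Fintype.one_lt_card_iff_nontrivial.1 (by omega)
  obtain ⟨a, b, hab⟩ := exists_pair_ne Ω
  obtain ⟨m, hm0, hm⟩ := twoTr_const hT a b hab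
  let S : Finset (Ω × Ω) := Finset.univ.filter (fun p => p.2 ∉ orb H l p.1)
  have hS1 : ∀ p ∈ S, p.1 ≠ p.2 := by
    intro p hp h
    have := (Finset.mem_filter.1 hp).2
    rw [← h] at this
    exact this (orb_self _)
  have hScard : n * n ≤ 2 * S.card := by
    have h1 : S.card = ∑ x : Ω, (Finset.univ.filter (fun y => y ∉ orb H l x)).card := by
      rw [Finset.card_filter, ← Finset.univ_product_univ, Finset.sum_product]
      refine Finset.sum_congr rfl fun z _ => ?_
      rw [Finset.card_filter]
    rw [h1, Finset.mul_sum]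
    have h2 : ∀ x ∈ (Finset.univ : Finset Ω),
        n ≤ 2 * (Finset.univ.filter (fun y => y ∉ orb H l x)).card := by
      intro x _
      have h3 := hl x
      unfold giant at h3
      have h4 : (Finset.univ.filter (fun y => y ∉ orb H l x)) = (orb H l x)ᶜ := by
        ext y; simp
      rw [h4, Finset.card_compl]
      omega
    have := Finset.card_nsmul_le_sum _ _ _ h2
    simpa [hnn] using this
  have hH : (els H).card = m * (n * n - n) := by
    have := hm a b hab Finset.univ.offDiag (fun p hp => (Finset.mem_offDiag.1 hp).2.2)
    rw [Finset.offDiag_card, Finset.card_univ] at this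
    rw [← hnn, Finset.filter_true_of_mem] at this
    · exact this
    · intro x _
      rw [Finset.mem_offDiag]
      exact ⟨Finset.mem_univ _, Finset.mem_univ _, fun h => hab (x⁻¹.injective h)⟩
  let Bad : Ω → Ω → Finset (Perm Ω) := fun c d =>
    (els H).filter (fun x => (x⁻¹ c, x⁻¹ d) ∉ S)
  have hBad : ∀ c d, c ≠ d → 2 * (Bad c d).card ≤ (els H).card := by
    intro c d hcd
    have h1 := hm c d hcd S hS1
    have h2 := Finset.card_filter_add_card_filter_not (s := els H)
      (fun x => (x⁻¹ c, x⁻¹ d) ∈ S)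
    have h3 : (els H).card ≤ 2 * (m * S.card) := by
      rw [hH]
      calc m * (n * n - n) ≤ m * (2 * S.card) := Nat.mul_le_mul_left _ (by omega)
        _ = _ := by ring
    simp only [Bad]
    omega
  -- choose a tuple
  let Tup : Finset (Fin T → Perm Ω) := Fintype.piFinset (fun _ => els H)
  have hHpos : 0 < (els H).card := Finset.card_pos.2 ⟨1, by simp [H.one_mem]⟩
  obtain ⟨γ, hγ, hsep⟩ : ∃ γ ∈ Tup, ∀ c d, c ≠ d → ∃ i, γ i ∉ Bad c d := by
    by_contra hcon
    push Not at hcon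
    have hsub : Tup ⊆ (Finset.univ.offDiag : Finset (Ω × Ω)).biUnion
        (fun p => Fintype.piFinset (fun _ : Fin T => Bad p.1 p.2)) := by
      intro γ hγ
      obtain ⟨c, d, hcd, h⟩ := hcon γ hγ
      rw [Finset.mem_biUnion]
      exact ⟨(c, d), by simp [hcd], Fintype.mem_piFinset.2 h⟩
    have h1 := (Finset.card_le_card hsub).trans Finset.card_biUnion_le
    have h2 : ∀ p ∈ (Finset.univ.offDiag : Finset (Ω × Ω)),
        2 ^ T * (Fintype.piFinset (fun _ : Fin T => Bad p.1 p.2)).card ≤ (els H).card ^ T := by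
      intro p hp
      rw [Fintype.card_piFinset_const, ← mul_pow]
      exact Nat.pow_le_pow_left (hBad _ _ (Finset.mem_offDiag.1 hp).2.2) T
    have h3 : 2 ^ T * Tup.card ≤ n ^ 2 * (els H).card ^ T := by
      calc 2 ^ T * Tup.card ≤ 2 ^ T * _ := Nat.mul_le_mul_left _ h1
        _ ≤ (Finset.univ.offDiag : Finset (Ω × Ω)).card • (els H).card ^ T := by
          rw [Finset.mul_sum]; exact Finset.sum_le_card_nsmul _ _ _ h2
        _ ≤ n ^ 2 * (els H).card ^ T := by
          rw [smul_eq_mul, Finset.offDiag_card, Finset.card_univ, ← hnn, sq]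
          exact Nat.mul_le_mul_right _ (Nat.sub_le _ _)
    rw [Fintype.card_piFinset_const] at h3
    have h4 := Nat.le_of_mul_le_mul_right h3 (pow_pos hHpos T)
    omega
  have hγH : ∀ i, γ i ∈ H := fun i => mem_els.1 (Fintype.mem_piFinset.1 hγ i)
  -- injection
  let F : Perm Ω → (Fin T × Fin l.length → Ω) := fun h ij => h (γ ij.1 (l.get ij.2))
  have hinj : Set.InjOn F (els H) := by
    intro h hh h' hh' hF
    have hhH : h ∈ H := mem_els.1 hh
    have hh'H : h' ∈ H := mem_els.1 hh'
    ext c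
    by_contra hne
    set d := (h'⁻¹ * h) c with hd
    have hcd : c ≠ d := by
      intro h1
      apply hne
      have : h'⁻¹ (h c) = c := h1.symm
      rw [Equiv.Perm.inv_eq_iff_eq] at this
      exact this
    obtain ⟨i, hi⟩ := hsep c d hcd
    apply hi
    simp only [Bad, S, Finset.mem_filter, mem_els, Finset.mem_univ, true_and, not_not]
    refine ⟨hγH i, ?_⟩
    have hfix : ∀ a ∈ l.map (γ i), (h'⁻¹ * h) a = a := by
      intro a ha
      obtain ⟨b, hb, rfl⟩ := List.mem_map.1 ha
      obtain ⟨j, rfl⟩ := List.get_of_mem hb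
      have := congrFun hF (i, j)
      rw [Equiv.Perm.mul_apply, Equiv.Perm.inv_eq_iff_eq]
      exact this
    have h1 : d ∈ orb H (l.map (γ i)) c :=
      mem_orb.2 ⟨h'⁻¹ * h, H.mul_mem (H.inv_mem hh'H) hhH, hfix, rfl⟩
    have h2 := orb_map (H.inv_mem (hγH i)) h1
    have h3 : (l.map (γ i)).map (⇑((γ i)⁻¹)) = l := by
      rw [List.map_map]
      conv_rhs => rw [← List.map_id l]
      refine List.map_congr_left fun a _ => ?_
      show (γ i)⁻¹ (γ i a) = a
      rw [perm_inv_app]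
    rw [h3] at h2
    exact h2
  have := Finset.card_le_card_of_injOn (t := Finset.univ) F (fun _ _ => Finset.mem_univ _) hinj
  rw [Finset.card_univ, Fintype.card_fun, Fintype.card_prod, Fintype.card_fin,
    Fintype.card_fin] at this
  exact this

end Giant

section Coh
variable {Ω : Type*} [Fintype Ω] [DecidableEq Ω]

/-- the equivalence relation of lying in the same orbital -/
def orbSetoid (H : Subgroup (Perm Ω)) : Setoid (Ω × Ω) where
  r p q := ∃ h ∈ H, h p.1 = q.1 ∧ h p.2 = q.2
  iseqv := by
    refine ⟨fun p => ⟨1, H.one_mem, rfl, rfl⟩, ?_, ?_⟩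
    · rintro p q ⟨h, hh, h1, h2⟩
      refine ⟨h⁻¹, H.inv_mem hh, ?_, ?_⟩
      · rw [Equiv.Perm.inv_eq_iff_eq, h1]
      · rw [Equiv.Perm.inv_eq_iff_eq, h2]
    · rintro p q w ⟨h, hh, h1, h2⟩ ⟨k, hk, k1, k2⟩
      refine ⟨k * h, H.mul_mem hk hh, ?_, ?_⟩
      · rw [Equiv.Perm.mul_apply, h1, k1]
      · rw [Equiv.Perm.mul_apply, h2, k2]

/-- the orbital containing `(x, y)` -/
def col (H : Subgroup (Perm Ω)) (x y : Ω) : Quotient (orbSetoid H) :=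
  Quotient.mk (orbSetoid H) (x, y)

lemma col_eq {H : Subgroup (Perm Ω)} {x y x' y' : Ω} :
    col H x y = col H x' y' ↔ ∃ h ∈ H, h x = x' ∧ h y = y' := by
  unfold col
  rw [Quotient.eq]
  rfl

lemma col_smul {H : Subgroup (Perm Ω)} {h : Perm Ω} (hh : h ∈ H) (x y : Ω) :
    col H (h x) (h y) = col H x y := (col_eq.2 ⟨h, hh, rfl, rfl⟩).symm

/-- points distinguishing `x` from `y` -/
noncomputable def Dst (H : Subgroup (Perm Ω)) (x y : Ω) : Finset Ω := by
  classical exact Finset.univ.filter (fun z => col H x z ≠ col H y z)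

lemma mem_Dst {H : Subgroup (Perm Ω)} {x y z : Ω} :
    z ∈ Dst H x y ↔ col H x z ≠ col H y z := by
  classical simp [Dst]

lemma Dst_smul {H : Subgroup (Perm Ω)} {h : Perm Ω} (hh : h ∈ H) (x y : Ω) :
    (Dst H (h x) (h y)).card = (Dst H x y).card := by
  have : Dst H (h x) (h y) = (Dst H x y).image h := by
    ext z
    rw [mem_Dst, Finset.mem_image]
    constructor
    · intro hz
      refine ⟨h⁻¹ z, ?_, ?_⟩
      · rw [mem_Dst, ← col_smul hh, ← col_smul hh y]
        have : h (h⁻¹ z) = z := by rw [← Equiv.Perm.eq_inv_iff_eq]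
        rw [this]; exact hz
      · rw [← Equiv.Perm.eq_inv_iff_eq]
    · rintro ⟨w, hw, rfl⟩
      rw [col_smul hh, col_smul hh]
      exact mem_Dst.1 hw
  rw [this, Finset.card_image_of_injective _ h.injective]

lemma Dst_col {H : Subgroup (Perm Ω)} {x y x' y' : Ω} (h : col H x y = col H x' y') :
    (Dst H x y).card = (Dst H x' y').card := by
  obtain ⟨k, hk, rfl, rfl⟩ := col_eq.1 h
  rw [Dst_smul hk]

lemma Dst_symm {H : Subgroup (Perm Ω)} (x y : Ω) : Dst H x y = Dst H y x := by
  ext z; rw [mem_Dst, mem_Dst]; exact ne_comm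

lemma Dst_self {H : Subgroup (Perm Ω)} (x : Ω) : (Dst H x x).card = 0 := by
  rw [Finset.card_eq_zero, Finset.eq_empty_iff_forall_notMem]
  intro z hz
  exact mem_Dst.1 hz rfl

lemma Dst_tri {H : Subgroup (Perm Ω)} (x y z : Ω) :
    (Dst H x z).card ≤ (Dst H x y).card + (Dst H y z).card := by
  refine (Finset.card_le_card ?_).trans (Finset.card_union_le _ _)
  intro w hw
  rw [Finset.mem_union, mem_Dst, mem_Dst]
  rw [mem_Dst] at hw
  by_contra hc
  push Not at hc
  exact hw (hc.1.trans hc.2)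

lemma Dst_le_supp {H : Subgroup (Perm Ω)} {g : Perm Ω} (hg : g ∈ H) (x : Ω) :
    (Dst H x (g x)).card ≤ g.support.card := by
  refine Finset.card_le_card ?_
  intro z hz
  rw [Equiv.Perm.mem_support]
  intro h
  rw [mem_Dst] at hz
  apply hz
  rw [← col_smul hg x z, h]

/-- primitivity in terms of invariant equivalence relations -/
def Prm (H : Subgroup (Perm Ω)) : Prop :=
  ∀ r : Ω → Ω → Prop, Equivalence r → (∀ h ∈ H, ∀ x y, r x y → r (h x) (h y)) →
    (∀ x y, r x y → x = y) ∨ (∀ x y, r x y)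

/-- transitivity -/
def Trn (H : Subgroup (Perm Ω)) : Prop := ∀ x y, ∃ h ∈ H, h x = y

lemma col_diag {H : Subgroup (Perm Ω)} {x y z : Ω} (h : col H x y = col H z z) : x = y := by
  obtain ⟨k, hk, h1, h2⟩ := col_eq.1 h
  exact k.injective (h1.trans h2.symm)

lemma rank_le_Dst {H : Subgroup (Perm Ω)} (hP : Prm H) (hT : Trn H) {x y : Ω} (hxy : x ≠ y) :
    Nat.card (Quotient (orbSetoid H)) ≤ (Dst H x y).card := by
  classical
  have key : ∀ j : Quotient (orbSetoid H), ∃ z, col H x z = j ∧ col H y z ≠ j := by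
    intro j
    by_contra hno
    push Not at hno
    let N : Ω → Finset Ω := fun w => Finset.univ.filter (fun z => col H w z = j)
    have hN : ∀ h ∈ H, ∀ w, N (h w) = (N w).image h := by
      intro h hh w
      ext z
      simp only [N, Finset.mem_filter, Finset.mem_univ, true_and, Finset.mem_image]
      constructor
      · intro hz
        have e : h (h⁻¹ z) = z := by rw [← Equiv.Perm.eq_inv_iff_eq]
        refine ⟨h⁻¹ z, ?_, e⟩
        rw [← col_smul hh, e]; exact hz
      · rintro ⟨v, hv, rfl⟩
        rw [col_smul hh]; exact hv
    have hsub : N x ⊆ N y := by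
      intro z hz
      simp only [N, Finset.mem_filter, Finset.mem_univ, true_and] at hz ⊢
      exact hno z hz
    have hcard : (N x).card = (N y).card := by
      obtain ⟨h, hh, rfl⟩ := hT x y
      rw [hN h hh, Finset.card_image_of_injective _ h.injective]
    have heq : N x = N y := Finset.eq_of_subset_of_card_le hsub hcard.ge
    rcases hP (fun a b => N a = N b) ⟨fun _ => rfl, fun h => h.symm, fun h h' => h.trans h'⟩
      (fun h hh a b hab => by
        show N (h a) = N (h b)
        have hab' : N a = N b := hab
        rw [hN h hh, hN h hh, hab']) with h | h
    · exact hxy (h x y heq)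
    · obtain ⟨⟨a, b⟩, hab⟩ := Quotient.exists_rep j
      have hab' : col H a b = j := hab
      have hall : ∀ w, col H w b = j := by
        intro w
        have h1 : b ∈ N a := by simp [N, hab']
        have h2 : N a = N w := h a w
        rw [h2] at h1
        simpa [N] using h1
      have hx : x = b := col_diag (z := b) ((hall x).trans (hall b).symm)
      have hy : y = b := col_diag (z := b) ((hall y).trans (hall b).symm)
      exact hxy (hx.trans hy.symm)
  choose f hf using key
  have : Fintype (Quotient (orbSetoid H)) := Fintype.ofFinite _
  rw [Nat.card_eq_fintype_card, ← Finset.card_univ]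
  refine Finset.card_le_card_of_injOn f ?_ ?_
  · intro j _
    rw [Finset.mem_coe, mem_Dst, (hf j).1]
    exact (hf j).2.symm
  · intro j _ j' _ h
    rw [← (hf j).1, ← (hf j').1, h]

lemma Dst_max {H : Subgroup (Perm Ω)} (hP : Prm H) {D : ℕ} {x0 y0 : Ω} (h0 : x0 ≠ y0)
    (hD : (Dst H x0 y0).card = D) (x y : Ω) :
    (Dst H x y).card ≤ Nat.card (Quotient (orbSetoid H)) * D := by
  classical
  let st : Ω → Ω → Prop := fun a b => (Dst H a b).card ≤ D
  have hst : ∀ a b, st a b → st b a := by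
    intro a b h; show (Dst H b a).card ≤ D; rw [Dst_symm]; exact h
  have hreach : ∀ a b, Relation.ReflTransGen st a b := by
    have hsy : ∀ a b, Relation.ReflTransGen st a b → Relation.ReflTransGen st b a := by
      intro a b hab
      induction hab with
      | refl => exact .refl
      | tail _ hbc ih => exact Relation.ReflTransGen.head (hst _ _ hbc) ih
    have hiv : ∀ h ∈ H, ∀ a b, Relation.ReflTransGen st a b →
        Relation.ReflTransGen st (h a) (h b) := by
      intro h hh a b hab
      induction hab with
      | refl => exact .refl
      | tail _ hbc ih =>
        refine Relation.ReflTransGen.tail ih ?_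
        show (Dst H (h _) (h _)).card ≤ D
        rw [Dst_smul hh]; exact hbc
    rcases hP (Relation.ReflTransGen st) ⟨fun _ => .refl, fun h => hsy _ _ h,
      fun h h' => h.trans h'⟩ hiv with h | h
    · exact absurd (h x0 y0 (.single hD.le)) h0
    · exact h
  by_contra hlt
  push Not at hlt
  set r := Nat.card (Quotient (orbSetoid H)) with hr
  have hz : ∀ t : Fin (r + 1), ∃ z, t * D < (Dst H x z).card ∧
      (Dst H x z).card ≤ (t + 1) * D := by
    intro t
    have aux : ∀ w, Relation.ReflTransGen st x w → t * D < (Dst H x w).card →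
        ∃ z, t * D < (Dst H x z).card ∧ (Dst H x z).card ≤ (t + 1) * D := by
      intro w hw
      induction hw with
      | refl => intro h; rw [Dst_self] at h; omega
      | tail hab hbc ih =>
        rename_i b c
        intro h
        by_cases hb : t * D < (Dst H x b).card
        · exact ih hb
        · refine ⟨c, h, ?_⟩
          have h1 := Dst_tri (H := H) x b c
          have h2 : (Dst H b c).card ≤ D := hbc
          push Not at hb
          rw [add_mul, one_mul]
          omega
    refine aux y (hreach x y) (lt_of_le_of_lt ?_ hlt)
    exact Nat.mul_le_mul_right _ (by have := t.2; omega)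
  choose f hf using hz
  have hinj : Function.Injective (fun t : Fin (r + 1) => col H x (f t)) := by
    intro s t hst
    have h1 := Dst_col hst
    have hs := hf s
    have ht := hf t
    rw [h1] at hs
    have a1 : (s : ℕ) * D < (t + 1) * D := lt_of_lt_of_le hs.1 ht.2
    have a2 : (t : ℕ) * D < (s + 1) * D := lt_of_lt_of_le ht.1 hs.2
    have b1 := Nat.lt_of_mul_lt_mul_right a1
    have b2 := Nat.lt_of_mul_lt_mul_right a2
    exact Fin.ext (by omega)
  have := Nat.card_le_card_of_injective _ hinj
  rw [Nat.card_eq_fintype_card, Fintype.card_fin] at this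
  omega

lemma valency_bound {H : Subgroup (Perm Ω)} (hP : Prm H) (hT : Trn H) (h2 : ¬ TwoTr H)
    {x z : Ω} (hxz : x ≠ z) (u : ℕ)
    (hc : Nat.card {y // col H y z ≠ col H x z} ≤ u) : Fintype.card Ω ≤ u ^ 2 := by
  classical
  set J := col H x z with hJ
  let U : Ω → Finset Ω := fun w => Finset.univ.filter (fun y => col H y w ≠ J)
  have memU : ∀ {w y}, y ∈ U w ↔ col H y w ≠ J := by intro w y; simp [U]
  have hUu : (U z).card ≤ u := by
    rw [Nat.card_eq_fintype_card, Fintype.card_subtype] at hc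
    exact hc
  have hU : ∀ h ∈ H, ∀ w, U (h w) = (U w).image h := by
    intro h hh w
    ext y
    rw [memU, Finset.mem_image]
    constructor
    · intro hz
      have e : h (h⁻¹ y) = y := by rw [← Equiv.Perm.eq_inv_iff_eq]
      refine ⟨h⁻¹ y, ?_, e⟩
      rw [memU, ← col_smul hh, e]; exact hz
    · rintro ⟨v, hv, rfl⟩
      rw [col_smul hh]; exact memU.1 hv
  have hUc : ∀ w w', (U w).card = (U w').card := by
    intro w w'
    obtain ⟨h, hh, rfl⟩ := hT w w'
    rw [hU h hh, Finset.card_image_of_injective _ h.injective]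
  have hzz : ∀ w, w ∈ U w := by
    intro w
    rw [memU]
    intro h
    exact hxz (col_diag h.symm)
  let A : Finset Ω := (U z).biUnion U
  have hA : A.card ≤ u ^ 2 := by
    refine Finset.card_biUnion_le.trans ?_
    refine (Finset.sum_le_card_nsmul _ _ u (fun w _ => (hUc w z).le.trans hUu)).trans ?_
    rw [smul_eq_mul, sq]
    exact Nat.mul_le_mul_right _ hUu
  have hAinv : ∀ h ∈ H, h z = z → ∀ y ∈ A, h y ∈ A := by
    intro h hh hz y hy
    obtain ⟨w, hw, hy⟩ := Finset.mem_biUnion.1 hy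
    refine Finset.mem_biUnion.2 ⟨h w, ?_, ?_⟩
    · rw [← hz, hU h hh]; exact Finset.mem_image_of_mem _ hw
    · rw [hU h hh]; exact Finset.mem_image_of_mem _ hy
  by_cases hxA : x ∈ A
  · have : A = Finset.univ := by
      rw [Finset.eq_univ_iff_forall]
      intro y
      by_cases hy : col H y z = J
      · obtain ⟨h, hh, h1, h2⟩ := col_eq.1 (hJ.symm.trans hy.symm)
        rw [← h1]
        exact hAinv h hh h2 x hxA
      · exact Finset.mem_biUnion.2 ⟨z, hzz z, memU.2 hy⟩
    rw [this, Finset.card_univ] at hA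
    exact hA
  · exfalso
    have hAU : A ⊆ U z := by
      intro y hy
      rw [memU]
      intro hyJ
      obtain ⟨h, hh, h1, h2⟩ := col_eq.1 (hyJ.trans hJ)
      apply hxA
      rw [← h1]
      exact hAinv h hh h2 y hy
    have hUw : ∀ w ∈ U z, U w = U z := by
      intro w hw
      refine Finset.eq_of_subset_of_card_le ?_ (hUc z w).le
      exact (Finset.subset_biUnion_of_mem U hw).trans hAU
    rcases hP (fun a b => U a = U b) ⟨fun _ => rfl, fun h => h.symm, fun h h' => h.trans h'⟩
      (fun h hh a b hab => by
        show U (h a) = U (h b)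
        have hab' : U a = U b := hab
        rw [hU h hh, hU h hh, hab']) with h | h
    · -- two-transitive
      have hall : ∀ y, y ≠ z → col H y z = J := by
        intro y hy
        by_contra hne
        exact hy (h _ _ (hUw y (memU.2 hne)))
      apply h2
      intro a b c d hab hcd
      obtain ⟨k, hk, hkd⟩ := hT d z
      obtain ⟨k', hk', hkb⟩ := hT b z
      have e1 : k c ≠ z := fun he => hcd (k.injective (he.trans hkd.symm))
      have e2 : k' a ≠ z := fun he => hab (k'.injective (he.trans hkb.symm))
      obtain ⟨m, hm, m1, m2⟩ := col_eq.1 ((hall _ e1).trans (hall _ e2).symm)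
      refine ⟨k'⁻¹ * m * k, H.mul_mem (H.mul_mem (H.inv_mem hk') hm) hk, ?_, ?_⟩
      · rw [Equiv.Perm.mul_apply, Equiv.Perm.mul_apply, m1, Equiv.Perm.inv_eq_iff_eq]
      · rw [Equiv.Perm.mul_apply, Equiv.Perm.mul_apply, hkd, m2, Equiv.Perm.inv_eq_iff_eq, hkb]
    · have h3 : U x = U z := h x z
      have h4 := hzz x
      rw [h3, memU] at h4
      exact h4 rfl

lemma exists_D {H : Subgroup (Perm Ω)} (hP : Prm H) (hT : Trn H) (h2 : ¬ TwoTr H)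
    (hn : 2 ≤ Fintype.card Ω) :
    ∃ D : ℕ, Fintype.card Ω ≤ D ^ 4 ∧ ∀ x y, x ≠ y → D ≤ (Dst H x y).card := by
  classical
  have : Nontrivial Ω := Fintype.one_lt_card_iff_nontrivial.1 (by omega)
  obtain ⟨a, b, hab⟩ := exists_pair_ne Ω
  obtain ⟨⟨x0, y0⟩, hp, hmin⟩ := Finset.exists_min_image (Finset.univ.offDiag : Finset (Ω × Ω))
    (fun p => (Dst H p.1 p.2).card) ⟨(a, b), by simp [hab]⟩
  have h0 : x0 ≠ y0 := (Finset.mem_offDiag.1 hp).2.2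
  set D := (Dst H x0 y0).card with hD
  have hmin' : ∀ x y, x ≠ y → D ≤ (Dst H x y).card := fun x y hxy =>
    hmin (x, y) (by simp [hxy])
  refine ⟨D, ?_, hmin'⟩
  by_contra hlt
  push Not at hlt
  have hmax : ∀ x y, (Dst H x y).card ≤ D * D := fun x y =>
    (Dst_max hP h0 hD.symm x y).trans (Nat.mul_le_mul_right _ (rank_le_Dst hP hT h0))
  let V : Ω → Finset Ω := fun z => Finset.univ.filter (fun y => col H a z ≠ col H y z)
  have hV : ∀ z, z ≠ a → D * D + 1 ≤ (V z).card := by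
    intro z hz
    by_contra hc
    have hc' : Nat.card {y // col H y z ≠ col H a z} ≤ D * D := by
      rw [Nat.card_eq_fintype_card, Fintype.card_subtype]
      have : (Finset.univ.filter (fun y => col H y z ≠ col H a z)) = V z := by
        ext y; simp [V, ne_comm, eq_comm]
      rw [this]; omega
    have := valency_bound hP hT h2 (Ne.symm hz) (D * D) hc'
    have e : (D * D) ^ 2 = D ^ 4 := by ring
    omega
  have hsum : ∑ y : Ω, (Dst H a y).card = ∑ z : Ω, (V z).card := by
    have : ∀ y, (Dst H a y) = Finset.univ.filter (fun z => col H a z ≠ col H y z) := by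
      intro y; ext z; rw [mem_Dst]; simp
    simp_rw [this, V, Finset.card_filter]
    exact Finset.sum_comm
  rw [← Finset.add_sum_erase _ _ (Finset.mem_univ a), Dst_self, zero_add,
    ← Finset.add_sum_erase (f := fun z => (V z).card) _ (Finset.mem_univ a)] at hsum
  have e1 : ∑ y ∈ Finset.univ.erase a, (Dst H a y).card ≤
      (Finset.univ.erase a).card • (D * D) :=
    Finset.sum_le_card_nsmul _ _ _ (fun y _ => hmax a y)
  have e2 : (Finset.univ.erase a).card • (D * D + 1) ≤ ∑ z ∈ Finset.univ.erase a, (V z).card :=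
    Finset.card_nsmul_le_sum _ _ _ (fun z hz => hV z (Finset.mem_erase.1 hz).1)
  rw [Finset.card_erase_of_mem (Finset.mem_univ a), Finset.card_univ, smul_eq_mul] at e1 e2
  rw [mul_add, mul_one] at e2
  omega

end Coh

section Count
variable {Ω : Type*} [Fintype Ω] [DecidableEq Ω]

lemma encode_finset {α : Type*} (F : Finset α) (M : ℕ) (hF : F.card ≤ M) :
    ∃ f : Fin M → Option α, ∀ p, p ∈ F ↔ ∃ i, f i = some p := by
  refine ⟨fun i => F.toList[(i : ℕ)]?, fun p => ?_⟩
  rw [← Finset.mem_toList, List.mem_iff_getElem?]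
  constructor
  · rintro ⟨i, hi⟩
    have : i < F.toList.length := by
      by_contra hc
      rw [List.getElem?_eq_none (by omega)] at hi
      exact absurd hi (by simp)
    rw [Finset.length_toList] at this
    exact ⟨⟨i, by omega⟩, hi⟩
  · rintro ⟨i, hi⟩
    exact ⟨i, hi⟩

lemma card_coord (b : ℕ) (i : Fin b) (A : Finset Ω) :
    (Finset.univ.filter (fun β : Fin b → Ω => β i ∈ A)).card * Fintype.card Ω
      = A.card * Fintype.card Ω ^ b := by
  classical
  have h1 : (Finset.univ.filter (fun β : Fin b → Ω => β i ∈ A)) =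
      Fintype.piFinset (fun j => if j = i then A else Finset.univ) := by
    ext β
    rw [Finset.mem_filter, Fintype.mem_piFinset]
    constructor
    · rintro ⟨_, h⟩ j
      split_ifs with hj
      · rw [hj]; exact h
      · exact Finset.mem_univ _
    · intro h
      have := h i
      rw [if_pos rfl] at this
      exact ⟨Finset.mem_univ _, this⟩
  rw [h1, Fintype.card_piFinset]
  have h2 : Fintype.card Ω ^ b = ∏ _j : Fin b, Fintype.card Ω := by simp
  rw [h2, ← Finset.mul_prod_erase Finset.univ _ (Finset.mem_univ i),
    ← Finset.mul_prod_erase Finset.univ (fun _ : Fin b => Fintype.card Ω) (Finset.mem_univ i),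
    if_pos rfl]
  have h3 : ∏ x ∈ Finset.univ.erase i, (if x = i then A else (Finset.univ : Finset Ω)).card
      = ∏ x ∈ Finset.univ.erase i, Fintype.card Ω := by
    refine Finset.prod_congr rfl fun x hx => ?_
    rw [if_neg (Finset.mem_erase.1 hx).1, Finset.card_univ]
  rw [h3]
  ring

lemma count_bound {H : Subgroup (Perm Ω)} (D b M s : ℕ) (hn : 0 < Fintype.card Ω)
    (hD : ∀ x y, x ≠ y → D ≤ (Dst H x y).card)
    (hb : 2 * (Fintype.card Ω ^ 2 * (Fintype.card Ω - D) ^ b) ≤ Fintype.card Ω ^ b)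
    (hM : 4 * b * s ≤ Fintype.card Ω * (M + 1)) :
    Ns H s ≤ 4 * (b * Fintype.card Ω + 1) ^ M := by
  classical
  set n := Fintype.card Ω with hnn
  let Sep : (Fin b → Ω) → Prop := fun β => ∀ x y, x ≠ y → ∃ i, col H x (β i) ≠ col H y (β i)
  let mv : Perm Ω → (Fin b → Ω) → Finset (Fin b) := fun g β =>
    Finset.univ.filter (fun i => β i ∈ g.support)
  have hU : (Finset.univ : Finset (Fin b → Ω)).card = n ^ b := by
    rw [Finset.card_univ, Fintype.card_fun, Fintype.card_fin]
  have hsep : 2 * (Finset.univ.filter (fun β => ¬ Sep β)).card ≤ n ^ b := by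
    refine le_trans (Nat.mul_le_mul_left 2 ?_) hb
    have hsub : Finset.univ.filter (fun β => ¬ Sep β) ⊆
        (Finset.univ.offDiag : Finset (Ω × Ω)).biUnion
          (fun p => Fintype.piFinset (fun _ : Fin b => (Dst H p.1 p.2)ᶜ)) := by
      intro β hβ
      have h1 := (Finset.mem_filter.1 hβ).2
      simp only [Sep] at h1
      push Not at h1
      obtain ⟨x, y, hxy, h⟩ := h1
      refine Finset.mem_biUnion.2 ⟨(x, y), by simp [hxy], Fintype.mem_piFinset.2 fun i => ?_⟩
      rw [Finset.mem_compl, mem_Dst, not_not]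
      exact h i
    refine (Finset.card_le_card hsub).trans (Finset.card_biUnion_le.trans ?_)
    refine (Finset.sum_le_card_nsmul _ _ ((n - D) ^ b) ?_).trans ?_
    · intro p hp
      rw [Fintype.card_piFinset_const, Finset.card_compl]
      have := hD p.1 p.2 (Finset.mem_offDiag.1 hp).2.2
      exact Nat.pow_le_pow_left (by omega) b
    · rw [smul_eq_mul, Finset.offDiag_card, Finset.card_univ, ← hnn, sq]
      exact Nat.mul_le_mul_right _ (Nat.sub_le _ _)
  have hbad : ∀ g : Perm Ω, g.support.card ≤ s →
      4 * (Finset.univ.filter (fun β => M + 1 ≤ (mv g β).card)).card ≤ n ^ b := by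
    intro g hg
    set bad := Finset.univ.filter (fun β => M + 1 ≤ (mv g β).card) with hbd
    have h1 : bad.card * (M + 1) ≤ ∑ β : Fin b → Ω, (mv g β).card := by
      rw [← smul_eq_mul]
      refine (Finset.card_nsmul_le_sum bad (fun β => (mv g β).card) (M + 1)
        (fun β hβ => (Finset.mem_filter.1 hβ).2)).trans ?_
      exact Finset.sum_le_sum_of_subset (Finset.subset_univ _)
    have h2 : ∑ β : Fin b → Ω, (mv g β).card =
        ∑ i : Fin b, (Finset.univ.filter (fun β : Fin b → Ω => β i ∈ g.support)).card := by
      simp_rw [mv, Finset.card_filter]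
      exact Finset.sum_comm
    have h3 : (∑ β : Fin b → Ω, (mv g β).card) * n ≤ b * s * n ^ b := by
      rw [h2, Finset.sum_mul]
      simp_rw [hnn, card_coord]
      rw [Finset.sum_const, Finset.card_univ, Fintype.card_fin, smul_eq_mul, mul_assoc b]
      exact Nat.mul_le_mul_left _ (Nat.mul_le_mul_right _ hg)
    have h4 : (n * (M + 1)) * (4 * bad.card) ≤ (n * (M + 1)) * n ^ b := by
      calc (n * (M + 1)) * (4 * bad.card) = 4 * (bad.card * (M + 1) * n) := by ring
        _ ≤ 4 * ((∑ β : Fin b → Ω, (mv g β).card) * n) := by gcongr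
        _ ≤ 4 * (b * s * n ^ b) := by gcongr
        _ = 4 * b * s * n ^ b := by ring
        _ ≤ _ := Nat.mul_le_mul_right _ hM
    exact Nat.le_of_mul_le_mul_left h4 (by positivity)
  let S := (els H).filter (fun g => g.support.card ≤ s)
  let gd : Perm Ω → Finset (Fin b → Ω) := fun g =>
    Finset.univ.filter (fun β => Sep β ∧ (mv g β).card ≤ M)
  have hgd : ∀ g ∈ S, n ^ b ≤ 4 * (gd g).card := by
    intro g hg
    have h1 := hbad g (Finset.mem_filter.1 hg).2
    have hsub : (Finset.univ : Finset (Fin b → Ω)) ⊆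
        (Finset.univ.filter (fun β => ¬ Sep β)) ∪
        (Finset.univ.filter (fun β => M + 1 ≤ (mv g β).card)) ∪ gd g := by
      intro β _
      simp only [gd, Finset.mem_union, Finset.mem_filter, Finset.mem_univ, true_and]
      by_cases h : Sep β
      · by_cases h' : (mv g β).card ≤ M
        · exact Or.inr ⟨h, h'⟩
        · exact Or.inl (Or.inr (by omega))
      · exact Or.inl (Or.inl h)
    have h2 := (Finset.card_le_card hsub).trans ((Finset.card_union_le _ _).trans
      (Nat.add_le_add_right (Finset.card_union_le _ _) _))
    rw [hU] at h2
    omega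
  have hbound : ∀ β ∈ (Finset.univ : Finset (Fin b → Ω)),
      (S.filter (fun g => β ∈ gd g)).card ≤ (b * n + 1) ^ M := by
    intro β _
    by_cases hβ : Sep β
    · let E : Perm Ω → Finset (Fin b × Ω) := fun g => (mv g β).image (fun i => (i, g (β i)))
      have hE : ∀ g, (mv g β).card ≤ M → ∃ f : Fin M → Option (Fin b × Ω),
          ∀ p, p ∈ E g ↔ ∃ i, f i = some p := fun g hg =>
        encode_finset (E g) M (Finset.card_image_le.trans hg)
      choose! F hF using hE
      have hinj : Set.InjOn F (S.filter (fun g => β ∈ gd g)) := by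
        intro g hg g' hg' hFF
        simp only [S, gd, Finset.coe_filter, Finset.mem_filter, mem_els, Finset.mem_univ,
          true_and, Set.mem_setOf_eq] at hg hg'
        have e1 := hF g hg.2.2
        have e2 := hF g' hg'.2.2
        have hEE : E g = E g' := by
          ext p
          rw [e1, e2, hFF]
        have hag : ∀ g g' : Perm Ω, E g = E g' → ∀ i, g (β i) ≠ β i → g' (β i) = g (β i) := by
          intro g g' hEE i hi
          have h1 : (i, g (β i)) ∈ E g :=
            Finset.mem_image.2 ⟨i, by simp [mv, hi], rfl⟩
          rw [hEE] at h1
          obtain ⟨j, _, hj⟩ := Finset.mem_image.1 h1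
          simp only [Prod.mk.injEq] at hj
          obtain ⟨rfl, hj⟩ := hj
          exact hj
        have hagree : ∀ i, g (β i) = g' (β i) := by
          intro i
          by_cases h1 : g (β i) = β i
          · by_cases h2 : g' (β i) = β i
            · rw [h1, h2]
            · exact hag g' g hEE.symm i h2
          · exact (hag g g' hEE i h1).symm
        ext x
        by_contra hne
        have hx : x ≠ (g'⁻¹ * g) x := by
          intro h
          have : g'⁻¹ (g x) = x := h.symm
          rw [Equiv.Perm.inv_eq_iff_eq] at this
          exact hne this
        obtain ⟨i, hi⟩ := hβ _ _ hx
        apply hi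
        have hk : g'⁻¹ * g ∈ H := H.mul_mem (H.inv_mem hg'.1.1) hg.1.1
        have hfix : (g'⁻¹ * g) (β i) = β i := by
          rw [Equiv.Perm.mul_apply, Equiv.Perm.inv_eq_iff_eq]; exact hagree i
        conv_rhs => rw [← hfix]
        rw [col_smul hk]
      have := Finset.card_le_card_of_injOn (t := Finset.univ) F (fun _ _ => Finset.mem_univ _) hinj
      rw [Finset.card_univ, Fintype.card_fun, Fintype.card_option, Fintype.card_prod,
        Fintype.card_fin, Fintype.card_fin] at this
      exact this
    · have : S.filter (fun g => β ∈ gd g) = ∅ := by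
        rw [Finset.filter_eq_empty_iff]
        intro g _ h
        exact hβ (Finset.mem_filter.1 h).2.1
      rw [this]; simp
  have hdc : ∑ g ∈ S, (gd g).card = ∑ β : Fin b → Ω, (S.filter (fun g => β ∈ gd g)).card := by
    have : ∀ g, (gd g).card = (Finset.univ.filter (fun β => β ∈ gd g)).card := by
      intro g; congr 1; ext β; simp
    simp_rw [this, Finset.card_filter]
    exact Finset.sum_comm
  have h5 : S.card * n ^ b ≤ 4 * (b * n + 1) ^ M * n ^ b := by
    calc S.card * n ^ b ≤ ∑ g ∈ S, 4 * (gd g).card := by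
          rw [← smul_eq_mul]; exact Finset.card_nsmul_le_sum _ _ _ hgd
      _ = 4 * ∑ β : Fin b → Ω, (S.filter (fun g => β ∈ gd g)).card := by
          rw [← Finset.mul_sum, hdc]
      _ ≤ 4 * (n ^ b * (b * n + 1) ^ M) := by
          refine Nat.mul_le_mul_left 4 ?_
          refine (Finset.sum_le_card_nsmul _ _ _ hbound).trans ?_
          rw [hU, smul_eq_mul]
      _ = _ := by ring
  exact Nat.le_of_mul_le_mul_right h5 (by positivity)

end Count

section Asym

lemma many_primes (m : ℕ) (hm : 10 ≤ m) : m ≤ Nat.primeCounting (m ^ 2) := by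
  have h1 := Chebyshev.psi_ge (m ^ 2)
  have h2 := Chebyshev.psi_le_primeCounting_mul_log (m ^ 2)
  have hm' : (10 : ℝ) ≤ m := by exact_mod_cast hm
  have hpos : (0 : ℝ) < m := by linarith
  have hl2 := Real.log_two_gt_d9
  have hl2' := Real.log_two_lt_d9
  push_cast at h1 h2
  have hlog : Real.log m ≤ m / 4 := by
    have e1 : Real.log ((m : ℝ) / 8) ≤ m / 8 - 1 := Real.log_le_sub_one_of_pos (by positivity)
    rw [Real.log_div hpos.ne' (by norm_num)] at e1
    have e2 : Real.log 8 = 3 * Real.log 2 := by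
      rw [show (8 : ℝ) = 2 ^ 3 by norm_num, Real.log_pow]; norm_num
    linarith
  have hlogpos : 0 < Real.log m := Real.log_pos (by linarith)
  have hlogsq : Real.log ((m : ℝ) ^ 2) = 2 * Real.log m := by
    rw [Real.log_pow]; norm_num
  have hlog1 : Real.log ((m : ℝ) ^ 2 + 1) ≤ 1 + 2 * Real.log m := by
    have : Real.log ((m : ℝ) ^ 2 + 1) ≤ Real.log (2 * (m : ℝ) ^ 2) :=
      Real.log_le_log (by positivity) (by nlinarith)
    rw [Real.log_mul (by norm_num) (by positivity), hlogsq] at this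
    linarith
  rw [hlogsq] at h2
  have h3 : (m : ℝ) ^ 2 * Real.log 2 - (1 + 2 * Real.log m) ≤
      (Nat.primeCounting (m ^ 2) : ℝ) * (2 * Real.log m) := by linarith
  by_contra hc
  push Not at hc
  have hc' : (Nat.primeCounting (m ^ 2) : ℝ) ≤ m - 1 := by
    have : Nat.primeCounting (m ^ 2) + 1 ≤ m := hc
    have : ((Nat.primeCounting (m ^ 2) + 1 : ℕ) : ℝ) ≤ m := by exact_mod_cast this
    push_cast at this
    linarith
  have h4 : (Nat.primeCounting (m ^ 2) : ℝ) * (2 * Real.log m) ≤ (m - 1) * (2 * Real.log m) :=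
    mul_le_mul_of_nonneg_right hc' (by positivity)
  have h5 : (m : ℝ) * Real.log m ≤ m * (m / 4) := mul_le_mul_of_nonneg_left hlog hpos.le
  nlinarith

lemma prime_set (L : ℕ) (hL : 2 ≤ L) : ∃ ps : Finset ℕ, (∀ p ∈ ps, p.Prime) ∧
    5 * L ≤ ps.card ∧ 0 < ps.card ∧
    ∑ p ∈ ps, p ≤ ((5 * L + 1) ^ 2 + 1) * (5 * L + 1) ^ 2 := by
  have h := many_primes (5 * L + 1) (by omega)
  set y := (5 * L + 1) ^ 2 with hy
  have hcard : Nat.primeCounting y = ((Finset.range (y + 1)).filter Nat.Prime).card := by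
    rw [Nat.primeCounting, Nat.primeCounting', Nat.count_eq_card_filter_range]
  refine ⟨(Finset.range (y + 1)).filter Nat.Prime, fun p hp => (Finset.mem_filter.1 hp).2,
    by omega, by omega, ?_⟩
  refine (Finset.sum_le_card_nsmul _ _ y ?_).trans ?_
  · intro p hp
    have := Finset.mem_range.1 (Finset.mem_filter.1 hp).1
    omega
  · rw [smul_eq_mul]
    refine Nat.mul_le_mul_right _ ((Finset.card_filter_le _ _).trans ?_)
    simp

lemma poly_lt_two_pow (A k : ℕ) : ∃ L0, ∀ L, L0 ≤ L → A * (L + 1) ^ k < 2 ^ L := by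
  have h := tendsto_pow_const_div_const_pow_of_one_lt k (r := (2 : ℝ)) (by norm_num)
  have hA : (0 : ℝ) < 1 / (2 * (A + 1)) := by positivity
  have h2 := (h.eventually (gt_mem_nhds hA))
  obtain ⟨L0, hL0⟩ := Filter.eventually_atTop.1 h2
  refine ⟨L0, fun L hL => ?_⟩
  have h3 := hL0 (L + 1) (by omega)
  rw [div_lt_div_iff₀ (by positivity) (by positivity)] at h3
  push_cast at h3
  have h4 : (A : ℝ) * ((L : ℝ) + 1) ^ k < 2 ^ L := by
    have : (0 : ℝ) ≤ ((L : ℝ) + 1) ^ k := by positivity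
    rw [pow_succ] at h3
    nlinarith
  exact_mod_cast h4

lemma asym : ∃ L0, 5 ≤ L0 ∧ ∀ L, L0 ≤ L →
    (16 + 32 * (3 * L + 3) * (2 * L + 4)) ^ 4 < 2 ^ L ∧
    80 * (L + 1) ^ 2 * (((5 * L + 1) ^ 2 + 1) * (5 * L + 1) ^ 2) + 5 * (8 * L + 16) < 2 ^ L := by
  obtain ⟨L1, h1⟩ := poly_lt_two_pow (400 ^ 4) 8
  obtain ⟨L2, h2⟩ := poly_lt_two_pow (53000) 6
  refine ⟨L1 + L2 + 5, by omega, fun L hL => ⟨?_, ?_⟩⟩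
  · refine lt_of_le_of_lt ?_ (h1 L (by omega))
    have : 16 + 32 * (3 * L + 3) * (2 * L + 4) ≤ 400 * (L + 1) ^ 2 := by nlinarith
    calc _ ≤ (400 * (L + 1) ^ 2) ^ 4 := Nat.pow_le_pow_left this 4
      _ = _ := by ring
  · refine lt_of_le_of_lt ?_ (h2 L (by omega))
    have e1 : (5 * L + 1) ^ 2 ≤ 25 * (L + 1) ^ 2 := by nlinarith
    have e2 : (5 * L + 1) ^ 2 + 1 ≤ 26 * (L + 1) ^ 2 := by nlinarith
    have e3 : 5 * (8 * L + 16) ≤ 80 * (L + 1) ^ 6 := by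
      have : L + 1 ≤ (L + 1) ^ 6 := Nat.le_self_pow (by norm_num) _
      have : 5 * (8 * L + 16) ≤ 80 * (L + 1) := by omega
      omega
    calc _ ≤ 80 * (L + 1) ^ 2 * ((26 * (L + 1) ^ 2) * (25 * (L + 1) ^ 2)) + 80 * (L + 1) ^ 6 := by
          gcongr
      _ = 52080 * (L + 1) ^ 6 := by ring
      _ ≤ _ := Nat.mul_le_mul_right _ (by norm_num)

variable {Ω : Type*} [Fintype Ω] [DecidableEq Ω]

lemma four_bound (n L : ℕ) (hn : 1 ≤ n) (hL : n < 2 ^ (L + 1)) :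
    (2 * n * (n + 1)) ^ 4 < 2 ^ (8 * L + 16) := by
  have h1 : 2 * n * (n + 1) < 2 ^ (2 * L + 4) := by
    calc 2 * n * (n + 1) ≤ 4 * (n * n) := by nlinarith
      _ < 4 * (2 ^ (L + 1) * 2 ^ (L + 1)) := by gcongr
      _ = 2 ^ (2 * L + 4) := by ring
  calc _ < (2 ^ (2 * L + 4)) ^ 4 := Nat.pow_lt_pow_left h1 (by norm_num)
    _ = _ := by rw [← pow_mul]; congr 1; ring

lemma case_two {H : Subgroup (Perm Ω)} (hT : TwoTr H) (L : ℕ)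
    (hL1 : 2 ^ L ≤ Fintype.card Ω) (hL2 : Fintype.card Ω < 2 ^ (L + 1)) (hL5 : 5 ≤ L)
    (h4 : ∀ g ∈ H, g ≠ 1 → 4 ≤ g.support.card)
    (hbig : 80 * (L + 1) ^ 2 * (((5 * L + 1) ^ 2 + 1) * (5 * L + 1) ^ 2) + 5 * (8 * L + 16)
      < 2 ^ L) :
    (∑ p ∈ (els H ×ˢ els H).erase (1, 1), 2 ^ min (nq p.1) (nq p.2)) *
      (2 * Fintype.card Ω) < 2 ^ Fintype.card Ω := by
  set n := Fintype.card Ω with hnn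
  have hn30 : 30 ≤ n := by
    have : 2 ^ 5 ≤ 2 ^ L := Nat.pow_le_pow_right (by norm_num) hL5
    omega
  have hB := bochert hT hn30 h4
  obtain ⟨ps, hps, hc, hc0, hsum⟩ := prime_set L (by omega)
  obtain ⟨l, hl, hg⟩ := exists_no_giant (H := H) (by omega) hB ps hps L hL2 hc hc0
  set Y := ((5 * L + 1) ^ 2 + 1) * (5 * L + 1) ^ 2 with hY
  have hord := order_le_of_no_giant hT (by omega) l hg (2 * L + 2) (by
    rw [← hnn]
    calc n ^ 2 < (2 ^ (L + 1)) ^ 2 := Nat.pow_lt_pow_left hL2 (by norm_num)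
      _ = _ := by rw [← pow_mul]; congr 1; ring)
  have hord2 : (els H).card ^ 8 ≤ 2 ^ (16 * (L + 1) ^ 2 * Y) := by
    calc (els H).card ^ 8 ≤ (n ^ ((2 * L + 2) * l.length)) ^ 8 := Nat.pow_le_pow_left hord 8
      _ ≤ ((2 ^ (L + 1)) ^ ((2 * L + 2) * l.length)) ^ 8 := by gcongr
      _ = 2 ^ (16 * (L + 1) ^ 2 * l.length) := by
        rw [← pow_mul, ← pow_mul]; congr 1; ring
      _ ≤ _ := Nat.pow_le_pow_right (by norm_num) (Nat.mul_le_mul_left _ (by omega))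
  have hY' : 5 * (16 * (L + 1) ^ 2 * Y) + 5 * (8 * L + 16) < n := by
    calc _ = 80 * (L + 1) ^ 2 * Y + 5 * (8 * L + 16) := by ring
      _ < 2 ^ L := hbig
      _ ≤ n := hL1
  refine key_sum (n / 5) ?_ ?_ ?_
  · intro g hg h1
    have := hB g hg h1
    omega
  · intro s hs _
    have h1 : Ns H s ≤ (els H).card := Finset.card_filter_le _ _
    refine (Nat.pow_le_pow_left h1 8).trans (hord2.trans ?_)
    exact Nat.pow_le_pow_right (by norm_num) (by omega)
  · refine (four_bound n L (by omega) hL2).trans_le ?_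
    exact Nat.pow_le_pow_right (by norm_num) (by omega)

lemma base_bound (n D b L : ℕ) (hn : 0 < n) (hDn : D ≤ n) (hL2 : n < 2 ^ (L + 1))
    (hb : n * (2 * L + 3) ≤ D * b) : 2 * (n ^ 2 * (n - D) ^ b) ≤ n ^ b := by
  have hn' : (0 : ℝ) < n := by exact_mod_cast hn
  have h1 : ((n - D : ℕ) : ℝ) ≤ n * Real.exp (-(D / n)) := by
    have := Real.one_sub_le_exp_neg ((D : ℝ) / n)
    rw [Nat.cast_sub hDn]
    calc (n : ℝ) - D = n * (1 - D / n) := by field_simp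
      _ ≤ _ := by gcongr
  have h2 : (((n - D : ℕ) : ℝ)) ^ b ≤ (n : ℝ) ^ b * Real.exp (-(2 * L + 3)) := by
    calc _ ≤ (n * Real.exp (-((D : ℝ) / n))) ^ b := by gcongr
      _ = (n : ℝ) ^ b * Real.exp (-(D * b / n)) := by
        rw [mul_pow, ← Real.exp_nat_mul]; congr 2; ring
      _ ≤ _ := by
        gcongr
        rw [le_div_iff₀ hn']
        have : ((n * (2 * L + 3) : ℕ) : ℝ) ≤ ((D * b : ℕ) : ℝ) := by exact_mod_cast hb
        push_cast at this
        linarith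
  have h3 : (2 : ℝ) ^ (2 * L + 3) * Real.exp (-(2 * L + 3)) ≤ 1 := by
    rw [Real.exp_neg, ← div_eq_mul_inv, div_le_one (Real.exp_pos _)]
    have : Real.exp (2 * L + 3) = Real.exp 1 ^ (2 * L + 3) := by
      rw [← Real.exp_nat_mul]; push_cast; ring_nf
    rw [this]
    have := Real.add_one_le_exp 1
    gcongr
    linarith
  have h4 : 2 * n ^ 2 ≤ 2 ^ (2 * L + 3) := by
    calc 2 * n ^ 2 ≤ 2 * (2 ^ (L + 1)) ^ 2 := by gcongr
      _ = _ := by ring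
  have h4' : (2 : ℝ) * n ^ 2 ≤ 2 ^ (2 * L + 3) := by exact_mod_cast h4
  have : ((2 * (n ^ 2 * (n - D) ^ b) : ℕ) : ℝ) ≤ ((n ^ b : ℕ) : ℝ) := by
    push_cast
    calc (2 : ℝ) * (n ^ 2 * ((n - D : ℕ) : ℝ) ^ b) = (2 * n ^ 2) * ((n - D : ℕ) : ℝ) ^ b := by ring
      _ ≤ 2 ^ (2 * L + 3) * ((n : ℝ) ^ b * Real.exp (-(2 * L + 3))) := by gcongr
      _ = (n : ℝ) ^ b * (2 ^ (2 * L + 3) * Real.exp (-(2 * L + 3))) := by ring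
      _ ≤ (n : ℝ) ^ b * 1 := by gcongr
      _ = _ := by ring
  exact_mod_cast this

lemma case_prim {H : Subgroup (Perm Ω)} (hP : Prm H) (hTr : Trn H) (hT : ¬ TwoTr H) (L : ℕ)
    (hL1 : 2 ^ L ≤ Fintype.card Ω) (hL2 : Fintype.card Ω < 2 ^ (L + 1)) (hL5 : 5 ≤ L)
    (hbig : (16 + 32 * (3 * L + 3) * (2 * L + 4)) ^ 4 < 2 ^ L) :
    (∑ p ∈ (els H ×ˢ els H).erase (1, 1), 2 ^ min (nq p.1) (nq p.2)) *
      (2 * Fintype.card Ω) < 2 ^ Fintype.card Ω := by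
  have hn30 : 30 ≤ Fintype.card Ω := by
    have : 2 ^ 5 ≤ 2 ^ L := Nat.pow_le_pow_right (by norm_num) hL5
    omega
  obtain ⟨D, hD4, hD⟩ := exists_D hP hTr hT (by omega)
  have hnt : Nontrivial Ω := Fintype.one_lt_card_iff_nontrivial.1 (by omega)
  obtain ⟨a, a', haa⟩ := exists_pair_ne Ω
  have hDn : D ≤ Fintype.card Ω := (hD a a' haa).trans (Finset.card_le_univ _)
  set n := Fintype.card Ω with hnn
  set E := 16 + 32 * (3 * L + 3) * (2 * L + 4) with hE
  have hED : E < D := lt_of_pow_lt_pow_left₀ 4 (by positivity)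
    (hbig.trans_le (hL1.trans hD4))
  have hEL : 8 * L + 16 ≤ E := by rw [hE]; nlinarith
  have hEn : 2 * L + 5 ≤ n := by
    have h1 : E ≤ E ^ 4 := Nat.le_self_pow (by norm_num) _
    omega
  set b := n * (2 * L + 3) / D + 1 with hb
  have hDpos : 0 < D := by omega
  have hnpos : 0 < n := by omega
  have hb1 : n * (2 * L + 3) ≤ D * b := by
    have h1 := Nat.lt_div_mul_add (a := n * (2 * L + 3)) hDpos
    have h2 : D * b = n * (2 * L + 3) / D * D + D := by rw [hb]; ring
    exact h2 ▸ h1.le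
  have hb2 : D * b ≤ n * (2 * L + 4) := by
    have := Nat.div_mul_le_self (n * (2 * L + 3)) D
    have h2 : D * b = n * (2 * L + 3) / D * D + D := by rw [hb]; ring
    rw [h2]
    have e : n * (2 * L + 4) = n * (2 * L + 3) + n := by ring
    omega
  have hb3 : b ≤ n * (2 * L + 4) := le_trans (Nat.le_mul_of_pos_left _ hDpos) hb2
  have hbn : b * n + 1 ≤ 2 ^ (3 * L + 3) := by
    calc b * n + 1 ≤ n * (2 * L + 4) * n + n * n := by nlinarith
      _ = (2 * L + 5) * n * n := by ring
      _ ≤ n * n * n := by gcongr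
      _ ≤ 2 ^ (L + 1) * 2 ^ (L + 1) * 2 ^ (L + 1) := by gcongr
      _ = _ := by rw [← pow_add, ← pow_add]; congr 1; ring
  refine key_sum D ?_ ?_ ?_
  · intro g hg h1
    obtain ⟨x, hx⟩ : ∃ x, g x ≠ x := by
      by_contra hh; push Not at hh; exact h1 (Equiv.ext hh)
    exact (hD x (g x) (Ne.symm hx)).trans (Dst_le_supp hg x)
  · intro s hs _
    set M := 4 * b * s / n with hM
    have hM1 : 4 * b * s ≤ n * (M + 1) := by
      have h1 := Nat.lt_div_mul_add (a := 4 * b * s) hnpos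
      have h2 : n * (M + 1) = 4 * b * s / n * n + n := by rw [hM]; ring
      rw [h2]; exact h1.le
    have hM2 : M * n ≤ 4 * b * s := Nat.div_mul_le_self _ _
    have hM3 : D * M ≤ 4 * s * (2 * L + 4) := by
      refine Nat.le_of_mul_le_mul_right (c := n) ?_ hnpos
      calc D * M * n = D * (M * n) := by ring
        _ ≤ D * (4 * b * s) := by gcongr
        _ = 4 * s * (D * b) := by ring
        _ ≤ 4 * s * (n * (2 * L + 4)) := by gcongr
        _ = _ := by ring
    have hcb := count_bound (H := H) D b M s hnpos hD (base_bound n D b L hnpos hDn hL2 hb1) hM1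
    have hexp : 16 + 8 * (3 * L + 3) * M ≤ s := by
      refine le_of_mul_le_mul_left (a := D) ?_ hDpos
      calc D * (16 + 8 * (3 * L + 3) * M) = 16 * D + 8 * (3 * L + 3) * (D * M) := by ring
        _ ≤ 16 * s + 8 * (3 * L + 3) * (4 * s * (2 * L + 4)) := by gcongr
        _ = E * s := by rw [hE]; ring
        _ ≤ D * s := by gcongr
    calc Ns H s ^ 8 ≤ (4 * (b * n + 1) ^ M) ^ 8 := Nat.pow_le_pow_left hcb 8
      _ ≤ (4 * (2 ^ (3 * L + 3)) ^ M) ^ 8 := by gcongr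
      _ = 2 ^ (16 + 8 * (3 * L + 3) * M) := by
        rw [mul_pow, ← pow_mul, ← pow_mul, pow_add]
        congr 1
        congr 1; ring
      _ ≤ 2 ^ s := Nat.pow_le_pow_right (by norm_num) hexp
  · refine (four_bound n L (by omega) hL2).trans_le ?_
    exact Nat.pow_le_pow_right (by norm_num) (by omega)

end Asym

open scoped Pointwise in
lemma prm_of_blocks {n : ℕ} {H : Subgroup (Perm (Fin n))} (hT : IsPretransitive H (Fin n))
    (hB : ∀ B : Set (Fin n), IsBlock H B → B.Subsingleton ∨ B = Set.univ) : Prm H := by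
  intro r hr hinv
  by_cases hn : ∃ x, ∀ y, r x y
  · obtain ⟨x, hx⟩ := hn
    exact Or.inr fun a b => hr.trans (hr.symm (hx a)) (hx b)
  · push Not at hn
    left
    intro x y hxy
    have hbl : IsBlock H {z | r x z} := by
      rw [isBlock_iff_smul_eq_or_disjoint]
      intro g
      by_cases hd : Disjoint (g • {z | r x z}) {z | r x z}
      · exact Or.inr hd
      · left
        rw [Set.not_disjoint_iff] at hd
        obtain ⟨w, hw, hw'⟩ := hd
        obtain ⟨v, hv, rfl⟩ := hw
        have hv' : r x v := hv
        have h1 : r x ((g : Perm (Fin n)) v) := hw'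
        have h2 : r ((g : Perm (Fin n)) x) ((g : Perm (Fin n)) v) := hinv g g.2 _ _ hv'
        have h3 : r x ((g : Perm (Fin n)) x) := hr.trans h1 (hr.symm h2)
        ext z
        constructor
        · rintro ⟨u, hu, rfl⟩
          have hu' : r x u := hu
          exact hr.trans h3 (hinv g g.2 _ _ hu')
        · intro hz
          have hz' : r x z := hz
          have e : (g : Perm (Fin n)) ((g : Perm (Fin n))⁻¹ z) = z := by
            rw [← Equiv.Perm.eq_inv_iff_eq]
          refine ⟨(g : Perm (Fin n))⁻¹ z, ?_, e⟩
          have h4 := hinv _ (H.inv_mem g.2) _ _ (hr.trans (hr.symm h3) hz')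
          rw [perm_inv_app] at h4
          exact h4
    rcases hB _ hbl with h | h
    · exact h (show r x x from hr.refl x) hxy
    · obtain ⟨y', hy'⟩ := hn x
      have : y' ∈ {z | r x z} := by rw [h]; trivial
      exact absurd this hy'

lemma trn_of_pretransitive {n : ℕ} {H : Subgroup (Perm (Fin n))}
    (hT : IsPretransitive H (Fin n)) : Trn H := by
  intro x y
  obtain ⟨g, hg⟩ := hT.exists_smul_eq x y
  exact ⟨g, g.2, hg⟩

lemma permIso_refl {α : Type*} (H : Subgroup (Perm α)) : PermIso H H := by
  refine ⟨Equiv.refl α, ?_⟩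
  have : _root_.permCongrHom (Equiv.refl α) = MonoidHom.id _ := by
    ext p x; rfl
  rw [this, Subgroup.map_id]

/-- If `H` is primitive of degree `n` and not permutation-isomorphic to `Alt n`, `Sym n`,
`Alt m` or `Sym m` on `2`-subsets (`n = C(m,2)`), nor to any `(Alt m)² ≤ H ≤ Sym m ≀ Sym 2`
in product action (`n = m²`), then `k^n/|H| ≤ k(X ≀ H) < (1 + 1/(kn)) k^n/|H|` whenever `n`
or `k` is sufficiently large. -/
theorem statement9 :
    ∃ C : ℕ, ∀ (n : ℕ) (X : Type) [Group X] [Finite X], Nontrivial X →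
      ∀ H : Subgroup (Perm (Fin n)),
      (IsPretransitive H (Fin n) ∧
        ∀ B : Set (Fin n), IsBlock H B → B.Subsingleton ∨ B = Set.univ) →
      ¬ PermIso H (⊤ : Subgroup (Perm (Fin n))) →
      ¬ PermIso H (alternatingGroup (Fin n)) →
      (∀ m : ℕ, n = m.choose 2 →
        ¬ PermIso H (subsetsHom m 2).range ∧
        ¬ PermIso H (Subgroup.map (subsetsHom m 2) (alternatingGroup (Fin m)))) →
      (∀ m : ℕ, n = m * m → ∀ K : Subgroup (Perm (Fin m × Fin m)),
        altSquare m ≤ K → K ≤ symWrSym2 m → ¬ PermIso H K) →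
      (C ≤ n ∨ C ≤ kclass X) →
      ((kclass X : ℝ) ^ n / (Nat.card H : ℝ) ≤ (kclass (Wreath X H) : ℝ) ∧
        (kclass (Wreath X H) : ℝ) <
          (1 + 1 / ((kclass X : ℝ) * n)) * ((kclass X : ℝ) ^ n / (Nat.card H : ℝ))) := by
  obtain ⟨L0, hL0, hasym⟩ := asym
  refine ⟨2 ^ L0 + (Nat.factorial (2 ^ L0)) ^ 2 * 2 ^ L0 + 1, ?_⟩
  intro n X _ _ hX H hprim hS hA _ _ hC
  have hS' : H ≠ ⊤ := fun h => hS (h ▸ permIso_refl H)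
  have hA' : H ≠ alternatingGroup (Fin n) := fun h => hA (by
    have := permIso_refl H
    rwa [h] at this ⊢)
  have hn2 : 2 ≤ n := by
    by_contra hlt
    have : Subsingleton (Fin n) := by
      rw [← not_nontrivial_iff_subsingleton]
      intro hnt
      have := Fintype.one_lt_card_iff_nontrivial.2 hnt
      rw [Fintype.card_fin] at this
      omega
    exact hS' (Subsingleton.elim _ _)
  have hpre : IsPreprimitive H (Fin n) := by
    haveI := hprim.1
    exact { isTrivialBlock_of_isBlock := fun hB => hprim.2 _ hB }
  have h4 : ∀ g ∈ H, g ≠ 1 → 4 ≤ g.support.card := fun g hg h1 =>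
    supp_ge_four hpre (not_alt_le hS' hA') hg h1
  have hfin := final_of_sum X H (by rw [Fintype.card_fin]; omega)
  have hk2 := two_le_kclass X
  have hcard : Fintype.card (Fin n) = n := Fintype.card_fin n
  rw [hcard] at hfin
  apply hfin
  by_cases hn : 2 ^ L0 ≤ n
  · have hL : L0 ≤ Nat.log 2 n := by
      have := Nat.log_mono_right (b := 2) hn
      rwa [Nat.log_pow (by norm_num)] at this
    have e1 : 2 ^ Nat.log 2 n ≤ n := Nat.pow_log_le_self 2 (by omega)
    have e2 : n < 2 ^ (Nat.log 2 n + 1) := Nat.lt_pow_succ_log_self (by norm_num) n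
    have hs : (∑ p ∈ (els H ×ˢ els H).erase (1, 1), 2 ^ min (nq p.1) (nq p.2)) *
      (2 * Fintype.card (Fin n)) < 2 ^ Fintype.card (Fin n) := by
      by_cases hT : TwoTr H
      · exact case_two hT (Nat.log 2 n) (by rw [hcard]; exact e1) (by rw [hcard]; exact e2)
          (by omega) h4 (hasym _ hL).2
      · exact case_prim (prm_of_blocks hprim.1 hprim.2) (trn_of_pretransitive hprim.1) hT
          (Nat.log 2 n) (by rw [hcard]; exact e1) (by rw [hcard]; exact e2)
          (by omega) (hasym _ hL).1
    have := sum_large h4 (kclass X) hk2 hs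
    rwa [hcard] at this
  · push Not at hn
    have hK : (2 ^ L0).factorial ^ 2 * 2 ^ L0 < kclass X := by
      rcases hC with hC | hC
      · have : 0 ≤ (2 ^ L0).factorial ^ 2 * 2 ^ L0 := Nat.zero_le _
        omega
      · omega
    have hlt : n.factorial ^ 2 * n < kclass X := by
      refine lt_of_le_of_lt ?_ hK
      exact Nat.mul_le_mul (Nat.pow_le_pow_left (Nat.factorial_le hn.le) 2) hn.le
    have := sum_small h4 (kclass X) (by rw [hcard]; exact hn2) (by rw [hcard]; exact hlt)
    rwa [hcard] at this
end

section
/- Let X be a nontrivial finite group with k := k(X) conjugacy classes and let G = X ≀ H where H = Sym(n) or H = Alt(n) in the natural action on {1,…,n}. Then there exists an absolute constant C such that whenever n ≥ C or k ≥ C, one has k(G) ≤ k^n. -/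
open Equiv MulAction

/-- weighted solutions -/
def PP {A : Type} [Fintype A] [DecidableEq A] (w : A → ℕ) (n : ℕ) : Finset (A → ℕ) :=
  (Fintype.piFinset fun _ => Finset.range (n+1)).filter (fun m => ∑ a, w a * m a = n)

lemma mem_PP {A : Type} [Fintype A] [DecidableEq A] {w : A → ℕ} (hw : ∀ a, 1 ≤ w a) {n : ℕ}
    {m : A → ℕ} : m ∈ PP w n ↔ ∑ a, w a * m a = n := by
  unfold PP
  rw [Finset.mem_filter, Fintype.mem_piFinset]
  refine ⟨fun h => h.2, fun h => ⟨fun a => ?_, h⟩⟩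
  rw [Finset.mem_range, Nat.lt_succ_iff, ← h]
  calc m a ≤ w a * m a := Nat.le_mul_of_pos_left _ (hw a)
    _ ≤ _ := Finset.single_le_sum (f := fun a => w a * m a) (fun _ _ => Nat.zero_le _)
      (Finset.mem_univ a)

lemma card_ge {A : Type} [Fintype A] [DecidableEq A] {w : A → ℕ} (hw : ∀ a, 1 ≤ w a) (n : ℕ)
    (a : A) (t : ℕ) :
    ((PP w n).filter (fun m => t ≤ m a)).card ≤
      if t * w a ≤ n then (PP w (n - t * w a)).card else 0 := by
  have key : ∀ m : A → ℕ, t ≤ m a →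
      ∑ b, w b * (m b - if b = a then t else 0) + t * w a = ∑ b, w b * m b := by
    intro m hm
    have h1 : t * w a = ∑ b, w b * (if b = a then t else 0) := by
      simp [mul_comm]
    rw [h1, ← Finset.sum_add_distrib]
    refine Finset.sum_congr rfl fun b _ => ?_
    rw [← mul_add]
    congr 1
    split_ifs with h
    · subst h; omega
    · omega
  split_ifs with h
  · refine Finset.card_le_card_of_injOn (fun m b => m b - if b = a then t else 0) ?_ ?_
    · intro m hm
      simp only [Finset.coe_filter, Set.mem_ofPred_eq, mem_PP hw] at hm
      simp only [Finset.mem_coe, mem_PP hw]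
      have := key m hm.2
      omega
    · intro m hm m' hm' e
      simp only [Finset.coe_filter, Set.mem_ofPred_eq] at hm hm'
      funext b
      have := congrFun e b
      simp only at this
      split_ifs at this with hb
      · subst hb; omega
      · simpa using this
  · rw [Nat.le_zero, Finset.card_eq_zero, Finset.filter_eq_empty_iff]
    intro m hm hm'
    rw [mem_PP hw] at hm
    have := key m hm'
    omega

lemma rec_ineq {A : Type} [Fintype A] [DecidableEq A] {w : A → ℕ} (hw : ∀ a, 1 ≤ w a) (n : ℕ) :
    n * (PP w n).card ≤ ∑ a, ∑ t ∈ Finset.range n,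
      w a * (if (t+1) * w a ≤ n then (PP w (n - (t+1) * w a)).card else 0) := by
  calc n * (PP w n).card = ∑ m ∈ PP w n, ∑ a, w a * m a := by
        rw [Finset.sum_congr rfl (fun m hm => (mem_PP hw).1 hm)]
        simp [mul_comm]
    _ = ∑ a, ∑ m ∈ PP w n, w a * m a := Finset.sum_comm
    _ ≤ _ := by
        refine Finset.sum_le_sum fun a _ => ?_
        calc ∑ m ∈ PP w n, w a * m a
            ≤ ∑ m ∈ PP w n, ∑ t ∈ Finset.range n, w a * (if t + 1 ≤ m a then 1 else 0) := by
              refine Finset.sum_le_sum fun m hm => ?_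
              rw [← Finset.mul_sum]
              refine Nat.mul_le_mul_left _ ?_
              have hm1 : m a ≤ n := by
                have := (Fintype.mem_piFinset.1 (Finset.mem_filter.1 hm).1) a
                rw [Finset.mem_range] at this; omega
              rw [Finset.sum_boole]
              have : Finset.range (m a) ⊆ (Finset.range n).filter (fun t => t + 1 ≤ m a) := by
                intro t ht
                simp only [Finset.mem_filter, Finset.mem_range] at ht ⊢
                omega
              simpa using Finset.card_le_card this
          _ = ∑ t ∈ Finset.range n, w a * ((PP w n).filter (fun m => t + 1 ≤ m a)).card := by
              rw [Finset.sum_comm]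
              refine Finset.sum_congr rfl fun t _ => ?_
              rw [← Finset.mul_sum, Finset.sum_boole]; simp
          _ ≤ _ := Finset.sum_le_sum fun t _ => Nat.mul_le_mul_left _ (card_ge hw n a (t+1))

/-- number of labelled partitions -/
def pp (N : ℕ) (K : Type) [Fintype K] [DecidableEq K] (n : ℕ) : ℕ :=
  (PP (fun a : Fin N × K => (a.1 : ℕ) + 1) n).card

lemma pp_rec (N : ℕ) (K : Type) [Fintype K] [DecidableEq K] (n : ℕ) :
    n * pp N K n ≤ Fintype.card K * ∑ i ∈ Finset.range N, ∑ t ∈ Finset.range n,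
      (i+1) * (if (t+1) * (i+1) ≤ n then pp N K (n - (t+1) * (i+1)) else 0) := by
  refine (rec_ineq (w := fun a : Fin N × K => (a.1 : ℕ) + 1) (fun a => by simp) n).trans ?_
  rw [Fintype.sum_prod_type, Finset.sum_range]
  simp only [Finset.sum_const, Finset.card_univ, smul_eq_mul, Finset.mul_sum]
  exact le_rfl

lemma pp_zero (N : ℕ) (K : Type) [Fintype K] [DecidableEq K] : pp N K 0 ≤ 1 := by
  unfold pp PP
  refine (Finset.card_filter_le _ _).trans ?_
  simp

lemma pp_one (N : ℕ) (K : Type) [Fintype K] [DecidableEq K] : pp N K 1 ≤ Fintype.card K := by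
  have h := pp_rec N K 1
  rw [one_mul] at h
  refine h.trans ?_
  conv_rhs => rw [← mul_one (Fintype.card K)]
  refine Nat.mul_le_mul_left _ ?_
  calc _ ≤ ∑ i ∈ Finset.range N, if i = 0 then 1 else 0 := by
        refine Finset.sum_le_sum fun i _ => ?_
        rcases Nat.eq_zero_or_pos i with rfl | hi
        · simpa using pp_zero N K
        · simp [hi.ne']
    _ ≤ 1 := by rw [Finset.sum_ite_eq']; split_ifs <;> simp

lemma pp_bound (N : ℕ) (K : Type) [Fintype K] [DecidableEq K] (n : ℕ) (x M : ℝ) (hx : 0 < x)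
    (hx1 : x < 1) (hM : 0 ≤ M) (h : ∀ m < n, (pp N K m : ℝ) * x ^ m ≤ M) :
    (n : ℝ) * pp N K n * x ^ n ≤ Fintype.card K * M * (x / (1 - x) ^ 3) := by
  have h0 : (0:ℝ) < 1 - x := by linarith
  have hr : (n : ℝ) * pp N K n ≤ Fintype.card K * ∑ i ∈ Finset.range N, ∑ t ∈ Finset.range n,
      ((i:ℝ)+1) * (if (t+1) * (i+1) ≤ n then (pp N K (n - (t+1) * (i+1)) : ℝ) else 0) := by
    exact_mod_cast pp_rec N K n
  have hgeo : ∑ t ∈ Finset.range n, x ^ t ≤ (1 - x)⁻¹ := by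
    rw [← tsum_geometric_of_lt_one hx.le hx1]
    exact (summable_geometric_of_lt_one hx.le hx1).sum_le_tsum _ (fun _ _ => by positivity)
  have hs : ‖x‖ < 1 := by rwa [Real.norm_of_nonneg hx.le]
  have hgeo2 : ∑ i ∈ Finset.range N, ((i:ℝ)+1) * x^(i+1) ≤ x / (1-x)^2 := by
    have hS := hasSum_coe_mul_geometric_of_norm_lt_one hs
    rw [← hS.tsum_eq]
    have := hS.summable.sum_le_tsum (Finset.range (N+1)) (fun _ _ => by positivity)
    rw [Finset.sum_range_succ'] at this
    simpa using this
  calc (n : ℝ) * pp N K n * x ^ n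
      ≤ (Fintype.card K * ∑ i ∈ Finset.range N, ∑ t ∈ Finset.range n,
      ((i:ℝ)+1) * (if (t+1) * (i+1) ≤ n then (pp N K (n - (t+1) * (i+1)) : ℝ) else 0)) * x^n := by
        gcongr
    _ = Fintype.card K * ∑ i ∈ Finset.range N, ∑ t ∈ Finset.range n,
      ((i:ℝ)+1) * ((if (t+1) * (i+1) ≤ n then (pp N K (n - (t+1) * (i+1)) : ℝ) else 0) * x^n) := by
        rw [mul_assoc, Finset.sum_mul]
        congr 1
        refine Finset.sum_congr rfl fun i _ => ?_
        rw [Finset.sum_mul]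
        refine Finset.sum_congr rfl fun t _ => by ring
    _ ≤ Fintype.card K * ∑ i ∈ Finset.range N, ∑ t ∈ Finset.range n,
      ((i:ℝ)+1) * (M * (x^(i+1) * x^t)) := by
        refine mul_le_mul_of_nonneg_left ?_ (by positivity)
        refine Finset.sum_le_sum fun i _ => Finset.sum_le_sum fun t _ => ?_
        refine mul_le_mul_of_nonneg_left ?_ (by positivity)
        split_ifs with hc
        · have e : x^n = x^(n - (t+1)*(i+1)) * x^((t+1)*(i+1)) := by
            rw [← pow_add]; congr 1; omega
          rw [e, ← mul_assoc]
          have hpos : 0 < (t+1)*(i+1) := by positivity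
          refine mul_le_mul (h _ (by omega)) ?_ (by positivity) hM
          rw [← pow_add]
          exact pow_le_pow_of_le_one hx.le hx1.le (by nlinarith)
        · rw [zero_mul]; positivity
    _ = Fintype.card K * (M * ((∑ i ∈ Finset.range N, ((i:ℝ)+1) * x^(i+1)) *
          ∑ t ∈ Finset.range n, x^t)) := by
        congr 1
        rw [Finset.sum_mul_sum, Finset.mul_sum]
        refine Finset.sum_congr rfl fun i _ => ?_
        rw [Finset.mul_sum]
        refine Finset.sum_congr rfl fun t _ => by ring
    _ ≤ Fintype.card K * (M * ((x / (1-x)^2) * (1-x)⁻¹)) := by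
        gcongr
    _ = _ := by field_simp

lemma pp_large (N : ℕ) (K : Type) [Fintype K] [DecidableEq K] (hK : 8 ≤ Fintype.card K) (n : ℕ) :
    pp N K n ≤ Fintype.card K ^ n ∧ (3 ≤ n → 2 * pp N K n ≤ Fintype.card K ^ n) := by
  induction n using Nat.strong_induction_on with
  | _ n ih =>
  set k := Fintype.card K with hk
  have hkr : (8:ℝ) ≤ k := by exact_mod_cast hK
  rcases Nat.lt_or_ge n 2 with hn | hn
  · interval_cases n
    · exact ⟨by simpa using pp_zero N K, by omega⟩
    · exact ⟨by simpa using pp_one N K, by omega⟩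
  · have hx8 : (k:ℝ)⁻¹ ≤ 1/8 := by rw [inv_le_comm₀ (by linarith) (by norm_num)]; simpa using hkr
    have hb := pp_bound N K n (k:ℝ)⁻¹ 1 (by positivity) (by linarith) (by norm_num) (by
      intro m hm
      rw [inv_pow, mul_inv_le_iff₀ (by positivity), one_mul]
      exact_mod_cast (ih m hm).1)
    rw [← hk] at hb
    have h2 : (k:ℝ) * 1 * ((k:ℝ)⁻¹ / (1 - (k:ℝ)⁻¹)^3) ≤ 3/2 := by
      have h78 : (7/8:ℝ) ≤ 1 - (k:ℝ)⁻¹ := by linarith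
      have : (7/8:ℝ)^3 ≤ (1 - (k:ℝ)⁻¹)^3 := by gcongr
      rw [mul_one, ← mul_div_assoc, mul_inv_cancel₀ (by positivity), div_le_iff₀ (by positivity)]
      nlinarith
    have h3 := hb.trans h2
    rw [inv_pow, mul_inv_le_iff₀ (by positivity)] at h3
    have h4 : 2 * (n * pp N K n) ≤ 3 * k^n := by
      have : (2:ℝ) * (n * pp N K n) ≤ 3 * k^n := by linarith
      exact_mod_cast this
    refine ⟨by nlinarith, fun h => by nlinarith⟩

lemma pp_small (N : ℕ) (K : Type) [Fintype K] [DecidableEq K] (hK : Fintype.card K ≤ 8) (n : ℕ) :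
    (pp N K n : ℝ) * (1/16)^n ≤ 1 := by
  induction n using Nat.strong_induction_on with
  | _ n ih =>
  rcases Nat.eq_zero_or_pos n with rfl | hn
  · simpa using pp_zero N K
  have hb := pp_bound N K n (1/16) 1 (by norm_num) (by norm_num) (by norm_num) ih
  have hk : (Fintype.card K : ℝ) ≤ 8 := by exact_mod_cast hK
  have hn' : (1:ℝ) ≤ n := by exact_mod_cast hn
  have : (0:ℝ) ≤ pp N K n * (1/16)^n := by positivity
  norm_num at hb this ⊢
  nlinarith

lemma pp_small2 (N : ℕ) (K : Type) [Fintype K] [DecidableEq K] (hK : Fintype.card K ≤ 8) (n : ℕ) :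
    (pp N K n : ℝ) * (2/3)^n ≤ 16^144 := by
  induction n using Nat.strong_induction_on with
  | _ n ih =>
  rcases Nat.lt_or_ge n 144 with hn | hn
  · have h := pp_small N K hK n
    rw [one_div, inv_pow, mul_inv_le_iff₀ (by positivity), one_mul] at h
    calc (pp N K n : ℝ) * (2/3)^n ≤ 16^n * 1 := by
          gcongr; exact pow_le_one₀ (by norm_num) (by norm_num)
      _ ≤ 16^144 := by rw [mul_one]; exact pow_le_pow_right₀ (by norm_num) hn.le
  have hb := pp_bound N K n (2/3) (16^144) (by norm_num) (by norm_num) (by positivity) ih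
  have hk : (Fintype.card K : ℝ) ≤ 8 := by exact_mod_cast hK
  have hn' : (144:ℝ) ≤ n := by exact_mod_cast hn
  have h0 : (0:ℝ) ≤ pp N K n * (2/3)^n := by positivity
  generalize (16:ℝ)^144 = M at *
  have hM : 0 ≤ M := le_trans (by positivity) (ih 0 (by omega))
  have e : (2/3:ℝ) / (1 - 2/3)^3 = 18 := by norm_num
  rw [e, mul_assoc] at hb
  generalize (pp N K n : ℝ) * (2/3)^n = Y at *
  nlinarith [mul_le_mul_of_nonneg_right hk hM, mul_le_mul_of_nonneg_right hn' h0]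

lemma pp_final : ∃ C : ℕ, 8 ≤ C ∧ 3 ≤ C ∧ ∀ (N n : ℕ) (K : Type) [Fintype K] [DecidableEq K],
    2 ≤ Fintype.card K → (C ≤ n ∨ C ≤ Fintype.card K) →
    pp N K n ≤ Fintype.card K ^ n ∧ (3 ≤ n → 2 * pp N K n ≤ Fintype.card K ^ n) := by
  obtain ⟨n₀, hn₀⟩ := pow_unbounded_of_one_lt (2 * 16^144 : ℝ) (show (1:ℝ) < 4/3 by norm_num)
  refine ⟨n₀ + 8, by omega, by omega, fun N n K _ _ hK2 h => ?_⟩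
  rcases Nat.lt_or_ge (Fintype.card K) 8 with h8 | h8
  swap
  · exact pp_large N K h8 n
  have hn : n₀ ≤ n := by omega
  suffices h : 2 * pp N K n ≤ Fintype.card K ^ n from ⟨by omega, fun _ => h⟩
  have h1 := pp_small2 N K h8.le n
  have h2 : (2 * 16^144 : ℝ) ≤ (4/3)^n :=
    hn₀.le.trans (pow_le_pow_right₀ (by norm_num) hn)
  have h3 : 2 * (pp N K n : ℝ) ≤ 2 ^ n := by
    have e : (4/3:ℝ)^n = 2^n * (2/3)^n := by rw [← mul_pow]; norm_num
    rw [e] at h2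
    have hp : (0:ℝ) < (2/3)^n := by positivity
    generalize (16:ℝ)^144 = M at *
    exact le_of_mul_le_mul_right (by linarith) hp
  have h4 : 2 * pp N K n ≤ 2 ^ n := by exact_mod_cast h3
  exact h4.trans (Nat.pow_le_pow_left hK2 n)

/-- the full wreath product -/
abbrev WW (ι X : Type) [Group X] := SemidirectProduct (ι → X) (Perm ι) (permAut ι X)

def act {ι X : Type} [Group X] (g : WW ι X) (e : ι × X) : ι × X :=
  (g.right e.1, g.left (g.right e.1) * e.2)

def mulr {ι X : Type} [Group X] (e : ι × X) (y : X) : ι × X := (e.1, e.2 * y)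

section
variable {ι X : Type} [Group X]

lemma act_mul (g g' : WW ι X) (e : ι × X) : act (g * g') e = act g (act g' e) := by
  simp [act, permAut, mul_assoc]

lemma act_one (e : ι × X) : act 1 e = e := by simp [act]

lemma act_mulr (g : WW ι X) (e : ι × X) (y : X) : act g (mulr e y) = mulr (act g e) y := by
  simp [act, mulr, mul_assoc]

lemma mulr_mulr (e : ι × X) (y z : X) : mulr (mulr e y) z = mulr e (y * z) := by
  simp [mulr, mul_assoc]

lemma mulr_one (e : ι × X) : mulr e 1 = e := by simp [mulr]

lemma mulr_inj {e : ι × X} {y z : X} : mulr e y = mulr e z ↔ y = z := by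
  simp [mulr]

lemma mulr_eq_iff {e e' : ι × X} {y z : X} : mulr e y = mulr e' z ↔ e = mulr e' (z * y⁻¹) := by
  simp [mulr, Prod.ext_iff, ← mul_assoc, eq_mul_inv_iff_mul_eq]

lemma act_eq_iff {g : WW ι X} {e e' : ι × X} : act g e = e' ↔ e = act g⁻¹ e' := by
  constructor
  · rintro rfl; rw [← act_mul]; simp [act_one]
  · rintro rfl; rw [← act_mul]; simp [act_one]

lemma act_fst_zpow (g : WW ι X) (z : ℤ) (e : ι × X) : (act (g ^ z) e).1 = (g.right ^ z) e.1 := by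
  have : (g ^ z).right = g.right ^ z := map_zpow SemidirectProduct.rightHom g z
  simp [act, this]

lemma act_ext {g g' : WW ι X} (h : ∀ j, act g (j, 1) = act g' (j, 1)) : g = g' := by
  have h1 : g.right = g'.right := Equiv.ext fun j => congrArg Prod.fst (h j)
  ext i
  · have := congrArg Prod.snd (h (g.right⁻¹ i))
    simp only [act, mul_one, ← h1] at this
    simpa using this
  · rw [h1]

lemma stab_iff {g : WW ι X} {e : ι × X} {l : ℕ} {P : X}
    (hl : Function.minimalPeriod (g.right • ·) e.1 = l) (hP : act (g ^ l) e = mulr e P)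
    (z z' : ℤ) (y y' : X) :
    mulr (act (g ^ z) e) y = mulr (act (g ^ z') e) y' ↔
      ∃ m : ℤ, z - z' = l * m ∧ y' = P ^ m * y := by
  have hnat : ∀ m : ℕ, act (g ^ ((l:ℤ) * m)) e = mulr e (P ^ m) := by
    intro m
    induction m with
    | zero => simp [act_one, mulr_one]
    | succ m ih =>
      rw [Nat.cast_succ, mul_add, zpow_add, act_mul, mul_one, zpow_natCast g l, hP, act_mulr, ih,
        mulr_mulr, pow_succ]
  have hzpow : ∀ m : ℤ, act (g ^ ((l:ℤ) * m)) e = mulr e (P ^ m) := by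
    intro m
    obtain ⟨m, rfl | rfl⟩ := m.eq_nat_or_neg
    · simpa using hnat m
    · rw [mul_neg, zpow_neg, eq_comm, eq_comm, act_eq_iff, inv_inv, act_mulr, hnat, mulr_mulr,
        zpow_neg, zpow_natCast, mul_inv_cancel, mulr_one]
  have hred : mulr (act (g ^ z) e) y = mulr (act (g ^ z') e) y' ↔
      act (g ^ (z - z')) e = mulr e (y' * y⁻¹) := by
    rw [mulr_eq_iff, sub_eq_neg_add, zpow_add, act_mul, act_eq_iff (g := g ^ (-z')), ← zpow_neg, neg_neg, act_mulr]
  rw [hred]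
  constructor
  · intro h
    have h1 := congrArg Prod.fst h
    rw [act_fst_zpow] at h1
    have h2 : (l:ℤ) ∣ z - z' := by
      rw [← hl]; exact (MulAction.zpow_smul_eq_iff_minimalPeriod_dvd).1 h1
    obtain ⟨m, hm⟩ := h2
    refine ⟨m, hm, ?_⟩
    rw [hm, hzpow, mulr_inj] at h
    rw [h]; simp
  · rintro ⟨m, hm, rfl⟩
    rw [hm, hzpow]; simp

/-- representative of a class -/
noncomputable def crep (c : ConjClasses X) : X := Function.surjInv ConjClasses.mk_surjective c

abbrev QQ (h : Perm ι) := orbitRel.Quotient (Subgroup.zpowers h) ι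

lemma exists_lab {n : ℕ} (g : WW (Fin n) X) : ∃ lab : QQ g.right → Fin n × ConjClasses X,
    ∀ q, ∃ x : X, Function.minimalPeriod (g.right • ·) q.out = (lab q).1 + 1 ∧
      act (g ^ (((lab q).1 : ℕ) + 1)) (q.out, x) = mulr (q.out, x) (crep (lab q).2) := by
  have H : ∀ q : QQ g.right, ∃ l : Fin n × ConjClasses X, ∃ x : X,
      Function.minimalPeriod (g.right • ·) q.out = l.1 + 1 ∧
      act (g ^ ((l.1 : ℕ) + 1)) (q.out, x) = mulr (q.out, x) (crep l.2) := by
    intro q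
    set b := q.out
    set l := Function.minimalPeriod (g.right • ·) b with hl
    have hpos : 0 < l := by
      have := MulAction.minimalPeriod_pos g.right b
      exact Nat.pos_of_ne_zero this.out
    have hle : l ≤ n := by
      classical
      have := Fintype.ofFinite (orbit (Subgroup.zpowers g.right) b)
      rw [hl, MulAction.minimalPeriod_eq_card]
      simpa using Fintype.card_le_of_injective (Subtype.val : orbit (Subgroup.zpowers g.right) b → Fin n)
        Subtype.val_injective
    have hfix : (act (g ^ l) (b, 1)).1 = b := by
      have := act_fst_zpow g l (b, (1:X))
      rw [zpow_natCast, zpow_natCast] at this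
      rw [this]
      exact (MulAction.pow_smul_eq_iff_minimalPeriod_dvd (a := g.right) (b := b)).2 dvd_rfl
    set P := (act (g ^ l) (b, 1)).2 with hP
    have hc : IsConj (crep (ConjClasses.mk P)) P := by
      rw [← ConjClasses.mk_eq_mk_iff_isConj]
      exact Function.surjInv_eq ConjClasses.mk_surjective _
    obtain ⟨x, hx⟩ := isConj_iff.1 hc
    refine ⟨(⟨l - 1, by omega⟩, ConjClasses.mk P), x, ?_, ?_⟩
    · simp; omega
    · have e1 : l - 1 + 1 = l := by omega
      simp only [e1]
      have e2 : ((b, x) : Fin n × X) = mulr (b, 1) x := by simp [mulr]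
      have e3 : act (g ^ l) (b, 1) = (b, P) := Prod.ext hfix rfl
      rw [e2, act_mulr, e3, mulr_mulr]
      simp only [mulr, one_mul, Prod.mk.injEq, true_and]
      exact (mul_inv_eq_iff_eq_mul.1 hx).symm
  choose lab hlab using H
  exact ⟨lab, hlab⟩

noncomputable def glab {n : ℕ} (g : WW (Fin n) X) : QQ g.right → Fin n × ConjClasses X :=
  (exists_lab g).choose

lemma glab_spec {n : ℕ} (g : WW (Fin n) X) : 
    ∀ q, ∃ x : X, Function.minimalPeriod (g.right • ·) q.out = (glab g q).1 + 1 ∧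
      act (g ^ (((glab g q).1 : ℕ) + 1)) (q.out, x) = mulr (q.out, x) (crep (glab g q).2) :=
  (exists_lab g).choose_spec

lemma sum_glab {n : ℕ} (g : WW (Fin n) X) [Fintype (QQ g.right)] :
    ∑ q, (((glab g q).1 : ℕ) + 1) = n := by
  classical
  have : ∀ q : QQ g.right, Fintype (orbit (Subgroup.zpowers g.right) q.out) := fun q => Fintype.ofFinite _
  have h := Fintype.card_congr (MulAction.selfEquivSigmaOrbits (Subgroup.zpowers g.right) (Fin n))
  rw [Fintype.card_fin, Fintype.card_sigma] at h
  refine Eq.trans (Finset.sum_congr rfl fun q _ => ?_) h.symm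
  obtain ⟨x, hx, -⟩ := glab_spec g q
  rw [← hx, MulAction.minimalPeriod_eq_card]

lemma conj_of {n : ℕ} (g g' : WW (Fin n) X) (β : QQ g.right ≃ QQ g'.right)
    (hβ : ∀ q, glab g' (β q) = glab g q) : ∃ w : WW (Fin n) X, w * g = g' * w := by
  choose x hx1 hx2 using glab_spec g
  choose x' hx1' hx2' using glab_spec g'
  set e : QQ g.right → Fin n × X := fun q => (q.out, x q) with he
  set e' : QQ g.right → Fin n × X := fun q => ((β q).out, x' (β q)) with he'
  have hst : ∀ q (z z' : ℤ) (y y' : X),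
      mulr (act (g ^ z) (e q)) y = mulr (act (g ^ z') (e q)) y' ↔
      mulr (act (g' ^ z) (e' q)) y = mulr (act (g' ^ z') (e' q)) y' := by
    intro q z z' y y'
    rw [stab_iff (l := (glab g q).1 + 1) (hx1 q) (hx2 q), stab_iff (l := (glab g q).1 + 1)
      (P := crep (glab g q).2)]
    · rw [← hβ]; exact hx1' _
    · rw [← hβ]; exact hx2' _
  have hmk : ∀ (q : QQ g.right) (z : ℤ), (Quotient.mk'' ((act (g ^ z) (e q)).1) : QQ g.right) = q := by
    intro q z
    rw [act_fst_zpow]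
    conv_rhs => rw [← Quotient.out_eq' q]
    rw [Quotient.eq'']
    exact ⟨⟨g.right ^ z, z, rfl⟩, rfl⟩
  have hmk' : ∀ (q : QQ g.right) (z : ℤ), (Quotient.mk'' ((act (g' ^ z) (e' q)).1) : QQ g'.right) = β q := by
    intro q z
    rw [act_fst_zpow]
    conv_rhs => rw [← Quotient.out_eq' (β q)]
    rw [Quotient.eq'']
    exact ⟨⟨g'.right ^ z, z, rfl⟩, rfl⟩
  have hex : ∀ j : Fin n, ∃ (z : ℤ) (y : X),
      ((j, 1) : Fin n × X) = mulr (act (g ^ z) (e (Quotient.mk'' j))) y := by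
    intro j
    have h1 : (orbitRel (Subgroup.zpowers g.right) (Fin n)) j (Quotient.out (Quotient.mk'' j : QQ g.right)) :=
      Setoid.symm' _ (Quotient.mk_out (s := orbitRel (Subgroup.zpowers g.right) (Fin n)) j)
    obtain ⟨⟨_, z, rfl⟩, hz⟩ := h1
    refine ⟨z, (act (g ^ z) (e (Quotient.mk'' j))).2⁻¹, ?_⟩
    have : (act (g ^ z) (e (Quotient.mk'' j))).1 = j := by
      rw [act_fst_zpow]; exact hz
    simp [mulr, this]
  choose zz yy hzy using hex
  set T : Fin n → Fin n × X := fun j => mulr (act (g' ^ zz j) (e' (Quotient.mk'' j))) (yy j) with hT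
  -- key property
  have key : ∀ q (z : ℤ) (y : X) j t, mulr (j, 1) t = mulr (act (g ^ z) (e q)) y →
      mulr (T j) t = mulr (act (g' ^ z) (e' q)) y := by
    intro q z y j t h
    have hq : (Quotient.mk'' j : QQ g.right) = q := by
      rw [← hmk q z]
      exact congrArg _ (congrArg Prod.fst h)
    rw [hT]
    simp only [mulr_mulr]
    rw [hq, ← hst, ← h]
    conv_rhs => rw [hzy j, hq, mulr_mulr]
  have hinj : Function.Injective (fun j => (T j).1) := by
    intro j j' h
    simp only at h
    have hq : (Quotient.mk'' j : QQ g.right) = Quotient.mk'' j' := by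
      apply β.injective
      rw [← hmk' _ (zz j), ← hmk' _ (zz j')]
      exact congrArg _ h
    have h2 : T j = mulr (T j') ((T j').2⁻¹ * (T j).2) := by
      ext1
      · exact h
      · simp [mulr]
    simp only [hT] at h2
    rw [mulr_mulr, hq, ← hst, ← mulr_mulr, ← hzy j', ← hq, ← hzy j] at h2
    exact congrArg Prod.fst h2
  let s : Perm (Fin n) := Equiv.ofBijective _ (Finite.injective_iff_bijective.1 hinj)
  let w : WW (Fin n) X := ⟨fun i => (T (s⁻¹ i)).2, s⟩
  have hw : ∀ j t, act w (mulr (j, 1) t) = mulr (T j) t := by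
    intro j t
    rw [act_mulr]
    congr 1
    ext1
    · rfl
    · simp [act, w]
  refine ⟨w, act_ext fun j => ?_⟩
  have h1 : act g (j, 1) = mulr ((act g (j,1)).1, 1) (act g (j,1)).2 := by simp [mulr]
  rw [act_mul, act_mul, h1, hw]
  have h2 := hw j 1
  rw [mulr_one, mulr_one] at h2
  rw [h2, key (Quotient.mk'' j) (1 + zz j) (yy j)]
  · simp only [hT]
    rw [zpow_add, act_mul, zpow_one, act_mulr]
  · rw [← h1]
    conv_lhs => rw [hzy j]
    rw [zpow_add, act_mul, zpow_one, act_mulr]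

open Classical in
/-- counting data -/
noncomputable def gdata {n : ℕ} (g : WW (Fin n) X) (a : Fin n × ConjClasses X) : ℕ :=
  Nat.card {q : QQ g.right // glab g q = a}

lemma conj_of_gdata {n : ℕ} (g g' : WW (Fin n) X) (h : gdata g = gdata g') :
    ∃ w : WW (Fin n) X, w * g = g' * w := by
  have H : ∀ a, Nonempty ({q : QQ g.right // glab g q = a} ≃ {q : QQ g'.right // glab g' q = a}) :=
    fun a => Finite.card_eq.1 (congrFun h a)
  let E := fun a => (H a).some
  let β : QQ g.right ≃ QQ g'.right := (Equiv.sigmaFiberEquiv (glab g)).symm.trans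
    ((Equiv.sigmaCongrRight E).trans (Equiv.sigmaFiberEquiv (glab g')))
  refine conj_of g g' β fun q => ?_
  exact (E (glab g q) ⟨q, rfl⟩).2

lemma gdata_mem {n : ℕ} [Fintype (ConjClasses X)] [DecidableEq (ConjClasses X)]
    (g : WW (Fin n) X) :
    gdata g ∈ PP (fun a : Fin n × ConjClasses X => (a.1 : ℕ) + 1) n := by
  classical
  have := Fintype.ofFinite (QQ g.right)
  rw [mem_PP (fun a => by simp)]
  conv_rhs => rw [← sum_glab g]
  rw [← Finset.sum_fiberwise (s := Finset.univ) (g := glab g)]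
  refine Finset.sum_congr rfl fun a _ => ?_
  rw [Finset.sum_congr rfl (g := fun _ => (a.1 : ℕ) + 1)]
  · rw [Finset.sum_const, smul_eq_mul, mul_comm, gdata, Nat.card_eq_fintype_card,
      Fintype.card_subtype]
  · intro q hq
    rw [(Finset.mem_filter.1 hq).2]

/-- inclusion in the full wreath product -/
def toWW {n : ℕ} {H : Subgroup (Perm (Fin n))} (g : Wreath X H) : WW (Fin n) X :=
  ⟨g.left, g.right⟩

lemma isConj_of_ww {n : ℕ} {H : Subgroup (Perm (Fin n))} {g g' : Wreath X H} (w : WW (Fin n) X)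
    (hw : w * toWW g = toWW g' * w) (hH : w.right ∈ H) : IsConj g g' := by
  rw [isConj_iff]
  refine ⟨⟨w.left, ⟨w.right, hH⟩⟩, ?_⟩
  rw [mul_inv_eq_iff_eq_mul]
  ext i
  · exact congrFun (congrArg SemidirectProduct.left hw) i
  · exact congrArg Fin.val (congrArg (fun v : WW (Fin n) X => v.right i) hw)

lemma card_conj_le {G S : Type} [Group G] [Finite S] (Φ : G → S)
    (h : ∀ g g', Φ g = Φ g' → IsConj g g') : kclass G ≤ Nat.card S := by
  refine Nat.card_le_card_of_injective (fun c : ConjClasses G => Φ (crep c)) ?_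
  intro c c' hcc
  have := ConjClasses.mk_eq_mk_iff_isConj.2 (h _ _ hcc)
  have e : ∀ c : ConjClasses G, ConjClasses.mk (crep c) = c :=
    fun c => Function.surjInv_eq ConjClasses.mk_surjective c
  rwa [e, e] at this

lemma kclass_top {n : ℕ} [Fintype (ConjClasses X)] [DecidableEq (ConjClasses X)] :
    kclass (Wreath X (⊤ : Subgroup (Perm (Fin n)))) ≤ pp n (ConjClasses X) n := by
  refine (card_conj_le (S := {m // m ∈ PP (fun a : Fin n × ConjClasses X => (a.1 : ℕ) + 1) n})
    (fun g => ⟨gdata (toWW g), gdata_mem _⟩) ?_).trans ?_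
  · intro g g' h
    obtain ⟨w, hw⟩ := conj_of_gdata _ _ (congrArg Subtype.val h)
    exact isConj_of_ww w hw trivial
  · simp [pp]

lemma kclass_alt {n : ℕ} [Fintype (ConjClasses X)] [DecidableEq (ConjClasses X)] :
    kclass (Wreath X (alternatingGroup (Fin n))) ≤ 2 * pp n (ConjClasses X) n := by
  classical
  set G := Wreath X (alternatingGroup (Fin n))
  -- chosen element with the given data
  let r : G → G := fun g => Function.invFun (fun g : G => gdata (toWW g)) (gdata (toWW g))
  have hr : ∀ g, gdata (toWW (r g)) = gdata (toWW g) := fun g =>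
    Function.invFun_eq (f := fun g : G => gdata (toWW g)) ⟨g, rfl⟩
  refine (card_conj_le (G := G)
    (S := {m // m ∈ PP (fun a : Fin n × ConjClasses X => (a.1 : ℕ) + 1) n} × Bool)
    (fun g => (⟨gdata (toWW g), gdata_mem _⟩, decide (IsConj (r g) g))) ?_).trans ?_
  · intro g g' h
    have h1 : gdata (toWW g) = gdata (toWW g') := congrArg (fun p => p.1.1) h
    have h2 : decide (IsConj (r g) g) = decide (IsConj (r g') g') := congrArg Prod.snd h
    have hrr : r g = r g' := by simp only [r, h1]
    rw [← hrr, decide_eq_decide] at h2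
    by_cases hc : IsConj (r g) g
    · exact hc.symm.trans (h2.1 hc)
    have hc' := fun h => hc (h2.2 h)
    obtain ⟨u, hu⟩ := conj_of_gdata _ _ (hr g)
    obtain ⟨v, hv⟩ := conj_of_gdata _ _ ((hr g).trans h1)
    have hu' : u.right ∉ alternatingGroup (Fin n) := fun h => hc (isConj_of_ww u hu h)
    have hv' : v.right ∉ alternatingGroup (Fin n) := fun h => hc' (isConj_of_ww v hv h)
    refine isConj_of_ww (v * u⁻¹) ?_ ?_
    · have : toWW g = u * toWW (r g) * u⁻¹ := by rw [hu]; group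
      rw [this]
      have : v * u⁻¹ * (u * toWW (r g) * u⁻¹) = v * toWW (r g) * u⁻¹ := by group
      rw [this, hv, mul_assoc]
    · rw [Equiv.Perm.mem_alternatingGroup] at hu' hv' ⊢
      have hu2 := (Int.units_eq_one_or (Perm.sign u.right)).resolve_left hu'
      have hv2 := (Int.units_eq_one_or (Perm.sign v.right)).resolve_left hv'
      simp [hu2, hv2]
  · simp [pp, mul_comm]

lemma alt_triv (n : ℕ) (hn : n < 3) : ∀ s ∈ alternatingGroup (Fin n), s = 1 := by
  simp only [Equiv.Perm.mem_alternatingGroup]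
  interval_cases n <;> decide

lemma kclass_triv {n : ℕ} [Finite X] {H : Subgroup (Perm (Fin n))} (hH : ∀ s ∈ H, s = 1) :
    kclass (Wreath X H) ≤ kclass X ^ n := by
  have : Finite (ConjClasses X) := Finite.of_surjective _ ConjClasses.mk_surjective
  refine (card_conj_le (S := Fin n → ConjClasses X) (fun g i => ConjClasses.mk (g.left i))
    ?_).trans ?_
  · intro g g' h
    have h' : ∀ i, ∃ c, c * g.left i * c⁻¹ = g'.left i := fun i =>
      isConj_iff.1 (ConjClasses.mk_eq_mk_iff_isConj.1 (congrFun h i))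
    choose c hc using h'
    have hg := hH _ g.right.2
    have hg' := hH _ g'.right.2
    refine isConj_of_ww ⟨c, 1⟩ ?_ H.one_mem
    ext i
    · simp [toWW, hg', ← hc]
    · simp [toWW, hg, hg']
  · rw [Nat.card_fun]; simp [kclass]

end

/-- If `H = Sym(n)` or `H = Alt(n)` in the natural action, then `k(X ≀ H) ≤ k^n` whenever
`n` or `k = k(X)` is sufficiently large. -/
theorem statement10 :
    ∃ C : ℕ, ∀ (n : ℕ) (X : Type) [Group X] [Finite X], Nontrivial X →
      ∀ H : Subgroup (Perm (Fin n)), (H = ⊤ ∨ H = alternatingGroup (Fin n)) →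
      (C ≤ n ∨ C ≤ kclass X) → kclass (Wreath X H) ≤ kclass X ^ n := by
  classical
  obtain ⟨C, -, hC3, hC⟩ := pp_final
  refine ⟨C, fun n X _ _ hX H hH h => ?_⟩
  have : Finite (ConjClasses X) := Finite.of_surjective _ ConjClasses.mk_surjective
  have := Fintype.ofFinite (ConjClasses X)
  have hk : kclass X = Fintype.card (ConjClasses X) := Nat.card_eq_fintype_card
  have hk2 : 2 ≤ Fintype.card (ConjClasses X) := by
    obtain ⟨x, hx⟩ := exists_ne (1 : X)
    refine Fintype.one_lt_card_iff.2 ⟨ConjClasses.mk x, ConjClasses.mk 1, fun h => hx ?_⟩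
    rw [ConjClasses.mk_eq_mk_iff_isConj] at h
    exact isConj_one_left.1 h
  rw [hk] at h
  have hp := hC n n (ConjClasses X) hk2 h
  rcases hH with rfl | rfl
  · rw [hk]; exact kclass_top.trans hp.1
  · rcases Nat.lt_or_ge n 3 with hn | hn
    · refine kclass_triv ?_
      exact alt_triv n hn
    · rw [hk]; exact kclass_alt.trans (hp.2 hn)
end

section
/- For every ε and γ with 0 < ε < 1 and 0 < γ < 1, there exists N = N(ε,γ) such that for every n ≥ N and every x ∈ Sym(n) satisfying σ(x) ≥ (1 − (1−ε)γ)·n, the conjugacy class of x in Sym(n) has size strictly less than 2·n⁴·(n!)^γ. -/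
open Equiv MulAction

/-- `S` contains exactly one point of every cycle of `x`. -/
def IsTransv {n : ℕ} (x : Perm (Fin n)) (S : Finset (Fin n)) : Prop :=
  (∀ a, ∃ s ∈ S, x.SameCycle a s) ∧ ∀ s ∈ S, ∀ t ∈ S, x.SameCycle s t → s = t

lemma exists_transv {n : ℕ} (x : Perm (Fin n)) :
    ∃ S : Finset (Fin n), S.card = cycleCount x ∧ IsTransv x S := by
  classical
  have key : ∀ a b : Fin n, (orbitRel (Subgroup.zpowers x) (Fin n)) a b ↔ x.SameCycle a b := by
    intro a b
    rw [orbitRel_apply, Equiv.Perm.sameCycle_comm]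
    constructor
    · rintro ⟨⟨g, k, rfl⟩, hg⟩
      exact ⟨k, hg⟩
    · rintro ⟨k, hk⟩
      exact ⟨⟨x ^ k, k, rfl⟩, hk⟩
  let f : orbitRel.Quotient (Subgroup.zpowers x) (Fin n) → Fin n := Quotient.out
  have hf : Function.Injective f := Quotient.out_injective
  haveI : Fintype (orbitRel.Quotient (Subgroup.zpowers x) (Fin n)) := Fintype.ofInjective f hf
  refine ⟨Finset.univ.image f, ?_, ?_, ?_⟩
  · rw [Finset.card_image_of_injective _ hf, cycleCount, Nat.card_eq_fintype_card,
      Finset.card_univ]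
  · intro a
    refine ⟨f (Quotient.mk _ a), Finset.mem_image_of_mem _ (Finset.mem_univ _), ?_⟩
    rw [Equiv.Perm.sameCycle_comm, ← key]
    exact Quotient.exact (Quotient.out_eq _)
  · intro s hs t ht hst
    obtain ⟨p, -, rfl⟩ := Finset.mem_image.1 hs
    obtain ⟨q, -, rfl⟩ := Finset.mem_image.1 ht
    congr 1
    have := Quotient.sound ((key _ _).2 hst)
    rwa [show (Quotient.mk _ (f p)) = p from Quotient.out_eq p,
      show (Quotient.mk _ (f q)) = q from Quotient.out_eq q] at this

lemma transv_conj {n : ℕ} {x y : Perm (Fin n)} {S : Finset (Fin n)} (h : IsTransv x S)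
    (hxy : IsConj x y) : ∃ T : Finset (Fin n), T.card = S.card ∧ IsTransv y T := by
  obtain ⟨g, rfl⟩ := isConj_iff.1 hxy
  refine ⟨S.map g.toEmbedding, Finset.card_map _, ?_, ?_⟩
  · intro a
    obtain ⟨s, hs, h1⟩ := h.1 (g⁻¹ a)
    refine ⟨g s, by simpa using hs, ?_⟩
    rw [Equiv.Perm.sameCycle_conj]
    simpa using h1
  · intro s hs t ht hst
    obtain ⟨p, hp, rfl⟩ := Finset.mem_map.1 hs
    obtain ⟨q, hq, rfl⟩ := Finset.mem_map.1 ht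
    rw [Equiv.Perm.sameCycle_conj] at hst
    have := h.2 p hp q hq (by simpa using hst)
    rw [this]

lemma transv_inj {n : ℕ} {x y : Perm (Fin n)} {S : Finset (Fin n)} (hx : IsTransv x S)
    (hy : IsTransv y S) (h : ∀ a, a ∉ S → x a = y a) : x = y := by
  classical
  ext1 s
  by_cases hs : s ∈ S
  swap
  · exact h s hs
  set t := x s with ht
  have hst : x.SameCycle s t := ⟨1, by simp [ht]⟩
  have hex : ∃ m : ℕ, (x ^ m) t ∈ S := by
    obtain ⟨m, -, hm⟩ := (hst.symm).exists_pow_eq'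
    exact ⟨m, by rw [hm]; exact hs⟩
  have hagree : ∀ m ≤ Nat.find hex, (x ^ m) t = (y ^ m) t := by
    intro m
    induction m with
    | zero => simp
    | succ m ih =>
      intro hm
      rw [pow_succ', pow_succ', Equiv.Perm.mul_apply, Equiv.Perm.mul_apply, ← ih (by omega)]
      exact h _ (Nat.find_min hex (by omega))
  have h1 := Nat.find_spec hex
  have h2 : (x ^ Nat.find hex) t = s := by
    refine (hx.2 _ hs _ h1 ?_).symm
    exact hst.trans ⟨(Nat.find hex : ℤ), by simp⟩
  have h3 : (y ^ Nat.find hex) t = s := by rw [← hagree _ le_rfl, h2]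
  have h4 : y.SameCycle t s := ⟨(Nat.find hex : ℤ), by simpa using h3⟩
  have hu : y (y⁻¹ t) = t := by simp
  have huS : y⁻¹ t ∈ S := by
    by_contra hc
    have h5 := h _ hc
    rw [hu, ht] at h5
    have h6 := x.injective h5
    rw [← ht] at h6
    exact hc (h6 ▸ hs)
  have h7 : y.SameCycle (y⁻¹ t) s := by simpa using h4
  have := hy.2 _ huS _ hs h7
  rw [← this, hu]

lemma card_class_le {n : ℕ} (x : Perm (Fin n)) : cycleCount x ≤ n ∧
    Nat.card {y : Perm (Fin n) // IsConj x y} ≤ 2 ^ n * n ^ (n - cycleCount x) := by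
  classical
  obtain ⟨S, hS, hxS⟩ := exists_transv x
  refine ⟨by rw [← hS]; simpa using S.card_le_univ, ?_⟩
  have hT : ∀ y : {y : Perm (Fin n) // IsConj x y}, ∃ T : Finset (Fin n),
      T.card = cycleCount x ∧ IsTransv y.1 T := fun y => by
    obtain ⟨T, h1, h2⟩ := transv_conj hxS y.2
    exact ⟨T, h1.trans hS, h2⟩
  choose T hT1 hT2 using hT
  let F : {y : Perm (Fin n) // IsConj x y} →
      (Σ U : {U : Finset (Fin n) // U.card = cycleCount x}, ({a // a ∉ U.1} → Fin n)) :=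
    fun y => ⟨⟨T y, hT1 y⟩, fun a => y.1 a.1⟩
  have hF : Function.Injective F := by
    intro y z hyz
    have h1 : T y = T z := congrArg (fun p => p.1.1) hyz
    have h2 : ∀ a, a ∉ T y → y.1 a = z.1 a := by
      intro a ha
      have h3 : (fun p : (Σ U : {U : Finset (Fin n) // U.card = cycleCount x},
        ({a // a ∉ U.1} → Fin n)) => if h : a ∉ p.1.1 then p.2 ⟨a, h⟩ else a) (F y) = 
        (fun p : (Σ U : {U : Finset (Fin n) // U.card = cycleCount x},
        ({a // a ∉ U.1} → Fin n)) => if h : a ∉ p.1.1 then p.2 ⟨a, h⟩ else a) (F z) := by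
        rw [hyz]
      have ha' : a ∉ T z := h1 ▸ ha
      simpa [F, ha, ha'] using h3
    exact Subtype.ext (transv_inj (hT2 y) (h1 ▸ hT2 z) h2)
  refine (Nat.card_le_card_of_injective F hF).trans ?_
  rw [Nat.card_eq_fintype_card, Fintype.card_sigma]
  have : ∀ U : {U : Finset (Fin n) // U.card = cycleCount x},
      Fintype.card ({a // a ∉ U.1} → Fin n) = n ^ (n - cycleCount x) := by
    intro U
    rw [Fintype.card_fun, Fintype.card_fin, Fintype.card_subtype_compl, Fintype.card_fin,
      Fintype.card_coe, U.2]
  rw [Finset.sum_congr rfl fun U _ => this U, Finset.sum_const, smul_eq_mul]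
  refine Nat.mul_le_mul_right _ ?_
  refine (Fintype.card_subtype_le _).trans ?_
  simp

/-- For all `0 < ε < 1` and `0 < γ < 1` there is `N` such that for `n ≥ N`, any `x ∈ Sym(n)`
with `σ(x) ≥ (1 - (1-ε)γ) n` has conjugacy class of size less than `2 n⁴ (n!)^γ`. -/
theorem statement11 (ε γ : ℝ) (hε0 : 0 < ε) (hε1 : ε < 1) (hγ0 : 0 < γ) (hγ1 : γ < 1) :
    ∃ N : ℕ, ∀ n : ℕ, N ≤ n → ∀ x : Perm (Fin n),
      (1 - (1 - ε) * γ) * n ≤ (cycleCount x : ℝ) →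
      (Nat.card {y : Perm (Fin n) // IsConj x y} : ℝ) <
        2 * (n : ℝ) ^ 4 * (n.factorial : ℝ) ^ γ := by
  refine ⟨⌈Real.exp ((1 + γ) / (ε * γ))⌉₊ + 1, fun n hn x hx => ?_⟩
  obtain ⟨hle, hcard⟩ := card_class_le x
  have hn1 : 1 ≤ n := by omega
  have hnR : (1 : ℝ) ≤ n := by exact_mod_cast hn1
  have hn0 : (0 : ℝ) < n := by linarith
  have hlog : (1 + γ) / (ε * γ) ≤ Real.log n := by
    rw [Real.le_log_iff_exp_le hn0]
    refine (Nat.le_ceil _).trans ?_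
    exact_mod_cast (by omega : ⌈Real.exp ((1 + γ) / (ε * γ))⌉₊ ≤ n)
  have hlog' : 1 + γ ≤ ε * γ * Real.log n := by
    rw [div_le_iff₀ (by positivity)] at hlog
    linarith
  have hlog0 : 0 ≤ Real.log n := Real.log_nonneg hnR
  -- upper bound
  have hA : (Nat.card {y : Perm (Fin n) // IsConj x y} : ℝ) ≤
      Real.exp (n + (1 - ε) * γ * n * Real.log n) := by
    have h1 : (Nat.card {y : Perm (Fin n) // IsConj x y} : ℝ) ≤
        2 ^ n * (n : ℝ) ^ (n - cycleCount x) := by exact_mod_cast hcard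
    refine h1.trans ?_
    rw [Real.exp_add]
    have h2 : (2 : ℝ) ^ n ≤ Real.exp n := by
      have h0 : (2 : ℝ) ≤ Real.exp 1 := by
        have := Real.add_one_le_exp 1
        linarith
      calc (2 : ℝ) ^ n ≤ Real.exp 1 ^ n := by gcongr
        _ = Real.exp n := by rw [← Real.exp_nat_mul, mul_one]
    have h3 : (n : ℝ) ^ (n - cycleCount x) ≤ Real.exp ((1 - ε) * γ * n * Real.log n) := by
      have h4 : (n : ℝ) ^ (n - cycleCount x) =
          Real.exp (((n - cycleCount x : ℕ) : ℝ) * Real.log n) := by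
        rw [Real.exp_nat_mul, Real.exp_log hn0]
      rw [h4, Nat.cast_sub hle]
      apply Real.exp_le_exp.2
      apply mul_le_mul_of_nonneg_right _ hlog0
      linarith
    gcongr
  -- lower bound
  have hB : Real.exp (γ * (n * Real.log n - n)) ≤ (n.factorial : ℝ) ^ γ := by
    have hf : (0 : ℝ) < n.factorial := by exact_mod_cast n.factorial_pos
    have h1 := Real.pow_div_factorial_le_exp (n : ℝ) hn0.le n
    rw [mul_comm, Real.exp_mul]
    refine Real.rpow_le_rpow (Real.exp_pos _).le ?_ hγ0.le
    rw [Real.exp_sub, Real.exp_nat_mul, Real.exp_log hn0, div_le_iff₀ (Real.exp_pos _)]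
    rw [div_le_iff₀ hf] at h1
    linarith
  have hC : Real.exp (n + (1 - ε) * γ * n * Real.log n) ≤
      Real.exp (γ * (n * Real.log n - n)) := by
    apply Real.exp_le_exp.2
    have := mul_le_mul_of_nonneg_left hlog' hn0.le
    linarith
  have hp : (0 : ℝ) < (n.factorial : ℝ) ^ γ := lt_of_lt_of_le (Real.exp_pos _) hB
  have hq : (1 : ℝ) ≤ (n : ℝ) ^ 4 := one_le_pow₀ hnR
  calc (Nat.card {y : Perm (Fin n) // IsConj x y} : ℝ) ≤ (n.factorial : ℝ) ^ γ :=
        hA.trans (hC.trans hB)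
    _ < 2 * (n : ℝ) ^ 4 * (n.factorial : ℝ) ^ γ := by nlinarith
end

section
/- There exists a positive integer N (independent of k) such that the following holds for every m ≥ N and every integer ℓ with 1 ≤ ℓ < m/2. Let Ω be the set of ℓ-element subsets of {1,…,m}, so |Ω| = C(m,ℓ), and let Sym(m) act on Ω in the natural way and hence on the set S^Ω of functions Ω → S by permuting coordinates, where S is any finite set with |S| = k ≥ 2. Then the number of orbits of Sym(m) on S^Ω is strictly less than 2·max{ k^{(7/8)·C(m,ℓ)}, (m!)^{−0.58}·k^{C(m,ℓ)} }. -/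
open Equiv MulAction

lemma aux_fixed_fun {G Ω S : Type} [Group G] [MulAction G Ω] [Fintype Ω] [Finite S] (g : G)
    (hS : 2 ≤ Nat.card S) :
    ∃ c : ℕ, 2 * c ≤ Nat.card Ω + Nat.card (fixedBy Ω g) ∧
      Nat.card (fixedBy (Ω → S) g) ≤ Nat.card S ^ c := by
  classical
  let Q := orbitRel.Quotient (Subgroup.zpowers g) Ω
  let q : Ω → Q := fun x => Quotient.mk'' x
  have : Fintype Q := Fintype.ofFinite Q
  have hq : ∀ x, q (g • x) = q x := by
    intro x
    apply Quotient.sound'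
    exact ⟨⟨g, Subgroup.mem_zpowers g⟩, rfl⟩
  have hsurj : Function.Surjective q := Quotient.mk''_surjective
  refine ⟨Fintype.card Q, ?_, ?_⟩
  · have h1 : Nat.card Ω = ∑ b : Q, (Finset.univ.filter (fun x => q x = b)).card := by
      rw [Nat.card_eq_fintype_card, ← Finset.card_univ]
      exact Finset.card_eq_sum_card_fiberwise (fun _ _ => Finset.mem_univ _)
    have h2 : Nat.card (fixedBy Ω g) =
        ∑ b : Q, ((Finset.univ.filter (fun x => g • x = x)).filter (fun x => q x = b)).card := by
      rw [← Finset.card_eq_sum_card_fiberwise (fun _ _ => Finset.mem_univ _),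
        Nat.card_eq_fintype_card, ← Fintype.card_subtype]
      rfl
    rw [h1, h2, ← Finset.sum_add_distrib, mul_comm, ← smul_eq_mul, ← Finset.card_univ,
      ← Finset.sum_const]
    apply Finset.sum_le_sum
    intro b _
    obtain ⟨x, rfl⟩ := hsurj b
    by_cases hx : g • x = x
    · have a1 : 0 < (Finset.univ.filter (fun y => q y = q x)).card :=
        Finset.card_pos.2 ⟨x, by simp⟩
      have a2 : 0 < ((Finset.univ.filter (fun x => g • x = x)).filter
          (fun y => q y = q x)).card := Finset.card_pos.2 ⟨x, by simp [hx]⟩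
      omega
    · have a1 : 1 < (Finset.univ.filter (fun y => q y = q x)).card :=
        Finset.one_lt_card.2 ⟨g • x, by simp [hq], x, by simp, hx⟩
      omega
  · rw [← Nat.card_eq_fintype_card (α := Q), ← Nat.card_fun]
    refine Nat.card_le_card_of_injective
      (fun (f : fixedBy (Ω → S) g) (b : Q) => f.1 (Function.surjInv hsurj b)) ?_
    intro f₁ f₂ h
    have key : ∀ f : fixedBy (Ω → S) g, ∀ x y, q x = q y → f.1 x = f.1 y := by
      intro f x y hxy
      have hf : ∀ n : Subgroup.zpowers g, (n : G) • f.1 = f.1 := by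
        intro n
        have hg : g ∈ stabilizer G f.1 := f.2
        exact (Subgroup.zpowers_le.2 hg) n.2
      have hr : (orbitRel (Subgroup.zpowers g) Ω) x y := Quotient.exact' hxy
      obtain ⟨n, hn⟩ := hr
      have := congrFun (hf n) x
      rw [← this, ← hn]
      show f.1 ((n : G)⁻¹ • ((n : G) • y)) = f.1 y
      rw [inv_smul_smul]
    apply Subtype.ext
    funext x
    have e := congrFun h (q x)
    have hs := Function.surjInv_eq hsurj (q x)
    rw [← key f₁ _ _ hs, ← key f₂ _ _ hs]
    exact e

lemma aux_count (m ℓ : ℕ) (hℓ : 1 ≤ ℓ) (g : Perm (Fin m)) :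
    ℓ * (Finset.univ.filter (fun A : Finset (Fin m) => A.card = ℓ ∧ A.image g = A)).card ≤
      (Finset.univ.filter (fun x => g x = x)).card * (m - 1).choose (ℓ - 1)
        + m.choose (ℓ - 1) := by
  classical
  set I := Finset.univ.filter (fun A : Finset (Fin m) => A.card = ℓ ∧ A.image g = A) with hI
  set F := Finset.univ.filter (fun x => g x = x) with hF
  have h1 : ℓ * I.card = (I.sigma (fun A => A)).card := by
    rw [Finset.card_sigma, Finset.sum_congr rfl (g := fun _ => ℓ)
      (fun A hA => by simp [hI] at hA; exact hA.1)]
    simp [mul_comm]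
  rw [h1, ← Finset.card_filter_add_card_filter_not (fun p : (_ : Finset (Fin m)) × Fin m => g p.2 = p.2)]
  apply Nat.add_le_add
  · have : ((F.sigma (fun x => (Finset.univ.erase x).powersetCard (ℓ - 1)))).card
        = F.card * (m - 1).choose (ℓ - 1) := by
      rw [Finset.card_sigma]
      simp [Finset.card_powersetCard]
    rw [← this]
    apply Finset.card_le_card_of_injOn (fun p => ⟨p.2, p.1.erase p.2⟩)
    · rintro ⟨A, x⟩ hp
      simp [hI] at hp
      obtain ⟨⟨⟨hc, _⟩, hx⟩, hg⟩ := hp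
      simp [hF, hg, Finset.mem_powersetCard, Finset.card_erase_of_mem hx, hc,
        Finset.erase_subset_erase]
    · rintro ⟨A, x⟩ hp ⟨B, y⟩ hp' h
      simp at h hp hp'
      obtain ⟨rfl, h⟩ := h
      have : A = B := by
        rw [← Finset.insert_erase hp.1.2, ← Finset.insert_erase hp'.1.2, h]
      subst this; rfl
  · have : ((Finset.univ : Finset (Fin m)).powersetCard (ℓ - 1)).card = m.choose (ℓ - 1) := by
      simp
    rw [← this]
    apply Finset.card_le_card_of_injOn (fun p => p.1.erase p.2)
    · rintro ⟨A, x⟩ hp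
      simp [hI] at hp
      obtain ⟨⟨⟨hc, _⟩, hx⟩, hg⟩ := hp
      simp [Finset.mem_powersetCard, Finset.card_erase_of_mem hx, hc]
    · rintro ⟨A, x⟩ hp ⟨B, y⟩ hp' h
      simp [hI] at h hp hp'
      obtain ⟨⟨⟨hc, hA⟩, hx⟩, hg⟩ := hp
      obtain ⟨⟨⟨hc', hB⟩, hy⟩, hg'⟩ := hp'
      by_cases hxy : x = y
      · subst hxy
        have : A = B := by
          rw [← Finset.insert_erase hx, ← Finset.insert_erase hy, h]
        subst this; rfl
      · exfalso
        have gA : g x ∈ A := by rw [← hA]; exact Finset.mem_image_of_mem g hx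
        have h2 : g x ∈ B.erase y := by rw [← h]; exact Finset.mem_erase.2 ⟨hg, gA⟩
        have h3 : g x ∈ B.image g := by rw [hB]; exact Finset.mem_of_mem_erase h2
        obtain ⟨z, hz, hzx⟩ := Finset.mem_image.1 h3
        have hzx : z = x := g.injective hzx
        subst hzx
        have : z ∈ A.erase z := by rw [h]; exact Finset.mem_erase.2 ⟨hxy, hz⟩
        simp at this

lemma aux_fix (m ℓ : ℕ) (hℓ : 1 ≤ ℓ) (hm : 2 * ℓ < m) (g : Perm (Fin m)) :
    m * Nat.card (fixedBy {s : Finset (Fin m) // s.card = ℓ} g) ≤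
      ((Finset.univ.filter (fun x => g x = x)).card + 2) * m.choose ℓ := by
  classical
  have e : Nat.card (fixedBy {s : Finset (Fin m) // s.card = ℓ} g) =
      (Finset.univ.filter (fun A : Finset (Fin m) => A.card = ℓ ∧ A.image g = A)).card := by
    rw [← Fintype.card_subtype, ← Nat.card_eq_fintype_card]
    refine Nat.card_congr ⟨fun s => ⟨s.1.1, s.1.2, congrArg Subtype.val s.2⟩,
      fun s => ⟨⟨s.1, s.2.1⟩, Subtype.ext s.2.2⟩, fun _ => rfl, fun _ => rfl⟩
  have h := aux_count m ℓ hℓ g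
  rw [← e] at h
  set X := Nat.card (fixedBy {s : Finset (Fin m) // s.card = ℓ} g)
  set f := (Finset.univ.filter (fun x => g x = x)).card
  obtain ⟨l, rfl⟩ : ∃ l, ℓ = l + 1 := ⟨ℓ - 1, by omega⟩
  obtain ⟨n, rfl⟩ : ∃ n, m = n + 1 := ⟨m - 1, by omega⟩
  simp only [Nat.add_sub_cancel] at h
  have h1 := Nat.add_one_mul_choose_eq n l
  have h2 := Nat.choose_succ_right_eq (n + 1) l
  have h3 : (n + 1) * (n + 1).choose l ≤ 2 * ((n + 1).choose (l + 1) * (l + 1)) := by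
    rw [h2]
    have : n + 1 ≤ 2 * (n + 1 - l) := by omega
    nlinarith [Nat.zero_le ((n + 1).choose l)]
  have : (l + 1) * ((n + 1) * X) ≤ (l + 1) * ((f + 2) * (n + 1).choose (l + 1)) := by
    have := Nat.mul_le_mul_left (n + 1) h
    nlinarith
  exact Nat.le_of_mul_le_mul_left this (by omega)

lemma aux_perms (m s : ℕ) (hs : s ≤ m) :
    (Finset.univ.filter (fun g : Perm (Fin m) =>
      (Finset.univ.filter (fun x => g x ≠ x)).card ≤ s)).card ≤ 2 ^ m * s.factorial := by
  classical
  have hsub : (Finset.univ.filter (fun g : Perm (Fin m) =>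
      (Finset.univ.filter (fun x => g x ≠ x)).card ≤ s)) ⊆
      ((Finset.univ : Finset (Fin m)).powersetCard s).biUnion
        (fun T => Finset.univ.filter (fun g : Perm (Fin m) => ∀ x, x ∉ T → g x = x)) := by
    intro g hg
    simp only [Finset.mem_filter, Finset.mem_univ, true_and] at hg
    obtain ⟨T, hT, hc⟩ := Finset.exists_superset_card_eq hg (by simpa using hs)
    simp only [Finset.mem_biUnion, Finset.mem_powersetCard, Finset.mem_filter, Finset.mem_univ,
      true_and]
    refine ⟨T, ⟨Finset.subset_univ _, hc⟩, fun x hx => ?_⟩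
    by_contra hne
    exact hx (hT (by simpa using hne))
  refine (Finset.card_le_card hsub).trans ?_
  refine (Finset.card_biUnion_le_card_mul _ _ s.factorial ?_).trans ?_
  · intro T hT
    have hT := (Finset.mem_powersetCard.1 hT).2
    rw [← Fintype.card_subtype]
    have e := Fintype.card_congr (Equiv.Perm.subtypeEquivSubtypePerm (fun x => x ∈ T))
    rw [← e, Fintype.card_perm]
    simp [hT]
  · apply Nat.mul_le_mul_right
    refine (Finset.card_le_card (Finset.subset_univ _)).trans ?_
    simp

lemma aux_analysis (m : ℕ) (hm : 59049 ≤ m) :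
    ((2 ^ m * ((m + 7) / 4).factorial : ℕ) : ℝ) ≤ (m.factorial : ℝ) ^ (0.42 : ℝ) := by
  have hm' : (59049 : ℝ) ≤ m := by exact_mod_cast hm
  have hm0 : (0 : ℝ) < m := by linarith
  have hf0 : (0 : ℝ) < m.factorial := by exact_mod_cast m.factorial_pos
  have hL : (10 : ℝ) ≤ Real.log m := by
    rw [Real.le_log_iff_exp_le hm0]
    have : Real.exp 10 = Real.exp 1 ^ (10 : ℕ) := by rw [← Real.exp_nat_mul]; norm_num
    rw [this]
    have h3 : Real.exp 1 ≤ 3 := by linarith [Real.exp_one_lt_d9]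
    calc Real.exp 1 ^ 10 ≤ (3 : ℝ) ^ 10 := by gcongr
      _ ≤ (m : ℝ) := by linarith
  have hfac : m * Real.log m - m ≤ Real.log m.factorial := by
    have h := Real.pow_div_factorial_le_exp (m : ℝ) hm0.le m
    have h' := Real.log_le_log (by positivity) h
    rw [Real.log_exp, Real.log_div (by positivity) (by positivity), Real.log_pow] at h'
    linarith
  set s := (m + 7) / 4 with hs
  have hsm : s ≤ m := by omega
  have hs4 : (s : ℝ) ≤ (m + 7) / 4 := by
    have : 4 * s ≤ m + 7 := by omega
    have : (4 : ℝ) * s ≤ m + 7 := by exact_mod_cast this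
    linarith
  have hsf : Real.log s.factorial ≤ s * Real.log m := by
    rw [← Real.log_pow]
    apply Real.log_le_log (by exact_mod_cast s.factorial_pos)
    have : s.factorial ≤ m ^ s := (Nat.factorial_le_pow s).trans (Nat.pow_le_pow_left hsm s)
    exact_mod_cast this
  have hs0 : (0 : ℝ) < s.factorial := by exact_mod_cast s.factorial_pos
  rw [← Real.log_le_log_iff (by positivity) (by positivity), Real.log_rpow hf0]
  push_cast
  rw [Real.log_mul (by positivity) (by positivity), Real.log_pow]
  have l2 := Real.log_two_lt_d9
  have a1 : (s : ℝ) * Real.log m ≤ (m + 7) / 4 * Real.log m := by gcongr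
  have a2 : (m : ℝ) * Real.log 2 ≤ m * 0.7 := by gcongr; linarith
  nlinarith [mul_le_mul_of_nonneg_left hL (by linarith : (0:ℝ) ≤ 0.17 * m - 7/4)]

/-- There is `N` (independent of `k`) such that for all `m ≥ N`, `1 ≤ ℓ < m/2`, and any
finite set `S` with `|S| = k ≥ 2`, the number of orbits of `Sym(m)` on the functions
`Ω → S` (where `Ω` is the set of `ℓ`-subsets of `{1,…,m}`) is less than
`2 max{k^{(7/8) C(m,ℓ)}, (m!)^{-0.58} k^{C(m,ℓ)}}`. -/
theorem statement14 :
    ∃ N : ℕ, 0 < N ∧ ∀ m : ℕ, N ≤ m → ∀ ℓ : ℕ, 1 ≤ ℓ → 2 * ℓ < m →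
      ∀ k : ℕ, 2 ≤ k → ∀ (S : Type) [Finite S], Nat.card S = k →
      (orbitCount (Perm (Fin m)) ({s : Finset (Fin m) // s.card = ℓ} → S) : ℝ) <
        2 * max ((k : ℝ) ^ ((7 / 8 : ℝ) * (m.choose ℓ : ℝ)))
          ((m.factorial : ℝ) ^ (-(0.58 : ℝ)) * (k : ℝ) ^ (m.choose ℓ)) := by
  classical
  refine ⟨59049, by norm_num, ?_⟩
  intro m hm ℓ hℓ hlm k hk S _ hS
  have : Fintype S := Fintype.ofFinite S
  set Ω := {s : Finset (Fin m) // s.card = ℓ} with hΩ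
  have hC : Nat.card Ω = m.choose ℓ := by
    rw [Nat.card_eq_fintype_card]
    exact (Fintype.card_finset_len ℓ).trans (by rw [Fintype.card_fin])
  set C := m.choose ℓ with hCdef
  have hCpos : 0 < C := Nat.choose_pos (by omega)
  set A : ℝ := (k : ℝ) ^ ((7 / 8 : ℝ) * (C : ℝ)) with hA
  set B : ℝ := (m.factorial : ℝ) ^ (-(0.58 : ℝ)) * (k : ℝ) ^ C with hB
  have hk1 : (1 : ℝ) ≤ k := by exact_mod_cast (by omega : 1 ≤ k)
  have hA0 : 0 < A := by positivity
  have hf0 : (0 : ℝ) < m.factorial := by exact_mod_cast m.factorial_pos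
  let bad : Perm (Fin m) → Prop := fun g => 3 * C < 4 * Nat.card (fixedBy Ω g)
  have burn : (orbitCount (Perm (Fin m)) (Ω → S) : ℝ) * m.factorial =
      ∑ g : Perm (Fin m), (Nat.card (fixedBy (Ω → S) g) : ℝ) := by
    have : Fintype (orbitRel.Quotient (Perm (Fin m)) (Ω → S)) := Fintype.ofFinite _
    have h := MulAction.sum_card_fixedBy_eq_card_orbits_mul_card_group (Perm (Fin m)) (Ω → S)
    simp only [← Nat.card_eq_fintype_card] at h
    rw [Nat.card_perm, Nat.card_fin] at h
    exact_mod_cast h.symm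
  have hbound : ∀ g : Perm (Fin m), (Nat.card (fixedBy (Ω → S) g) : ℝ) ≤
      if bad g then (k : ℝ) ^ C else A := by
    intro g
    obtain ⟨c, hc1, hc2⟩ := aux_fixed_fun (Ω := Ω) (S := S) g (by omega)
    rw [hS] at hc2
    rw [hC] at hc1
    have hc2' : (Nat.card (fixedBy (Ω → S) g) : ℝ) ≤ (k : ℝ) ^ c := by exact_mod_cast hc2
    have hfixle : Nat.card (fixedBy Ω g) ≤ C := by
      rw [← hC]; exact Nat.card_le_card_of_injective _ Subtype.val_injective
    refine hc2'.trans ?_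
    split_ifs with hb
    · exact pow_le_pow_right₀ hk1 (by omega)
    · rw [hA, ← Real.rpow_natCast]
      apply Real.rpow_le_rpow_of_exponent_le hk1
      have : 8 * c ≤ 7 * C := by simp only [bad] at hb; omega
      have : (8 : ℝ) * c ≤ 7 * C := by exact_mod_cast this
      linarith
  have hbad : ((Finset.univ.filter bad).card : ℝ) ≤ (m.factorial : ℝ) ^ (0.42 : ℝ) := by
    refine le_trans ?_ (aux_analysis m hm)
    norm_cast
    refine le_trans (Finset.card_le_card ?_) (aux_perms m ((m + 7) / 4) (by omega))
    intro g hg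
    simp only [Finset.mem_filter, Finset.mem_univ, true_and, bad] at hg ⊢
    have h1 := aux_fix m ℓ hℓ hlm g
    have h2 := Finset.card_filter_add_card_filter_not (s := (Finset.univ : Finset (Fin m)))
      (fun x => g x = x)
    rw [Finset.card_univ, Fintype.card_fin] at h2
    set f := (Finset.univ.filter (fun x => g x = x)).card
    have h3 : C * (3 * m) < C * (4 * (f + 2)) := by
      have : m * (3 * C) < m * (4 * Nat.card (fixedBy Ω g)) :=
        Nat.mul_lt_mul_of_pos_left hg (by omega)
      nlinarith
    have h4 := Nat.lt_of_mul_lt_mul_left h3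
    have h5 : (Finset.univ.filter (fun x => g x ≠ x)).card = m - f := by
      simp only [ne_eq]; omega
    rw [h5]
    omega
  have hgood : ((Finset.univ.filter (fun g => ¬ bad g)).card : ℝ) < m.factorial := by
    norm_cast
    have : m.factorial = (Finset.univ : Finset (Perm (Fin m))).card := by
      rw [Finset.card_univ, Fintype.card_perm, Fintype.card_fin]
    rw [this]
    apply Finset.card_lt_card
    rw [Finset.filter_ssubset]
    refine ⟨1, Finset.mem_univ _, ?_⟩
    simp only [bad, not_not]
    have : fixedBy Ω (1 : Perm (Fin m)) = Set.univ := by ext x; simp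
    rw [this, Nat.card_univ, hC]
    omega
  have hsum : (orbitCount (Perm (Fin m)) (Ω → S) : ℝ) * m.factorial <
      (A + B) * m.factorial := by
    rw [burn]
    refine (Finset.sum_le_sum (fun g _ => hbound g)).trans_lt ?_
    rw [Finset.sum_ite, Finset.sum_const, Finset.sum_const, nsmul_eq_mul, nsmul_eq_mul]
    have e : B * m.factorial = (m.factorial : ℝ) ^ (0.42 : ℝ) * (k : ℝ) ^ C := by
      have : (m.factorial : ℝ) ^ (0.42 : ℝ) = (m.factorial : ℝ) ^ (-(0.58 : ℝ)) * m.factorial := by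
        rw [← Real.rpow_add_one hf0.ne']; norm_num
      rw [this, hB]; ring
    rw [add_mul, e]
    have b1 := mul_le_mul_of_nonneg_right hbad (by positivity : (0 : ℝ) ≤ (k : ℝ) ^ C)
    have b2 := mul_lt_mul_of_pos_right hgood hA0
    linarith
  have := lt_of_mul_lt_mul_right hsum hf0.le
  linarith [le_max_left A B, le_max_right A B]
end
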